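/- arXiv:2604.11682 — 2 statements merged into one kernel-verified Lean document; each statement's English description precedes it below -/
import Mathlib

section
/- Triple-overlap bound for down-up neighbourhoods of high-degree vertices. Under assumptions (A1) and (A2), for every ν > 0 and every x_1 ∈ V_ν^(h), with ν-high probability Σ_{x_2, x_3 ∈ V_ν^(h), x_2 ≺ x_1, x_2 ≺ x_3} ⟨1_{S_1^du(x_1)}, 1_{S_1^du(x_2)}⟩ · ⟨1_{S_1^du(x_2)∖S_1^du(x_1)}, 1_{S_1^du(x_3)}⟩ ≤ 2ν (log N / log log N)². -/
open MeasureTheory Real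

namespace GRG

variable {N : ℕ}

/-! ### Generic graph-theoretic definitions over an adjacency relation on `Fin N` -/

/-- The degree of a vertex with respect to an adjacency relation. -/
noncomputable def degA (A : Fin N → Fin N → Prop) (x : Fin N) : ℕ :=
  {y | A x y}.ncard

/-- The strict total order `≺`: `x ≺ y` iff `D_x < D_y`, or `D_x = D_y` and `x > y`. -/
def precA (A : Fin N → Fin N → Prop) (x y : Fin N) : Prop :=
  degA A x < degA A y ∨ (degA A x = degA A y ∧ y < x)

/-- `γ 0, γ 1, …, γ l` is a path for the adjacency relation `A`. -/
def IsPathOn (A : Fin N → Fin N → Prop) (l : ℕ) (γ : ℕ → Fin N) : Prop :=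
  ∀ i < l, A (γ i) (γ (i + 1))

/-- A path of length `l` is simple: all vertices distinct except possibly endpoints. -/
def IsSimplePath (l : ℕ) (γ : ℕ → Fin N) : Prop :=
  ∀ i j, i < j → j ≤ l → ¬(i = 0 ∧ j = l) → γ i ≠ γ j

/-- Two paths are edge-disjoint. -/
def EdgeDisjoint (l l' : ℕ) (γ γ' : ℕ → Fin N) : Prop :=
  ∀ i < l, ∀ j < l',
    ¬((γ i = γ' j ∧ γ (i + 1) = γ' (j + 1)) ∨ (γ i = γ' (j + 1) ∧ γ (i + 1) = γ' j))

/-- `S_1^cyc(x)`: neighbours of `x` that start a simple cycle through `x`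
of length at most `2r+1`. -/
def S1cycA (A : Fin N → Fin N → Prop) (r : ℕ) (x : Fin N) : Set (Fin N) :=
  {y | A x y ∧ ∃ l γ, 3 ≤ l ∧ l ≤ 2 * r + 1 ∧ γ 0 = x ∧ γ 1 = y ∧ γ l = x ∧
    IsPathOn A l γ ∧ IsSimplePath l γ}

/-- `S_1^du(x)`: neighbours `y ∉ S_1^cyc(x)` of `x` that have a neighbour
`z ∉ S_1^cyc(y)` with `y ≺ x ≺ z`. -/
def S1duA (A : Fin N → Fin N → Prop) (r : ℕ) (x : Fin N) : Set (Fin N) :=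
  {y | A x y ∧ y ∉ S1cycA A r x ∧ precA A y x ∧
    ∃ z, A y z ∧ z ∉ S1cycA A r y ∧ precA A x z}

/-- Adjacency in the graph `G^nc` (after removing the cycle-creating edges). -/
def AdjNCA (A : Fin N → Fin N → Prop) (r : ℕ) (x y : Fin N) : Prop :=
  A x y ∧ y ∉ S1cycA A r x ∧ x ∉ S1cycA A r y

/-- Adjacency in the pruned graph `G^p` (after further removing the down-up edges). -/
def AdjPA (A : Fin N → Fin N → Prop) (r : ℕ) (x y : Fin N) : Prop :=
  AdjNCA A r x y ∧ y ∉ S1duA A r x ∧ x ∉ S1duA A r y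

/-- Degree in the pruned graph. -/
noncomputable def degPA (A : Fin N → Fin N → Prop) (r : ℕ) (x : Fin N) : ℕ :=
  {y | AdjPA A r x y}.ncard

/-- `S_1^{p−}(x)`: pruned-graph neighbours of `x` that are smaller than `x` for `≺`. -/
def S1pmA (A : Fin N → Fin N → Prop) (r : ℕ) (x : Fin N) : Set (Fin N) :=
  {y | AdjPA A r x y ∧ precA A y x}

/-- `D_x^{p−}`. -/
noncomputable def degPmA (A : Fin N → Fin N → Prop) (r : ℕ) (x : Fin N) : ℕ :=
  (S1pmA A r x).ncard

/-- `Sib^−(x)`: the smaller siblings of `x` (children of the parent of `x`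
that are smaller than `x`). -/
def SibmA (A : Fin N → Fin N → Prop) (r : ℕ) (x : Fin N) : Set (Fin N) :=
  {y | ∃ p, AdjPA A r x p ∧ precA A x p ∧ AdjPA A r p y ∧ precA A y p ∧ precA A y x}

/-- The normalization constant `Z_x` (note `2/0 = 0` in Lean, so this agrees with the
convention `Z_x = 2` when `Sib^−(x) = ∅`). -/
noncomputable def ZxA (A : Fin N → Fin N → Prop) (r : ℕ) (x : Fin N) : ℝ :=
  2 + 2 / (SibmA A r x).ncard

/-- The indicator vector of a set of vertices. -/
noncomputable def indVec (S : Set (Fin N)) : Fin N → ℝ :=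
  S.indicator 1

/-- The approximate eigenvector `u_σ(x)`. -/
noncomputable def uVecA (A : Fin N → Fin N → Prop) (r : ℕ) (σ : ℝ) (x : Fin N) :
    Fin N → ℝ := fun y =>
  (Real.sqrt (ZxA A r x))⁻¹ *
    (indVec {x} y + σ * (Real.sqrt (degPmA A r x))⁻¹ * indVec (S1pmA A r x) y -
      indVec (SibmA A r x) y / (SibmA A r x).ncard)

/-- The star vector `v_σ(x)`. -/
noncomputable def vVecA (A : Fin N → Fin N → Prop) (r : ℕ) (σ : ℝ) (x : Fin N) :
    Fin N → ℝ := fun y =>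
  (Real.sqrt 2)⁻¹ *
    (indVec {x} y + σ * (Real.sqrt (degPmA A r x))⁻¹ * indVec (S1pmA A r x) y)

/-- Euclidean scalar product on `ℝ^N`. -/
noncomputable def dotR (f g : Fin N → ℝ) : ℝ := ∑ y, f y * g y

/-- The Euclidean (`ℓ² → ℓ²`) operator norm of an `N × N` real matrix. -/
noncomputable def opNorm (M : Matrix (Fin N) (Fin N) ℝ) : ℝ :=
  ‖Matrix.toEuclideanCLM (𝕜 := ℝ) M‖

open Classical in
/-- The adjacency matrix of the pruned graph. -/
noncomputable def adjMatrixPA (A : Fin N → Fin N → Prop) (r : ℕ) :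
    Matrix (Fin N) (Fin N) ℝ := fun x y => if AdjPA A r x y then 1 else 0

/-- The threshold `ξ_ν`. -/
noncomputable def xi (ν δ : ℝ) (N : ℕ) : ℝ :=
  3 * (ν + 1) * (2 - 3 * δ) / ((1 - δ) * (1 - 2 * δ)) *
    (Real.log N / Real.log (Real.log N))

/-- The set `V_ν^{(h)}` of high-degree vertices. -/
def VhA (A : Fin N → Fin N → Prop) (ν δ : ℝ) : Set (Fin N) :=
  {x | xi ν δ N ≤ (degA A x : ℝ)}

/-- The projection `Π^p` onto the span of the vectors `u_σ(x)`, `x ∈ V_ν^{(h)}`. -/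
noncomputable def PiPA (A : Fin N → Fin N → Prop) (r : ℕ) (ν δ : ℝ) :
    Matrix (Fin N) (Fin N) ℝ :=
  ∑ x : Fin N, Set.indicator (VhA A ν δ) (fun _ => (1 : ℝ)) x •
    (Matrix.vecMulVec (uVecA A r 1 x) (uVecA A r 1 x) +
      Matrix.vecMulVec (uVecA A r (-1) x) (uVecA A r (-1) x))

/-- The block-diagonal approximation `Â`. -/
noncomputable def AhatA (A : Fin N → Fin N → Prop) (r : ℕ) (ν δ : ℝ) :
    Matrix (Fin N) (Fin N) ℝ :=
  (∑ x : Fin N, Set.indicator (VhA A ν δ) (fun _ => (1 : ℝ)) x •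
    (Real.sqrt (degPmA A r x) •
      (Matrix.vecMulVec (uVecA A r 1 x) (uVecA A r 1 x) -
        Matrix.vecMulVec (uVecA A r (-1) x) (uVecA A r (-1) x)))) +
  (1 - PiPA A r ν δ) * adjMatrixPA A r * (1 - PiPA A r ν δ)

/-! ### The generalized random graph (GRG) model -/

/-- Index set of potential edges. -/
abbrev EdgeIdx (N : ℕ) := {p : Fin N × Fin N // p.1 < p.2}

/-- The edge probabilities `p_{xy} = w_x w_y / (Σ_z w_z + w_x w_y)`. -/
noncomputable def pGRG (w : Fin N → ℝ) (x y : Fin N) : ℝ :=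
  w x * w y / ((∑ z, w z) + w x * w y)

/-- Bernoulli measure with parameter `p` on `Bool`. -/
noncomputable def bern (p : ℝ) : Measure Bool :=
  ENNReal.ofReal p • Measure.dirac true + ENNReal.ofReal (1 - p) • Measure.dirac false

instance (p : ℝ) : IsFiniteMeasure (bern p) := by
  constructor
  simp only [bern, Measure.coe_add, Measure.coe_smul, Pi.add_apply, Pi.smul_apply,
    smul_eq_mul, measure_univ, mul_one]
  exact ENNReal.add_lt_top.mpr ⟨ENNReal.ofReal_lt_top, ENNReal.ofReal_lt_top⟩

/-- The law of the GRG: independent Bernoulli edge indicators. -/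
noncomputable def grgMeasure (w : Fin N → ℝ) : Measure (EdgeIdx N → Bool) :=
  Measure.pi fun e => bern (pGRG w e.val.1 e.val.2)

/-- The (random) adjacency matrix. -/
noncomputable def adjMatrix (ω : EdgeIdx N → Bool) : Matrix (Fin N) (Fin N) ℝ :=
  fun x y =>
    if h : x < y then (if ω ⟨(x, y), h⟩ then 1 else 0)
    else if h' : y < x then (if ω ⟨(y, x), h'⟩ then 1 else 0)
    else 0

/-- The (random) adjacency relation. -/
def Adj (ω : EdgeIdx N → Bool) (x y : Fin N) : Prop := adjMatrix ω x y = 1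

/-- The (random) degree `D_x`. -/
noncomputable def deg (ω : EdgeIdx N → Bool) (x : Fin N) : ℕ := degA (Adj ω) x

/-- The first empirical moment `m_1`. -/
noncomputable def m1 (w : Fin N → ℝ) : ℝ := (∑ x, w x) / N

/-- The second empirical moment `m_2`. -/
noncomputable def m2 (w : Fin N → ℝ) : ℝ := (∑ x, w x ^ 2) / N

/-- The expected degree `d_x = E[D_x]`. -/
noncomputable def dExp (w : Fin N → ℝ) (x : Fin N) : ℝ :=
  ∫ ω, (deg ω x : ℝ) ∂(grgMeasure w)

/-- The set `W_{λ,η}` of resonant vertices. -/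
def resonant (ω : EdgeIdx N → Bool) (lam η : ℝ) : Set (Fin N) :=
  {x | |Real.sqrt (deg ω x) - lam| ≤ η}

/-- The set `V*_{ν,η}` of isolated vertices. -/
noncomputable def Vstar (w : Fin N → ℝ) (ν η : ℝ) : Set (Fin N) :=
  {x | (4 * ν / 9) * Real.log N ≤ dExp w x ∧
    ∀ y, y ≠ x →
      max (4 * Real.sqrt (ν * Real.log N * dExp w x) +
            4 * Real.sqrt (ν * Real.log N * dExp w y))
          (16 * η ^ 2) ≤ |dExp w x - dExp w y|}

end GRG


set_option linter.unusedSectionVars false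
namespace TOB
open MvPolynomial

section Poly
variable {E : Type*} [DecidableEq E]

/-- Exponent vector of a squarefree monomial. -/
noncomputable def ind (S : Finset E) : E →₀ ℕ := Finsupp.indicator S (fun _ _ => 1)

lemma ind_apply (S : Finset E) (e : E) : ind S e = if e ∈ S then 1 else 0 := by
  simp [ind, Finsupp.indicator_apply]

lemma ind_inj {S T : Finset E} (h : ind S = ind T) : S = T := by
  ext e
  have := DFunLike.congr_fun h e
  rw [ind_apply, ind_apply] at this
  split_ifs at this <;> simp_all

lemma ind_union {S T : Finset E} (h : Disjoint S T) : ind (S ∪ T) = ind S + ind T := by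
  ext e
  simp only [ind_apply, Finsupp.add_apply, Finset.mem_union]
  by_cases h1 : e ∈ S <;> by_cases h2 : e ∈ T <;> simp [h1, h2]
  exact (Finset.disjoint_left.mp h h1 h2).elim

lemma ind_empty : ind (∅ : Finset E) = 0 := by
  ext e; simp [ind_apply]

/-- Nonnegative coefficients. -/
def NN (P : MvPolynomial E ℝ) : Prop := ∀ m, 0 ≤ coeff m P

/-- Sum of the squarefree coefficients supported on `ω`. -/
noncomputable def ev (ω : Finset E) (P : MvPolynomial E ℝ) : ℝ :=
  ∑ S ∈ ω.powerset, coeff (ind S) P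

lemma NN.add {P Q : MvPolynomial E ℝ} (hP : NN P) (hQ : NN Q) : NN (P + Q) := fun m => by
  rw [coeff_add]; exact add_nonneg (hP m) (hQ m)

lemma NN.mul {P Q : MvPolynomial E ℝ} (hP : NN P) (hQ : NN Q) : NN (P * Q) := fun m => by
  rw [coeff_mul]; exact Finset.sum_nonneg fun i _ => mul_nonneg (hP _) (hQ _)

lemma NN_C {c : ℝ} (hc : 0 ≤ c) : NN (C c : MvPolynomial E ℝ) := fun m => by
  rw [coeff_C]; split_ifs <;> simp [hc]

lemma NN_one : NN (1 : MvPolynomial E ℝ) := by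
  simpa using NN_C (E := E) (c := 1) zero_le_one

lemma NN_zero : NN (0 : MvPolynomial E ℝ) := fun m => by simp

lemma NN_X (e : E) : NN (X e : MvPolynomial E ℝ) := fun m => by
  rw [coeff_X]; split_ifs <;> simp

lemma NN_sum {ι : Type*} (t : Finset ι) (P : ι → MvPolynomial E ℝ) (h : ∀ i ∈ t, NN (P i)) :
    NN (∑ i ∈ t, P i) := fun m => by
  rw [coeff_sum]; exact Finset.sum_nonneg fun i hi => h i hi m

lemma NN_prod {ι : Type*} (t : Finset ι) (P : ι → MvPolynomial E ℝ) (h : ∀ i ∈ t, NN (P i)) :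
    NN (∏ i ∈ t, P i) := by
  classical
  induction t using Finset.induction_on with
  | empty => simpa using NN_one
  | insert a s ha ih =>
    rw [Finset.prod_insert ha]
    exact (h a (by simp)).mul (ih fun i hi => h i (by simp [hi]))

lemma NN_prod_sub_one {ι : Type*} (t : Finset ι) (P : ι → MvPolynomial E ℝ)
    (h : ∀ i ∈ t, NN (P i)) : NN (∏ i ∈ t, (1 + P i) - 1) := by
  classical
  induction t using Finset.induction_on with
  | empty => simpa using NN_zero
  | insert a s ha ih =>
    rw [Finset.prod_insert ha]
    have e : (1 + P a) * ∏ i ∈ s, (1 + P i) - 1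
        = (∏ i ∈ s, (1 + P i) - 1) + P a * ∏ i ∈ s, (1 + P i) := by ring
    rw [e]
    have h' : ∀ i ∈ s, NN (P i) := fun i hi => h i (by simp [hi])
    exact (ih h').add ((h a (by simp)).mul (NN_prod _ _ fun i hi => NN_one.add (h' i hi)))

lemma ev_add (ω : Finset E) (P Q : MvPolynomial E ℝ) : ev ω (P + Q) = ev ω P + ev ω Q := by
  simp [ev, Finset.sum_add_distrib]

lemma ev_sub (ω : Finset E) (P Q : MvPolynomial E ℝ) : ev ω (P - Q) = ev ω P - ev ω Q := by
  simp [ev, Finset.sum_sub_distrib]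

lemma ev_sum {ι : Type*} (ω : Finset E) (t : Finset ι) (P : ι → MvPolynomial E ℝ) :
    ev ω (∑ i ∈ t, P i) = ∑ i ∈ t, ev ω (P i) := by
  simp only [ev, coeff_sum]
  rw [Finset.sum_comm]

lemma ev_C_mul (ω : Finset E) (c : ℝ) (P : MvPolynomial E ℝ) : ev ω (C c * P) = c * ev ω P := by
  simp [ev, coeff_C_mul, Finset.mul_sum]

lemma ev_one (ω : Finset E) : ev ω (1 : MvPolynomial E ℝ) = 1 := by
  unfold ev
  rw [Finset.sum_eq_single ∅]
  · simp [ind_empty]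
  · intro S _ hS
    rw [coeff_one, if_neg]
    intro h
    exact hS (ind_inj (by rw [← h, ind_empty]))
  · simp

lemma ev_nonneg (ω : Finset E) {P : MvPolynomial E ℝ} (hP : NN P) : 0 ≤ ev ω P :=
  Finset.sum_nonneg fun _ _ => hP _

lemma ev_mono {ω ω' : Finset E} (h : ω ⊆ ω') {P : MvPolynomial E ℝ} (hP : NN P) :
    ev ω P ≤ ev ω' P :=
  Finset.sum_le_sum_of_subset_of_nonneg (Finset.powerset_mono.mpr h) fun _ _ _ => hP _

lemma ev_X {ω : Finset E} {e : E} (h : e ∈ ω) : 1 ≤ ev ω (X e : MvPolynomial E ℝ) := by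
  unfold ev
  have h1 : ind {e} = Finsupp.single e 1 := by
    ext f; simp [ind_apply, Finsupp.single_apply, eq_comm]
  calc (1:ℝ) = coeff (ind {e}) (X e : MvPolynomial E ℝ) := by rw [h1, coeff_X, if_pos rfl]
    _ ≤ _ := Finset.single_le_sum (f := fun S => coeff (ind S) (X e : MvPolynomial E ℝ))
      (fun S _ => NN_X e _) (by simpa using h)

lemma ev_mul_ge {ω ω₁ ω₂ : Finset E} (h₁ : ω₁ ⊆ ω) (h₂ : ω₂ ⊆ ω) (hd : Disjoint ω₁ ω₂)
    {P Q : MvPolynomial E ℝ} (hP : NN P) (hQ : NN Q) :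
    ev ω₁ P * ev ω₂ Q ≤ ev ω (P * Q) := by
  unfold ev
  simp only [coeff_mul]
  rw [Finset.sum_mul_sum, ← Finset.sum_product', Finset.sum_sigma']
  let i : Finset E × Finset E → (_ : Finset E) × ((E →₀ ℕ) × (E →₀ ℕ)) :=
    fun p => ⟨p.1 ∪ p.2, (ind p.1, ind p.2)⟩
  have hinj : Function.Injective i := by
    rintro ⟨a, b⟩ ⟨c, d⟩ h
    simp only [i, Sigma.mk.injEq, heq_eq_eq, Prod.mk.injEq] at h
    rw [ind_inj h.2.1, ind_inj h.2.2]
  rw [← Finset.sum_image (s := ω₁.powerset ×ˢ ω₂.powerset) (g := i)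
    (f := fun x => coeff x.2.1 P * coeff x.2.2 Q) hinj.injOn]
  refine Finset.sum_le_sum_of_subset_of_nonneg ?_ fun _ _ _ => mul_nonneg (hP _) (hQ _)
  intro x hx
  obtain ⟨⟨a, b⟩, hab, rfl⟩ := Finset.mem_image.mp hx
  simp only [Finset.mem_product, Finset.mem_powerset] at hab
  simp only [i, Finset.mem_sigma, Finset.mem_powerset]
  exact ⟨Finset.union_subset (hab.1.trans h₁) (hab.2.trans h₂),
    Finset.HasAntidiagonal.mem_antidiagonal.mpr (ind_union (Finset.disjoint_of_subset_left hab.1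
      (Finset.disjoint_of_subset_right hab.2 hd))).symm⟩

lemma ev_prod_ge {ι : Type*} (t : Finset ι) (P : ι → MvPolynomial E ℝ)
    (f : ι → Finset E) (ω : Finset E)
    (hP : ∀ i ∈ t, NN (P i)) (hs : ∀ i ∈ t, f i ⊆ ω)
    (hd : ∀ i ∈ t, ∀ j ∈ t, i ≠ j → Disjoint (f i) (f j)) :
    ∏ i ∈ t, ev (f i) (P i) ≤ ev ω (∏ i ∈ t, P i) := by
  classical
  induction t using Finset.induction_on generalizing ω with
  | empty => simp [ev_one]
  | insert a s ha ih =>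
    rw [Finset.prod_insert ha, Finset.prod_insert ha]
    have hP' : ∀ i ∈ s, NN (P i) := fun i hi => hP i (by simp [hi])
    have h1 := ih (s.biUnion f) hP' (fun i hi => Finset.subset_biUnion_of_mem f hi)
      (fun i hi j hj => hd i (by simp [hi]) j (by simp [hj]))
    refine (mul_le_mul_of_nonneg_left h1 (ev_nonneg _ (hP a (by simp)))).trans ?_
    refine ev_mul_ge (hs a (by simp)) ?_ ?_ (hP a (by simp)) (NN_prod _ _ hP')
    · intro x hx
      obtain ⟨i, hi, hx⟩ := Finset.mem_biUnion.mp hx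
      exact hs i (by simp [hi]) hx
    · rw [Finset.disjoint_biUnion_right]
      intro i hi
      exact hd a (by simp) i (by simp [hi]) (by rintro rfl; exact ha hi)

lemma eval_nonneg {q : E → ℝ} (hq : ∀ e, 0 ≤ q e) {P : MvPolynomial E ℝ} (hP : NN P) :
    0 ≤ eval q P := by
  rw [eval_eq]
  exact Finset.sum_nonneg fun m _ => mul_nonneg (hP m)
    (Finset.prod_nonneg fun i _ => pow_nonneg (hq i) _)

lemma sum_sqfree_le [Fintype E] {q : E → ℝ} (hq : ∀ e, 0 ≤ q e) {P : MvPolynomial E ℝ}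
    (hP : NN P) : ∑ S : Finset E, coeff (ind S) P * ∏ e ∈ S, q e ≤ eval q P := by
  have key : ∀ S : Finset E, ∏ e ∈ S, q e = ∏ e ∈ (ind S).support, q e ^ (ind S e) := by
    intro S
    have : (ind S).support = S := by
      ext e; simp [ind_apply]
    rw [this]
    refine Finset.prod_congr rfl fun e he => ?_
    simp [ind_apply, he]
  simp only [key]
  rw [eval_eq]
  have h2 : ∑ S : Finset E, coeff (ind S) P * ∏ e ∈ (ind S).support, q e ^ (ind S e)
      = ∑ m ∈ (Finset.univ : Finset (Finset E)).image ind,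
        coeff m P * ∏ e ∈ m.support, q e ^ (m e) := by
    rw [Finset.sum_image]
    intro a _ b _ h
    exact ind_inj h
  rw [h2]
  have hnn : ∀ m, 0 ≤ coeff m P * ∏ e ∈ m.support, q e ^ (m e) := fun m =>
    mul_nonneg (hP m) (Finset.prod_nonneg fun i _ => pow_nonneg (hq i) _)
  rw [← Finset.sum_filter_add_sum_filter_not _ (fun m => m ∈ P.support)]
  have h0 : ∑ m ∈ ((Finset.univ : Finset (Finset E)).image ind).filter (fun m => ¬ m ∈ P.support),
        coeff m P * ∏ e ∈ m.support, q e ^ (m e) = 0 := by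
    refine Finset.sum_eq_zero fun m hm => ?_
    have := (Finset.mem_filter.mp hm).2
    rw [notMem_support_iff] at this
    simp [this]
  rw [h0, add_zero]
  refine Finset.sum_le_sum_of_subset_of_nonneg ?_ fun m _ _ => hnn m
  intro m hm
  exact (Finset.mem_filter.mp hm).2

end Poly
end TOB

set_option linter.unusedSectionVars false
namespace TOB
open MvPolynomial GRG

section Meas
variable {N : ℕ}

lemma Adj_symm (ω : EdgeIdx N → Bool) {x y : Fin N} (h : Adj ω x y) : Adj ω y x := by
  unfold Adj adjMatrix at *
  rcases lt_trichotomy x y with hxy | hxy | hxy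
  · simp only [hxy, dif_pos] at h
    simp [hxy, hxy.not_gt]
    simpa using h
  · subst hxy; simp at h
  · simp only [hxy.not_gt, hxy] at h
    simp [hxy]
    simpa using h

lemma Adj_irrefl (ω : EdgeIdx N → Bool) (x : Fin N) : ¬ Adj ω x x := by
  simp [Adj, adjMatrix]

lemma Adj_lt (ω : EdgeIdx N → Bool) {x y : Fin N} (h : x < y) :
    Adj ω x y ↔ ω ⟨(x, y), h⟩ = true := by
  simp [Adj, adjMatrix, h]

/-- The random graph as a `SimpleGraph`. -/
def Gr (ω : EdgeIdx N → Bool) : SimpleGraph (Fin N) where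
  Adj := Adj ω
  symm := ⟨fun _ _ h => Adj_symm ω h⟩
  loopless := ⟨fun x h => Adj_irrefl ω x h⟩

open Classical in
/-- Edge set of the random graph. -/
noncomputable def es (ω : EdgeIdx N → Bool) : Finset (Sym2 (Fin N)) := (Gr ω).edgeFinset

lemma mem_es (ω : EdgeIdx N → Bool) (x y : Fin N) : s(x, y) ∈ es ω ↔ Adj ω x y := by
  classical
  unfold es
  rw [SimpleGraph.mem_edgeFinset]
  exact Iff.rfl

/-- Upper bound weights on edges. -/
noncomputable def qw (w : Fin N → ℝ) : Sym2 (Fin N) → ℝ :=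
  Sym2.lift ⟨fun x y => w x * w y / ∑ z, w z, fun x y => by simp only [mul_comm (w x)]⟩

lemma qw_mk (w : Fin N → ℝ) (x y : Fin N) : qw w s(x, y) = w x * w y / ∑ z, w z := rfl

variable {w : Fin N → ℝ}

lemma W_pos (hw : ∀ x, 0 < w x) (x : Fin N) : 0 < ∑ z, w z :=
  Finset.sum_pos (fun i _ => hw i) ⟨x, Finset.mem_univ x⟩

lemma qw_nonneg (hw : ∀ x, 0 < w x) (e : Sym2 (Fin N)) : 0 ≤ qw w e := by
  induction e using Sym2.ind with
  | _ x y =>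
    rw [qw_mk]
    exact div_nonneg (mul_nonneg (hw x).le (hw y).le) (W_pos hw x).le

lemma p_nonneg (hw : ∀ x, 0 < w x) (x y : Fin N) : 0 ≤ pGRG w x y :=
  div_nonneg (mul_nonneg (hw x).le (hw y).le)
    (add_nonneg (W_pos hw x).le (mul_nonneg (hw x).le (hw y).le))

lemma p_le_qw (hw : ∀ x, 0 < w x) (x y : Fin N) : pGRG w x y ≤ qw w s(x, y) := by
  rw [qw_mk, pGRG]
  have := W_pos hw x
  have h2 := mul_pos (hw x) (hw y)
  exact div_le_div_of_nonneg_left h2.le this (by linarith)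

lemma p_le_one (hw : ∀ x, 0 < w x) (x y : Fin N) : pGRG w x y ≤ 1 := by
  have := W_pos hw x
  have h2 := mul_pos (hw x) (hw y)
  rw [pGRG, div_le_one (by linarith)]
  linarith

lemma bern_prob {p : ℝ} (h0 : 0 ≤ p) (h1 : p ≤ 1) : IsProbabilityMeasure (bern p) := by
  constructor
  simp only [bern, Measure.coe_add, Measure.coe_smul, Pi.add_apply, Pi.smul_apply,
    smul_eq_mul, measure_univ, mul_one]
  rw [← ENNReal.ofReal_add h0 (by linarith)]
  simp

lemma grg_prob (hw : ∀ x, 0 < w x) : IsProbabilityMeasure (grgMeasure w) := by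
  have : ∀ e : EdgeIdx N, IsProbabilityMeasure (bern (pGRG w e.val.1 e.val.2)) :=
    fun e => bern_prob (p_nonneg hw _ _) (p_le_one hw _ _)
  unfold grgMeasure
  infer_instance

/-- The edge as an unordered pair. -/
def sy (e : EdgeIdx N) : Sym2 (Fin N) := s(e.val.1, e.val.2)

lemma sy_inj : Function.Injective (sy (N := N)) := by
  rintro ⟨⟨a, b⟩, h⟩ ⟨⟨c, d⟩, h'⟩ he
  simp only [sy, Sym2.eq_iff] at he
  rcases he with ⟨rfl, rfl⟩ | ⟨rfl, rfl⟩
  · rfl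
  · simp only at h h'
    exact absurd h (not_lt_of_gt h')

lemma mem_es_sy (ω : EdgeIdx N → Bool) (e : EdgeIdx N) : sy e ∈ es ω ↔ ω e = true := by
  rw [sy, mem_es, Adj_lt ω e.2]

lemma exists_sy (ω : EdgeIdx N → Bool) {e : Sym2 (Fin N)} (h : e ∈ es ω) : ∃ i, sy i = e := by
  induction e using Sym2.ind with
  | _ x y =>
    rw [mem_es] at h
    rcases lt_trichotomy x y with hxy | hxy | hxy
    · exact ⟨⟨(x, y), hxy⟩, rfl⟩
    · subst hxy; exact absurd h (Adj_irrefl ω x)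
    · exact ⟨⟨(y, x), hxy⟩, Sym2.eq_swap⟩

lemma meas_subset (hw : ∀ x, 0 < w x) (S : Finset (Sym2 (Fin N))) :
    grgMeasure w {ω | S ⊆ es ω} ≤ ENNReal.ofReal (∏ e ∈ S, qw w e) := by
  classical
  by_cases hS : ∀ e ∈ S, ∃ i, sy (N := N) i = e
  · have hset : {ω : EdgeIdx N → Bool | S ⊆ es ω}
        ⊆ Set.pi Set.univ (fun i : EdgeIdx N => if sy i ∈ S then {true} else Set.univ) := by
      intro ω hω i _
      by_cases hi : sy i ∈ S
      · simp only [hi, if_true, Set.mem_singleton_iff]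
        exact (mem_es_sy ω i).mp (hω hi)
      · simp [hi]
    refine (measure_mono hset).trans ?_
    unfold grgMeasure
    have : ∀ e : EdgeIdx N, IsProbabilityMeasure (bern (pGRG w e.val.1 e.val.2)) :=
      fun e => bern_prob (p_nonneg hw _ _) (p_le_one hw _ _)
    rw [Measure.pi_pi]
    have h1 : ∀ i : EdgeIdx N, (bern (pGRG w i.val.1 i.val.2))
        (if sy i ∈ S then {true} else Set.univ)
        ≤ if sy i ∈ S then ENNReal.ofReal (qw w (sy i)) else 1 := by
      intro i
      split_ifs with h
      · have : (bern (pGRG w i.val.1 i.val.2)) {true} = ENNReal.ofReal (pGRG w i.val.1 i.val.2) := by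
          simp [bern]
        rw [this]
        exact ENNReal.ofReal_le_ofReal (p_le_qw hw _ _)
      · exact prob_le_one
    refine (Finset.prod_le_prod' fun i _ => h1 i).trans ?_
    rw [← Finset.prod_filter, ← Finset.prod_image (f := fun e => ENNReal.ofReal (qw w e))
      (g := sy) sy_inj.injOn]
    have h2 : (Finset.univ.filter fun i : EdgeIdx N => sy i ∈ S).image sy = S := by
      ext e
      simp only [Finset.mem_image, Finset.mem_filter, Finset.mem_univ, true_and]
      constructor
      · rintro ⟨i, hi, rfl⟩; exact hi
      · intro he
        obtain ⟨i, rfl⟩ := hS e he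
        exact ⟨i, he, rfl⟩
    rw [h2, ENNReal.ofReal_prod_of_nonneg fun e _ => qw_nonneg hw e]
  · push Not at hS
    obtain ⟨e, he, hne⟩ := hS
    have : {ω : EdgeIdx N → Bool | S ⊆ es ω} = ∅ := by
      ext ω
      simp only [Set.mem_ofPred_eq, Set.mem_empty_iff_false, iff_false]
      intro h
      obtain ⟨i, hi⟩ := exists_sy ω (h he)
      exact hne i hi
    rw [this]; simp

/-- Markov inequality for polynomial functionals. -/
lemma markov (hw : ∀ x, 0 < w x) {P : MvPolynomial (Sym2 (Fin N)) ℝ} (hP : NN P) {a m : ℝ}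
    (ha : 0 < a) (hm : eval (qw w) P ≤ m) :
    grgMeasure w {ω | a ≤ ev (es ω) P} ≤ ENNReal.ofReal (m / a) := by
  classical
  have hev : ∀ ω : EdgeIdx N → Bool, ENNReal.ofReal (ev (es ω) P)
      = ∑ S : Finset (Sym2 (Fin N)),
        Set.indicator {ω | S ⊆ es ω} (fun _ => ENNReal.ofReal (coeff (ind S) P)) ω := by
    intro ω
    rw [ev, ENNReal.ofReal_sum_of_nonneg fun S _ => hP _]
    have : (es ω).powerset = Finset.univ.filter (fun S => S ⊆ es ω) := by
      ext S; simp
    rw [this, Finset.sum_filter]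
    refine Finset.sum_congr rfl fun S _ => ?_
    simp [Set.indicator_apply]
  have hmeas : ∀ s : Set (EdgeIdx N → Bool), MeasurableSet s := fun s => s.toFinite.measurableSet
  have hlin : ∫⁻ ω, ENNReal.ofReal (ev (es ω) P) ∂(grgMeasure w) ≤ ENNReal.ofReal m := by
    simp only [hev]
    rw [lintegral_finsetSum]
    · simp only [lintegral_indicator (hmeas _), lintegral_const, Measure.restrict_apply_univ]
      calc _ ≤ ∑ S : Finset (Sym2 (Fin N)), ENNReal.ofReal (coeff (ind S) P) *
              ENNReal.ofReal (∏ e ∈ S, qw w e) :=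
            Finset.sum_le_sum fun S _ => mul_le_mul_right (meas_subset hw S) _
        _ = ENNReal.ofReal (∑ S : Finset (Sym2 (Fin N)), coeff (ind S) P * ∏ e ∈ S, qw w e) := by
            rw [ENNReal.ofReal_sum_of_nonneg]
            · exact Finset.sum_congr rfl fun S _ => (ENNReal.ofReal_mul (hP _)).symm
            · exact fun S _ => mul_nonneg (hP _) (Finset.prod_nonneg fun e _ => qw_nonneg hw e)
        _ ≤ _ := ENNReal.ofReal_le_ofReal ((sum_sqfree_le (qw_nonneg hw) hP).trans hm)
    · exact fun S _ => Measurable.indicator measurable_const (hmeas _)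
  have h1 := mul_meas_ge_le_lintegral (μ := grgMeasure w)
    (f := fun ω => ENNReal.ofReal (ev (es ω) P)) (fun s _ => hmeas _) (ENNReal.ofReal a)
  have h2 := h1.trans hlin
  rw [ENNReal.ofReal_div_of_pos ha, ENNReal.le_div_iff_mul_le (by simp [ha]) (by simp), mul_comm]
  refine le_trans (mul_le_mul_right (measure_mono ?_) _) h2
  intro ω hω
  exact ENNReal.ofReal_le_ofReal hω

end Meas
end TOB

set_option linter.unusedSectionVars false
namespace TOB
open GRG

section Graph
variable {N : ℕ} {G : SimpleGraph (Fin N)}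

/-- There is a walk of length at most `k` from `a` to `b` avoiding `v`. -/
def Reach (G : SimpleGraph (Fin N)) (v : Fin N) (k : ℕ) (a b : Fin N) : Prop :=
  ∃ W : G.Walk a b, v ∉ W.support ∧ W.length ≤ k

lemma Reach.mono {v : Fin N} {k k' : ℕ} {a b : Fin N} (h : Reach G v k a b) (hk : k ≤ k') :
    Reach G v k' a b := by
  obtain ⟨W, h1, h2⟩ := h
  exact ⟨W, h1, h2.trans hk⟩

lemma Reach.refl {v a : Fin N} (h : v ≠ a) (k : ℕ) : Reach G v k a a :=
  ⟨SimpleGraph.Walk.nil, by simpa using h, by simp⟩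

lemma Reach.symm {v : Fin N} {k : ℕ} {a b : Fin N} (h : Reach G v k a b) : Reach G v k b a := by
  obtain ⟨W, h1, h2⟩ := h
  exact ⟨W.reverse, by simpa using h1, by simpa using h2⟩

lemma Reach.trans {v : Fin N} {k l : ℕ} {a b c : Fin N} (h : Reach G v k a b)
    (h' : Reach G v l b c) : Reach G v (k + l) a c := by
  obtain ⟨W, h1, h2⟩ := h
  obtain ⟨W', h1', h2'⟩ := h'
  refine ⟨W.append W', ?_, by rw [SimpleGraph.Walk.length_append]; omega⟩
  rw [SimpleGraph.Walk.mem_support_append_iff]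
  tauto

lemma Reach.edge {v a b : Fin N} (h : G.Adj a b) (ha : v ≠ a) (hb : v ≠ b) : Reach G v 1 a b :=
  ⟨SimpleGraph.Walk.cons h SimpleGraph.Walk.nil, by simp [ha, hb], by simp⟩

lemma Reach.ne_right {v : Fin N} {k : ℕ} {a b : Fin N} (h : Reach G v k a b) : v ≠ b := by
  obtain ⟨W, h1, h2⟩ := h
  rintro rfl
  exact h1 W.end_mem_support

lemma Reach.ne_left {v : Fin N} {k : ℕ} {a b : Fin N} (h : Reach G v k a b) : v ≠ a :=
  h.symm.ne_right

/-- The edge `va` lies on no cycle of length at most `13`. -/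
def NC (G : SimpleGraph (Fin N)) (v a : Fin N) : Prop :=
  G.Adj v a ∧ ∀ c, G.Adj v c → c ≠ a → ¬ Reach G v 11 a c

lemma cyc_of_path {r : ℕ} {v a : Fin N} (Q : G.Walk a v) (hQ : Q.IsPath) (hva : G.Adj v a)
    (h2 : 2 ≤ Q.length) (hr : Q.length ≤ 2 * r) : a ∈ S1cycA G.Adj r v := by
  refine ⟨hva, Q.length + 1, fun i => if i = 0 then v else Q.getVert (i - 1), by omega, by omega,
    by simp, by simp, by simp, ?_, ?_⟩
  · intro i hi
    rcases Nat.eq_zero_or_pos i with rfl | hpos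
    · simpa using hva
    · have h1 : i ≠ 0 := by omega
      simp only [h1, if_false, Nat.add_eq_zero_iff, and_false, Nat.add_sub_cancel]
      have := Q.adj_getVert_succ (i := i - 1) (by omega)
      rwa [Nat.sub_add_cancel hpos] at this
  · intro i j hij hj hn
    have hj0 : j ≠ 0 := by omega
    have hinj := hQ.getVert_injOn
    rcases Nat.eq_zero_or_pos i with rfl | hpos
    · simp only [if_true, hj0, if_false]
      intro h
      have hl : j - 1 = Q.length := by
        refine hinj (by simp; omega) (by simp) ?_
        rw [← h, Q.getVert_length]
      apply hn; constructor
      · rfl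
      · omega
    · have h1 : i ≠ 0 := by omega
      simp only [h1, hj0, if_false]
      intro h
      have := hinj (by simp; omega) (by simp; omega) h
      omega

lemma Reach.path {v : Fin N} {k : ℕ} {a b : Fin N} (h : Reach G v k a b) :
    ∃ W : G.Walk a b, W.IsPath ∧ v ∉ W.support ∧ W.length ≤ k := by
  classical
  obtain ⟨W, h1, h2⟩ := h
  exact ⟨W.bypass, W.bypass_isPath, fun h => h1 (W.support_bypass_subset h),
    W.length_bypass_le.trans h2⟩

lemma NC_of_notMem {r : ℕ} (hr : 6 ≤ r) {v a : Fin N} (hva : G.Adj v a)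
    (h : a ∉ S1cycA G.Adj r v) : NC G v a := by
  refine ⟨hva, fun c hc hca hR => h ?_⟩
  obtain ⟨W, hW, h1, h2⟩ := hR.path
  have h3 : 1 ≤ W.length := by
    rcases Nat.eq_zero_or_pos W.length with h0 | h0
    · exact absurd (SimpleGraph.Walk.eq_of_length_eq_zero h0).symm hca
    · exact h0
  refine cyc_of_path (W.concat hc.symm) (hW.concat h1 _) hva ?_ ?_ <;>
    rw [SimpleGraph.Walk.length_concat] <;> omega

lemma NC_of_notMem' {r : ℕ} (hr : 6 ≤ r) {v a : Fin N} (hva : G.Adj v a)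
    (h : a ∉ S1cycA G.Adj r v) : NC G a v := by
  refine ⟨hva.symm, fun c hc hca hR => h ?_⟩
  obtain ⟨W, hW, h1, h2⟩ := hR.symm.path
  have h3 : 1 ≤ W.length := by
    rcases Nat.eq_zero_or_pos W.length with h0 | h0
    · exact absurd (SimpleGraph.Walk.eq_of_length_eq_zero h0) hca
    · exact h0
  refine cyc_of_path (SimpleGraph.Walk.cons hc W) (hW.cons h1) hva ?_ ?_ <;>
    rw [SimpleGraph.Walk.length_cons] <;> omega

open Classical in
/-- Edges hanging off `a`, seen from `v`, up to depth `k`. -/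
noncomputable def Comp (G : SimpleGraph (Fin N)) (v a : Fin N) (k : ℕ) : Finset (Sym2 (Fin N)) :=
  G.edgeFinset.filter fun e => e ≠ s(v, a) ∧ ∃ b ∈ e, Reach G v k a b

lemma mem_Comp {v a : Fin N} {k : ℕ} {e : Sym2 (Fin N)} :
    e ∈ Comp G v a k ↔ e ∈ G.edgeSet ∧ e ≠ s(v, a) ∧ ∃ b ∈ e, Reach G v k a b := by
  classical
  simp [Comp]

/-- The branch at `v` in the direction `a`. -/
noncomputable def Tr (G : SimpleGraph (Fin N)) (v a : Fin N) (k : ℕ) : Finset (Sym2 (Fin N)) :=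
  insert s(v, a) (Comp G v a k)

lemma notMem_of_Comp {v a : Fin N} {k : ℕ} (hk : k ≤ 11) (h : NC G v a) {e : Sym2 (Fin N)}
    (he : e ∈ Comp G v a k) : v ∉ e := by
  obtain ⟨h1, h2, b, hb, hR⟩ := mem_Comp.mp he
  intro hv
  obtain ⟨c, rfl⟩ := hv
  have hbc : b = c := by
    rcases Sym2.mem_iff.mp hb with h | h
    · exact absurd h.symm hR.ne_right
    · exact h
  subst hbc
  exact h.2 b h1 (by rintro rfl; exact h2 rfl) (hR.mono hk)

lemma Comp_disjoint {v a a' : Fin N} {k : ℕ} (hk : k ≤ 5) (h : NC G v a) (h' : G.Adj v a')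
    (hne : a ≠ a') : Disjoint (Comp G v a k) (Comp G v a' k) := by
  rw [Finset.disjoint_left]
  intro e he he'
  have hv := notMem_of_Comp (by omega) h he
  obtain ⟨h1, h2, b, hb, hR⟩ := mem_Comp.mp he
  obtain ⟨-, -, b', hb', hR'⟩ := mem_Comp.mp he'
  have hbb : Reach G v 1 b b' := by
    by_cases hbb : b = b'
    · subst hbb; exact Reach.refl hR.ne_right 1
    · have : e = s(b, b') := ((Sym2.mem_and_mem_iff hbb).mp ⟨hb, hb'⟩)
      subst this
      exact Reach.edge h1 hR.ne_right hR'.ne_right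
  exact h.2 a' h' hne.symm (((hR.trans hbb).trans hR'.symm).mono (by omega))

lemma Tr_disjoint {v a a' : Fin N} {k : ℕ} (hk : k ≤ 5) (h : NC G v a) (h' : NC G v a')
    (hne : a ≠ a') : Disjoint (Tr G v a k) (Tr G v a' k) := by
  unfold Tr
  rw [Finset.disjoint_insert_left, Finset.disjoint_insert_right]
  refine ⟨?_, ?_, Comp_disjoint hk h h'.1 hne⟩
  · rw [Finset.mem_insert]
    rintro (h1 | h1)
    · simp only [Sym2.eq_iff] at h1
      rcases h1 with ⟨-, h1⟩ | ⟨h1, h2⟩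
      · exact hne h1
      · exact hne (h2.trans h1)
    · exact notMem_of_Comp (by omega) h' h1 (Sym2.mem_mk_left v a)
  · intro h1
    exact notMem_of_Comp (by omega) h h1 (Sym2.mem_mk_left v a')

lemma Tr_disjoint_single {v a a' : Fin N} {k : ℕ} (hk : k ≤ 5) (h : NC G v a)
    (hne : a ≠ a') : s(v, a') ∉ Tr G v a k := by
  unfold Tr
  rw [Finset.mem_insert]
  rintro (h1 | h1)
  · simp only [Sym2.eq_iff] at h1
    rcases h1 with ⟨-, h1⟩ | ⟨h1, h2⟩
    · exact hne h1.symm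
    · exact hne (h1.symm.trans h2.symm)
  · exact notMem_of_Comp (by omega) h h1 (Sym2.mem_mk_left v a')

lemma single_mem_Comp {p v u : Fin N} {k : ℕ} (hpv : G.Adj p v) (hvu : G.Adj v u) (hne : p ≠ u) :
    s(v, u) ∈ Comp G p v k := by
  rw [mem_Comp]
  refine ⟨hvu, ?_, v, Sym2.mem_mk_left v u, Reach.refl hpv.ne k⟩
  intro h
  simp only [Sym2.eq_iff] at h
  rcases h with ⟨h1, -⟩ | ⟨-, h2⟩
  · exact hpv.ne h1.symm
  · exact hne h2.symm

lemma Tr_subset_Comp {p v u : Fin N} {k : ℕ} (hk : k ≤ 10) (hpv : G.Adj p v) (hvu : NC G v u)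
    (hne : p ≠ u) : Tr G v u k ⊆ Comp G p v (k + 1) := by
  intro e he
  rcases Finset.mem_insert.mp he with rfl | he
  · exact single_mem_Comp hpv hvu.1 hne
  · have hv := notMem_of_Comp (by omega) hvu he
    obtain ⟨h1, h2, b, hb, W, hW1, hW2⟩ := mem_Comp.mp he
    rw [mem_Comp]
    refine ⟨h1, ?_, b, hb, ?_⟩
    · rintro rfl
      exact hv (Sym2.mem_mk_right p v)
    · refine ⟨SimpleGraph.Walk.cons hvu.1 W, ?_, by rw [SimpleGraph.Walk.length_cons]; omega⟩
      rw [SimpleGraph.Walk.support_cons, List.mem_cons]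
      rintro (h | h)
      · exact hpv.ne h
      · classical
        refine hvu.2 p hpv.symm hne ⟨W.takeUntil p h, ?_, ?_⟩
        · exact fun h' => hW1 (W.support_takeUntil_subset h h')
        · exact (W.length_takeUntil_le h).trans (hW2.trans (by omega))

lemma Comp_subset_Tr {v a : Fin N} {k : ℕ} : Comp G v a k ⊆ Tr G v a k :=
  Finset.subset_insert _ _

lemma self_notMem_Comp {v a : Fin N} {k : ℕ} : s(v, a) ∉ Comp G v a k := by
  intro h
  exact (mem_Comp.mp h).2.1 rfl

end Graph
end TOB

set_option linter.unusedSectionVars false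
namespace TOB
open MvPolynomial

section Polys
variable {N : ℕ}

abbrev Pol (N : ℕ) := MvPolynomial (Sym2 (Fin N)) ℝ

/-- Polynomial of a vertex with excess degree tilt `σ`. -/
noncomputable def NP (σ ξ : ℝ) (v : Fin N) (L : Fin N → Pol N) : Pol N :=
  C (σ ^ (-(ξ - 1))) * ∏ u, (1 + X s(v, u) * (C (σ - 1) + C σ * L u))

open Classical in
/-- Star polynomial. -/
noncomputable def St (exc : Fin N → Prop) (s ξ : ℝ) (v : Fin N) : Pol N :=
  NP (if exc v then s else 1) ξ v (fun _ => 0)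

open Classical in
/-- Last generation. -/
noncomputable def Leaf (R : Fin N → Fin N → Prop) (exc : Fin N → Prop) (s ξ c : ℝ)
    (x u : Fin N) : Pol N :=
  ∏ x3 with R x3 x ∧ R x3 u, (1 + X s(u, x3) * (C c * St exc s ξ x3)) - 1

open Classical in
/-- Second generation. -/
noncomputable def Nx (R : Fin N → Fin N → Prop) (exc : Fin N → Prop) (s ξ c : ℝ)
    (x : Fin N) : Pol N :=
  if exc x then NP s ξ x (Leaf R exc s ξ c x)
  else ∏ u, (1 + X s(x, u) * Leaf R exc s ξ c x u) - 1

open Classical in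
/-- First generation. -/
noncomputable def Bp (R : Fin N → Fin N → Prop) (exc : Fin N → Prop) (s ξ c : ℝ)
    (x y : Fin N) : Pol N :=
  ∑ z with R z x, (X s(y, z) * St exc s ξ z) *
    ∏ x2 with R x2 y, (1 + X s(y, x2) * Nx R exc s ξ c x2)

/-- Root polynomial. -/
noncomputable def Root (R : Fin N → Fin N → Prop) (exc : Fin N → Prop) (s ξ c : ℝ)
    (x : Fin N) : Pol N :=
  ∏ y, (1 + X s(x, y) * Bp R exc s ξ c x y)

variable {R : Fin N → Fin N → Prop} {exc : Fin N → Prop} {s ξ c : ℝ}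

lemma NN_NP {σ : ℝ} (hσ : 1 ≤ σ) {v : Fin N} {L : Fin N → Pol N} (hL : ∀ u, NN (L u)) :
    NN (NP σ ξ v L) := by
  refine (NN_C (rpow_nonneg (by linarith) _)).mul (NN_prod _ _ fun u _ => NN_one.add ?_)
  exact (NN_X _).mul ((NN_C (by linarith)).add ((NN_C (by linarith)).mul (hL u)))

lemma sv_one (hs : 1 ≤ s) (p : Prop) [Decidable p] : 1 ≤ (if p then s else 1) := by
  split_ifs <;> simp [hs]

lemma NN_St (hs : 1 ≤ s) (v : Fin N) : NN (St exc s ξ v) := by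
  classical
  exact NN_NP (sv_one hs _) fun _ => NN_zero

lemma NN_Leaf (hs : 1 ≤ s) (hc : 0 ≤ c) (x u : Fin N) : NN (Leaf R exc s ξ c x u) :=
  NN_prod_sub_one _ _ fun _ _ => (NN_X _).mul ((NN_C hc).mul (NN_St hs _))

lemma NN_Nx (hs : 1 ≤ s) (hc : 0 ≤ c) (x : Fin N) : NN (Nx R exc s ξ c x) := by
  unfold Nx
  split_ifs
  · exact NN_NP hs fun _ => NN_Leaf hs hc _ _
  · exact NN_prod_sub_one _ _ fun _ _ => (NN_X _).mul (NN_Leaf hs hc _ _)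

lemma NN_Bp (hs : 1 ≤ s) (hc : 0 ≤ c) (x y : Fin N) : NN (Bp R exc s ξ c x y) :=
  NN_sum _ _ fun _ _ => ((NN_X _).mul (NN_St hs _)).mul
    (NN_prod _ _ fun _ _ => NN_one.add ((NN_X _).mul (NN_Nx hs hc _)))

lemma NN_Root (hs : 1 ≤ s) (hc : 0 ≤ c) (x : Fin N) : NN (Root R exc s ξ c x) :=
  NN_prod _ _ fun _ _ => NN_one.add ((NN_X _).mul (NN_Bp hs hc _ _))

variable {G : SimpleGraph (Fin N)}

lemma ev_branch {v a : Fin N} {k : ℕ} {P : Pol N} (hP : NN P) :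
    ev (Comp G v a k) P ≤ ev (Tr G v a k) (X s(v, a) * P) := by
  have h := ev_mul_ge (ω := Tr G v a k) (ω₁ := {s(v, a)}) (ω₂ := Comp G v a k)
    (P := X s(v, a)) (Q := P) (by simp [Tr]) Comp_subset_Tr
    (by simpa using self_notMem_Comp) (NN_X _) hP
  have h1 := ev_X (E := Sym2 (Fin N)) (ω := {s(v, a)}) (e := s(v, a)) (by simp)
  have h2 := ev_nonneg (Comp G v a k) hP
  nlinarith

lemma ev_node {v : Fin N} {k : ℕ} (hk : k ≤ 5) {ω : Finset (Sym2 (Fin N))} {A t : Finset (Fin N)}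
    (hAt : A ⊆ t)
    (hA : ∀ a ∈ A, NC G v a ∧ Tr G v a k ⊆ ω) {P : Fin N → Pol N} (hP : ∀ u, NN (P u)) :
    ∏ a ∈ A, (1 + ev (Comp G v a k) (P a)) ≤ ev ω (∏ u ∈ t, (1 + X s(v, u) * P u)) := by
  classical
  have hPX : ∀ u, NN (1 + X s(v, u) * P u) := fun u => NN_one.add ((NN_X _).mul (hP u))
  refine le_trans ?_ (ev_prod_ge t (fun u => 1 + X s(v, u) * P u)
    (fun u => if u ∈ A then Tr G v u k else ∅) ω (fun u _ => hPX u) ?_ ?_)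
  · rw [← Finset.prod_congr rfl (g := fun a => (1 + ev (Comp G v a k) (P a)))
      (f := fun a => if a ∈ A then (1 + ev (Comp G v a k) (P a)) else 1)
      (fun x hx => by simp [hx])]
    rw [Finset.prod_subset hAt (fun x _ hx => by simp [hx])]
    refine Finset.prod_le_prod (fun i _ => ?_) fun i _ => ?_
    · split_ifs
      · have := ev_nonneg (Comp G v i k) (hP i); linarith
      · norm_num
    · by_cases hi : i ∈ A
      · simp only [hi, if_true]
        rw [ev_add, ev_one]
        have := ev_branch (G := G) (v := v) (a := i) (k := k) (hP i)
        linarith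
      · simp only [hi, if_false]
        rw [ev_add, ev_one]
        have := ev_nonneg ∅ ((NN_X s(v, i)).mul (hP i))
        linarith
  · intro u _
    split_ifs with h
    · exact (hA u h).2
    · simp
  · intro u _ u' _ hne
    beta_reduce
    split_ifs with h h'
    · exact Tr_disjoint hk (hA u h).1 (hA u' h').1 hne
    all_goals simp


lemma ev_star {p v : Fin N} {k : ℕ} (hk : k ≤ 5) (hpv : G.Adj p v) {σ : ℝ} (hσ : 1 ≤ σ)
    (hdeg : ξ ≤ GRG.degA G.Adj v) {A : Finset (Fin N)}
    (hA : ∀ a ∈ A, NC G v a ∧ a ≠ p) {L : Fin N → Pol N} (hL : ∀ u, NN (L u)) :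
    ∏ a ∈ A, (1 + ev (Comp G v a k) (L a)) ≤ ev (Comp G p v (k + 1)) (NP σ ξ v L) := by
  classical
  unfold NP
  rw [ev_C_mul]
  have hPN : ∀ u, NN (C (σ - 1) + C σ * L u) := fun u =>
    (NN_C (by linarith)).add ((NN_C (by linarith)).mul (hL u))
  have hA' : ∀ a ∈ A, G.Adj v a ∧ a ≠ p := fun a ha => ⟨(hA a ha).1.1, (hA a ha).2⟩
  have key : (∏ u, if G.Adj v u ∧ u ≠ p then σ else 1) *
      ∏ a ∈ A, (1 + ev (Comp G v a k) (L a)) ≤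
      ev (Comp G p v (k + 1)) (∏ u, (1 + X s(v, u) * (C (σ - 1) + C σ * L u))) := by
    refine le_trans ?_ (ev_prod_ge Finset.univ (fun u => 1 + X s(v, u) * (C (σ - 1) + C σ * L u))
      (fun u => if u ∈ A then Tr G v u k else if G.Adj v u ∧ u ≠ p then {s(v, u)} else ∅) _
      (fun u _ => NN_one.add ((NN_X _).mul (hPN u))) ?_ ?_)
    · rw [← Finset.prod_congr rfl (g := fun a => (1 + ev (Comp G v a k) (L a)))
        (f := fun a => if a ∈ A then (1 + ev (Comp G v a k) (L a)) else 1)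
        (fun x hx => by simp [hx])]
      rw [Finset.prod_subset (Finset.subset_univ A) (fun x _ hx => by simp [hx]),
        ← Finset.prod_mul_distrib]
      refine Finset.prod_le_prod (fun i _ => ?_) fun i _ => ?_
      · have := ev_nonneg (Comp G v i k) (hL i)
        refine mul_nonneg ?_ ?_ <;> split_ifs <;> linarith
      · by_cases hi : i ∈ A
        · have h1 := ev_branch (G := G) (v := v) (a := i) (k := k) (hPN i)
          have h2 : ev (Comp G v i k) (C (σ - 1)) = σ - 1 := by
            have := ev_C_mul (E := Sym2 (Fin N)) (Comp G v i k) (σ - 1) 1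
            rw [mul_one, ev_one, mul_one] at this
            exact this
          rw [if_pos (hA' i hi), if_pos hi, if_pos hi, ev_add, ev_one]
          rw [ev_add, h2, ev_C_mul] at h1
          linarith
        · rw [if_neg hi, if_neg hi, ev_add, ev_one]
          by_cases h3 : G.Adj v i ∧ i ≠ p
          · rw [if_pos h3, if_pos h3]
            have h := ev_mul_ge (ω := {s(v, i)}) (ω₁ := {s(v, i)}) (ω₂ := ∅)
              (P := X s(v, i)) (Q := C (σ - 1) + C σ * L i) (by simp) (by simp) (by simp)
              (NN_X _) (hPN i)
            have h1 := ev_X (E := Sym2 (Fin N)) (ω := {s(v, i)}) (e := s(v, i)) (by simp)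
            have h2 : ev ∅ (C (σ - 1) : Pol N) = σ - 1 := by
              have := ev_C_mul (E := Sym2 (Fin N)) ∅ (σ - 1) 1
              rw [mul_one, ev_one, mul_one] at this
              exact this
            rw [ev_add, h2, ev_C_mul] at h
            have h4 := ev_nonneg ∅ (hL i)
            have h5 : σ - 1 ≤ σ - 1 + σ * ev ∅ (L i) := by nlinarith
            nlinarith
          · rw [if_neg h3, if_neg h3]
            have := ev_nonneg ∅ ((NN_X s(v, i)).mul (hPN i))
            linarith
    · intro u _
      beta_reduce
      split_ifs with h h'
      · exact Tr_subset_Comp (by omega) hpv (hA u h).1 (hA u h).2.symm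
      · simpa using single_mem_Comp hpv h'.1 h'.2.symm
      · simp
    · intro u _ u' _ hne
      beta_reduce
      split_ifs with h h' h'' h1 h2 h3
      · exact Tr_disjoint hk (hA u h).1 (hA u' h').1 hne
      · simpa using Tr_disjoint_single hk (hA u h).1 hne
      · simp
      · simpa using Tr_disjoint_single hk (hA u' h2).1 hne.symm
      · simp only [Finset.disjoint_singleton]
        intro h
        simp only [Sym2.eq_iff] at h
        rcases h with ⟨-, h⟩ | ⟨h, h'⟩
        · exact hne h
        · exact hne (h'.trans h)
      all_goals simp
  have hcard : ξ - 1 ≤ ((Finset.univ.filter fun u => G.Adj v u ∧ u ≠ p).card : ℝ) := by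
    have e1 : GRG.degA G.Adj v = (Finset.univ.filter fun u => G.Adj v u).card := by
      unfold GRG.degA
      rw [← Set.ncard_coe_finset]
      congr 1
      ext; simp
    have e2 : (Finset.univ.filter fun u => G.Adj v u)
        ⊆ insert p (Finset.univ.filter fun u => G.Adj v u ∧ u ≠ p) := by
      intro u hu
      by_cases h : u = p <;> simp_all
    have e3 := (Finset.card_le_card e2).trans (Finset.card_insert_le _ _)
    rw [← e1] at e3
    have e4 : (GRG.degA G.Adj v : ℝ) ≤
      ((Finset.univ.filter fun u => G.Adj v u ∧ u ≠ p).card : ℝ) + 1 := by exact_mod_cast e3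
    linarith
  have hpow : 1 ≤ σ ^ (-(ξ - 1)) * ∏ u, (if G.Adj v u ∧ u ≠ p then σ else 1) := by
    rw [Finset.prod_ite, Finset.prod_const_one, mul_one, Finset.prod_const, ← rpow_natCast,
      ← rpow_add (by linarith)]
    exact one_le_rpow hσ (by linarith)
  have hA0 : 0 ≤ ∏ a ∈ A, (1 + ev (Comp G v a k) (L a)) :=
    Finset.prod_nonneg fun i _ => by have := ev_nonneg (Comp G v i k) (hL i); linarith
  calc ∏ a ∈ A, (1 + ev (Comp G v a k) (L a))
      ≤ (σ ^ (-(ξ - 1)) * ∏ u, (if G.Adj v u ∧ u ≠ p then σ else 1)) *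
        ∏ a ∈ A, (1 + ev (Comp G v a k) (L a)) := le_mul_of_one_le_left hA0 hpow
    _ = σ ^ (-(ξ - 1)) * ((∏ u, if G.Adj v u ∧ u ≠ p then σ else 1) *
        ∏ a ∈ A, (1 + ev (Comp G v a k) (L a))) := by ring
    _ ≤ _ := mul_le_mul_of_nonneg_left key (rpow_nonneg (by linarith) _)

lemma lb_St (hs : 1 ≤ s) {p v : Fin N} {k : ℕ} (hk : k ≤ 5) (hpv : G.Adj p v)
    (hdeg : ξ ≤ GRG.degA G.Adj v) : 1 ≤ ev (Comp G p v (k + 1)) (St exc s ξ v) := by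
  classical
  have := ev_star (G := G) (k := k) hk hpv (sv_one hs (exc v)) hdeg (A := ∅) (by simp)
    (L := fun _ => 0) (fun _ => NN_zero)
  simpa [St] using this

lemma lb_Leaf (hs : 1 ≤ s) (hc : 0 ≤ c) {x u : Fin N} (hxu : G.Adj x u) {A : Finset (Fin N)}
    (hA : ∀ a ∈ A, R a x ∧ R a u ∧ NC G u a ∧ a ≠ x ∧ ξ ≤ GRG.degA G.Adj a) :
    (1 + c) ^ A.card ≤ 1 + ev (Comp G x u 2) (Leaf R exc s ξ c x u) := by
  classical
  unfold Leaf
  rw [ev_sub, ev_one]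
  have := ev_node (G := G) (v := u) (k := 1) (by omega) (ω := Comp G x u 2) (A := A)
    (t := Finset.univ.filter fun x3 => R x3 x ∧ R x3 u)
    (fun a ha => by simp [(hA a ha).1, (hA a ha).2.1])
    (fun a ha => ⟨(hA a ha).2.2.1, Tr_subset_Comp (by omega) hxu (hA a ha).2.2.1
      (hA a ha).2.2.2.1.symm⟩) (P := fun x3 => C c * St exc s ξ x3)
    (fun a => (NN_C hc).mul (NN_St hs a))
  have h2 : (1 + c) ^ A.card ≤ ∏ a ∈ A, (1 + ev (Comp G u a 1) (C c * St exc s ξ a)) := by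
    rw [← Finset.prod_const]
    refine Finset.prod_le_prod (fun _ _ => by linarith) fun a ha => ?_
    rw [ev_C_mul]
    have := lb_St (G := G) (exc := exc) (k := 0) hs (by omega) (hA a ha).2.2.1.1
      (hA a ha).2.2.2.2
    simp only [zero_add] at this
    nlinarith
  linarith

lemma lb_N (hs : 1 ≤ s) (hc : 0 ≤ c) {p x : Fin N} (hpx : G.Adj p x)
    (hdeg : ξ ≤ GRG.degA G.Adj x) {A : Finset (Fin N)} {A4 : Fin N → Finset (Fin N)}
    (hA : ∀ u ∈ A, NC G x u ∧ u ≠ p ∧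
      ∀ a ∈ A4 u, R a x ∧ R a u ∧ NC G u a ∧ a ≠ x ∧ ξ ≤ GRG.degA G.Adj a) :
    (1 + c) ^ (∑ u ∈ A, (A4 u).card) ≤ 1 + ev (Comp G p x 3) (Nx R exc s ξ c x) := by
  classical
  have h1 : (1 + c) ^ (∑ u ∈ A, (A4 u).card) ≤
      ∏ u ∈ A, (1 + ev (Comp G x u 2) (Leaf R exc s ξ c x u)) := by
    rw [← Finset.prod_pow_eq_pow_sum]
    exact Finset.prod_le_prod (fun _ _ => by positivity) fun u hu =>
      lb_Leaf hs hc (hA u hu).1.1 (hA u hu).2.2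
  refine h1.trans ?_
  unfold Nx
  split_ifs
  · have := ev_star (G := G) (k := 2) (by omega) hpx hs hdeg (A := A)
      (fun a ha => ⟨(hA a ha).1, (hA a ha).2.1⟩) (L := Leaf R exc s ξ c x)
      (fun _ => NN_Leaf hs hc _ _)
    linarith
  · rw [ev_sub, ev_one]
    have := ev_node (G := G) (v := x) (k := 2) (by omega) (ω := Comp G p x 3) (A := A)
      (t := Finset.univ) (Finset.subset_univ A)
      (fun a ha => ⟨(hA a ha).1, Tr_subset_Comp (by omega) hpx (hA a ha).1
        (hA a ha).2.1.symm⟩) (P := Leaf R exc s ξ c x)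
      (fun a => NN_Leaf hs hc _ _)
    linarith

lemma lb_B (hs : 1 ≤ s) (hc : 0 ≤ c) {x y z : Fin N} (hxy : G.Adj x y)
    (hz : R z x) (hyz : NC G y z) (hzx : z ≠ x) (hdz : ξ ≤ GRG.degA G.Adj z)
    {A2 : Finset (Fin N)} {A3 : Fin N → Finset (Fin N)} {A4 : Fin N → Fin N → Finset (Fin N)}
    (hA2 : ∀ x2 ∈ A2, R x2 y ∧ NC G y x2 ∧ x2 ≠ x ∧ x2 ≠ z ∧ ξ ≤ GRG.degA G.Adj x2 ∧
      ∀ u ∈ A3 x2, NC G x2 u ∧ u ≠ y ∧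
        ∀ a ∈ A4 x2 u, R a x2 ∧ R a u ∧ NC G u a ∧ a ≠ x2 ∧ ξ ≤ GRG.degA G.Adj a) :
    (1 + c) ^ (∑ x2 ∈ A2, ∑ u ∈ A3 x2, (A4 x2 u).card) ≤
      ev (Comp G x y 4) (Bp R exc s ξ c x y) := by
  classical
  have h1 : (1 + c) ^ (∑ x2 ∈ A2, ∑ u ∈ A3 x2, (A4 x2 u).card) ≤
      ∏ x2 ∈ A2, (1 + ev (Comp G y x2 3) (Nx R exc s ξ c x2)) := by
    rw [← Finset.prod_pow_eq_pow_sum]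
    exact Finset.prod_le_prod (fun _ _ => by positivity) fun u hu =>
      lb_N hs hc (hA2 u hu).2.1.1 (hA2 u hu).2.2.2.2.1 (hA2 u hu).2.2.2.2.2
  have hNP : NN (∏ x2 with R x2 y, (1 + X s(y, x2) * Nx R exc s ξ c x2)) :=
    NN_prod _ _ fun _ _ => NN_one.add ((NN_X _).mul (NN_Nx hs hc _))
  have hsub : Tr G y z 3 ⊆ Comp G x y 4 := Tr_subset_Comp (by omega) hxy hyz hzx.symm
  have h2 := ev_node (G := G) (v := y) (k := 3) (by omega) (ω := Comp G x y 4 \ Tr G y z 3)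
    (A := A2) (t := Finset.univ.filter fun x2 => R x2 y)
    (fun a ha => by simp [(hA2 a ha).1])
    (fun a ha => ⟨(hA2 a ha).2.1, by
      rw [Finset.subset_sdiff]
      exact ⟨Tr_subset_Comp (by omega) hxy (hA2 a ha).2.1 (hA2 a ha).2.2.1.symm,
        Tr_disjoint (by omega) (hA2 a ha).2.1 hyz (hA2 a ha).2.2.2.1⟩⟩)
    (P := Nx R exc s ξ c) (fun a => NN_Nx hs hc a)
  have h3 := ev_mul_ge (ω := Comp G x y 4) hsub Finset.sdiff_subset Finset.disjoint_sdiff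
    ((NN_X s(y, z)).mul (NN_St (exc := exc) (ξ := ξ) hs z)) hNP
  have h4 := ev_branch (G := G) (v := y) (a := z) (k := 3) (NN_St (exc := exc) (ξ := ξ) hs z)
  have h5 := lb_St (G := G) (exc := exc) (k := 2) hs (by omega) hyz.1 hdz
  norm_num at h5
  unfold Bp
  rw [ev_sum]
  refine le_trans ?_ (Finset.single_le_sum (f := fun z => ev (Comp G x y 4)
    ((X s(y, z) * St exc s ξ z) *
    ∏ x2 with R x2 y, (1 + X s(y, x2) * Nx R exc s ξ c x2)))
    (fun i _ => ev_nonneg _ (((NN_X _).mul (NN_St hs _)).mul hNP)) (a := z) (by simp [hz]))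
  refine le_trans ?_ h3
  refine (h1.trans h2).trans (le_mul_of_one_le_left (ev_nonneg _ hNP) (h5.trans h4))

lemma lb_Root (hs : 1 ≤ s) (hc : 0 ≤ c) {x : Fin N} {ω : Finset (Sym2 (Fin N))}
    (hω : ∀ e, e ∈ ω ↔ e ∈ G.edgeSet)
    {A1 : Finset (Fin N)} {A2 : Fin N → Finset (Fin N)} {A3 : Fin N → Finset (Fin N)}
    {A4 : Fin N → Fin N → Finset (Fin N)}
    (hA1 : ∀ y ∈ A1, NC G x y ∧ (∃ z, R z x ∧ NC G y z ∧ z ≠ x ∧ ξ ≤ GRG.degA G.Adj z ∧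
      ∀ x2 ∈ A2 y, x2 ≠ z) ∧
      (∀ x2 ∈ A2 y, R x2 y ∧ NC G y x2 ∧ x2 ≠ x ∧ ξ ≤ GRG.degA G.Adj x2 ∧
      ∀ u ∈ A3 x2, NC G x2 u ∧ u ≠ y ∧
        ∀ a ∈ A4 x2 u, R a x2 ∧ R a u ∧ NC G u a ∧ a ≠ x2 ∧ ξ ≤ GRG.degA G.Adj a)) :
    (1 + c) ^ (∑ y ∈ A1, ∑ x2 ∈ A2 y, ∑ u ∈ A3 x2, (A4 x2 u).card) ≤
      ev ω (Root R exc s ξ c x) := by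
  classical
  have h1 : (1 + c) ^ (∑ y ∈ A1, ∑ x2 ∈ A2 y, ∑ u ∈ A3 x2, (A4 x2 u).card) ≤
      ∏ y ∈ A1, (1 + ev (Comp G x y 4) (Bp R exc s ξ c x y)) := by
    rw [← Finset.prod_pow_eq_pow_sum]
    refine Finset.prod_le_prod (fun _ _ => by positivity) fun y hy => ?_
    obtain ⟨a1, ⟨z, b1, b2, b3, b4, b5⟩, a3⟩ := hA1 y hy
    have := lb_B (G := G) (R := R) (exc := exc) (A2 := A2 y) (A3 := A3) (A4 := A4)
      hs hc a1.1 b1 b2 b3 b4 (fun x2 hx2 => by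
        obtain ⟨c1, c2, c3, c4, c5⟩ := a3 x2 hx2
        exact ⟨c1, c2, c3, b5 x2 hx2, c4, c5⟩)
    linarith
  refine h1.trans ?_
  unfold Root
  refine ev_node (G := G) (k := 4) (by omega) (Finset.subset_univ A1) (fun a ha => ⟨(hA1 a ha).1,
    ?_⟩) (fun u => NN_Bp hs hc x u)
  intro e he
  rw [hω]
  rcases Finset.mem_insert.mp he with rfl | he
  · exact (hA1 a ha).1.1
  · exact (mem_Comp.mp he).1

end Polys
end TOB

set_option linter.unusedSectionVars false
namespace TOB
open MvPolynomial GRG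

section Lower
variable {N : ℕ}

open Classical in
lemma dot_ind (S T : Set (Fin N)) :
    dotR (indVec S) (indVec T) = ∑ y, if y ∈ S ∧ y ∈ T then (1 : ℝ) else 0 := by
  unfold dotR indVec
  refine Finset.sum_congr rfl fun y _ => ?_
  by_cases h1 : y ∈ S <;> by_cases h2 : y ∈ T <;> simp [h1, h2]

lemma prec_ne {A : Fin N → Fin N → Prop} {x y : Fin N} (h : precA A x y) : x ≠ y := by
  rintro rfl
  rcases h with h | ⟨_, h⟩ <;> exact lt_irrefl _ h

lemma prec_le {A : Fin N → Fin N → Prop} {x y : Fin N} (h : precA A x y) :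
    degA A x ≤ degA A y := by
  rcases h with h | ⟨h, _⟩
  · exact h.le
  · exact h.le

lemma prec_trans {A : Fin N → Fin N → Prop} {x y z : Fin N} (h : precA A x y)
    (h' : precA A y z) : precA A x z := by
  unfold precA at *
  rcases h with h | ⟨h, h1⟩ <;> rcases h' with h' | ⟨h', h1'⟩
  · left; omega
  · left; omega
  · left; omega
  · right; exact ⟨h.trans h', h1'.trans h1⟩

open Classical in
/-- The sum in the theorem. -/
noncomputable def TS (A : Fin N → Fin N → Prop) (r : ℕ) (ν δ : ℝ) (x₁ : Fin N) : ℝ :=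
  ∑ x₂ : Fin N, ∑ x₃ : Fin N,
            if x₂ ∈ VhA A ν δ ∧ x₃ ∈ VhA A ν δ ∧
                precA A x₂ x₁ ∧ precA A x₂ x₃ then
              dotR (indVec (S1duA A r x₁)) (indVec (S1duA A r x₂)) *
                dotR (indVec (S1duA A r x₂ \ S1duA A r x₁))
                  (indVec (S1duA A r x₃))
            else 0

open Classical in
lemma TS_eq (A : Fin N → Fin N → Prop) (r : ℕ) (ν δ : ℝ) (x₁ : Fin N) :
    TS A r ν δ x₁ = ((∑ y with y ∈ S1duA A r x₁,
      ∑ x2 with x2 ∈ VhA A ν δ ∧ precA A x2 x₁ ∧ y ∈ S1duA A r x2,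
      ∑ u with u ∈ S1duA A r x2 \ S1duA A r x₁,
      (Finset.univ.filter fun x3 => x3 ∈ VhA A ν δ ∧ precA A x2 x3 ∧ u ∈ S1duA A r x3).card : ℕ)
      : ℝ) := by
  unfold TS
  push_cast [Finset.card_filter]
  simp_rw [dot_ind]
  simp_rw [Finset.sum_filter]
  rw [Finset.sum_congr rfl (fun x2 _ => Finset.sum_congr rfl (fun x3 _ => ?_)) (g := fun x2 =>
    ∑ x3, ∑ y, ∑ u, if (x2 ∈ VhA A ν δ ∧ x3 ∈ VhA A ν δ ∧
                precA A x2 x₁ ∧ precA A x2 x3) ∧ (y ∈ S1duA A r x₁ ∧ y ∈ S1duA A r x2) ∧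
                (u ∈ S1duA A r x2 \ S1duA A r x₁ ∧ u ∈ S1duA A r x3) then (1 : ℝ) else 0)]
  · rw [Finset.sum_congr rfl (fun x2 _ => Finset.sum_comm), Finset.sum_comm]
    refine Finset.sum_congr rfl fun y _ => ?_
    by_cases hy : y ∈ S1duA A r x₁
    · rw [if_pos hy]
      refine Finset.sum_congr rfl fun x2 _ => ?_
      by_cases hx2 : x2 ∈ VhA A ν δ ∧ precA A x2 x₁ ∧ y ∈ S1duA A r x2
      · rw [if_pos hx2, Finset.sum_comm]
        refine Finset.sum_congr rfl fun u _ => ?_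
        by_cases hu : u ∈ S1duA A r x2 \ S1duA A r x₁
        · rw [if_pos hu]
          refine Finset.sum_congr rfl fun x3 _ => ?_
          congr 1
          simp only [eq_iff_iff]
          tauto
        · rw [if_neg hu]
          refine Finset.sum_eq_zero fun x3 _ => if_neg ?_
          tauto
      · rw [if_neg hx2]
        refine Finset.sum_eq_zero fun x3 _ => Finset.sum_eq_zero fun u _ => if_neg ?_
        tauto
    · rw [if_neg hy]
      refine Finset.sum_eq_zero fun x2 _ => Finset.sum_eq_zero fun x3 _ =>
        Finset.sum_eq_zero fun u _ => if_neg ?_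
      tauto
  · by_cases h : x2 ∈ VhA A ν δ ∧ x3 ∈ VhA A ν δ ∧ precA A x2 x₁ ∧ precA A x2 x3
    · rw [if_pos h, Finset.sum_mul_sum]
      refine Finset.sum_congr rfl fun y _ => Finset.sum_congr rfl fun u _ => ?_
      by_cases h1 : y ∈ S1duA A r x₁ ∧ y ∈ S1duA A r x2
      · by_cases h2 : u ∈ S1duA A r x2 \ S1duA A r x₁ ∧ u ∈ S1duA A r x3
        · rw [if_pos h1, if_pos h2, if_pos ⟨h, h1, h2⟩, one_mul]
        · rw [if_neg h2, mul_zero, if_neg (by tauto)]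
      · rw [if_neg h1, zero_mul, if_neg (by tauto)]
    · rw [if_neg h]
      symm
      refine Finset.sum_eq_zero fun y _ => Finset.sum_eq_zero fun u _ => if_neg ?_
      tauto

lemma lb_main {R : Fin N → Fin N → Prop} {exc : Fin N → Prop} {s c : ℝ} (hs : 1 ≤ s) (hc : 0 ≤ c)
    {r : ℕ} (hr : 6 ≤ r) {ν δ : ℝ} (ω : EdgeIdx N → Bool)
    (hR : ∀ y z, degA (Adj ω) y ≤ degA (Adj ω) z → R z y) {x₁ : Fin N}
    (hx : x₁ ∈ VhA (Adj ω) ν δ) :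
    ∃ Z : ℕ, TS (Adj ω) r ν δ x₁ = Z ∧
      (1 + c) ^ Z ≤ ev (es ω) (Root R exc s (xi ν δ N) c x₁) := by
  classical
  refine ⟨_, TS_eq _ _ _ _ _, ?_⟩
  refine lb_Root (G := Gr ω) hs hc (fun e => by classical unfold es; simp)
    (A2 := fun y => Finset.univ.filter fun x2 => x2 ∈ VhA (Adj ω) ν δ ∧ precA (Adj ω) x2 x₁ ∧
      y ∈ S1duA (Adj ω) r x2)
    (A3 := fun x2 => Finset.univ.filter fun u => u ∈ S1duA (Adj ω) r x2 \ S1duA (Adj ω) r x₁)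
    (A4 := fun x2 u => Finset.univ.filter fun x3 => x3 ∈ VhA (Adj ω) ν δ ∧
      precA (Adj ω) x2 x3 ∧ u ∈ S1duA (Adj ω) r x3) ?_
  intro y hy
  simp only [Finset.mem_filter, Finset.mem_univ, true_and] at hy ⊢
  obtain ⟨y1, y2, y3, z, z1, z2, z3⟩ := id hy
  refine ⟨NC_of_notMem (G := Gr ω) hr y1 y2, ⟨z, hR _ _ (prec_le z3),
    NC_of_notMem (G := Gr ω) hr z1 z2, (prec_ne z3).symm, ?_, ?_⟩, ?_⟩
  · have h1 : xi ν δ N ≤ degA (Adj ω) x₁ := hx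
    have h2 : (degA (Adj ω) x₁ : ℝ) ≤ degA (Adj ω) z := by exact_mod_cast prec_le z3
    exact h1.trans h2
  · rintro x2 ⟨_, h2, _⟩
    exact prec_ne (prec_trans h2 z3)
  · rintro x2 ⟨h1, h2, h3⟩
    obtain ⟨a1, a2, a3, -⟩ := id h3
    refine ⟨hR _ _ (prec_le a3), NC_of_notMem' (G := Gr ω) hr a1 a2, prec_ne h2, h1, ?_⟩
    rintro u ⟨u1, u2⟩
    obtain ⟨b1, b2, b3, -⟩ := id u1
    refine ⟨NC_of_notMem (G := Gr ω) hr b1 b2, ?_, ?_⟩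
    · rintro rfl
      exact u2 hy
    · rintro x3 ⟨d1, d2, d3⟩
      obtain ⟨e1, e2, e3, -⟩ := id d3
      exact ⟨hR _ _ (prec_le d2), hR _ _ (prec_le e3), NC_of_notMem' (G := Gr ω) hr e1 e2,
        (prec_ne d2).symm, d1⟩

end Lower
end TOB

set_option linter.unusedSectionVars false
namespace TOB
open MvPolynomial GRG

section Mass
variable {N : ℕ}

lemma prod_le_exp {ι : Type*} (t : Finset ι) (f : ι → ℝ) (hf : ∀ i ∈ t, 0 ≤ f i) :
    ∏ i ∈ t, (1 + f i) ≤ exp (∑ i ∈ t, f i) := by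
  rw [exp_sum]
  refine Finset.prod_le_prod (fun i hi => by linarith [hf i hi]) fun i _ => ?_
  rw [add_comm]; exact add_one_le_exp _

lemma exp_sub_le {t : ℝ} (h0 : 0 ≤ t) (h1 : t ≤ 1) : exp t - 1 ≤ 2 * t := by
  have := Real.abs_exp_sub_one_le (x := t) (by rw [abs_of_nonneg h0]; exact h1)
  rw [abs_of_nonneg h0] at this
  exact (le_abs_self _).trans this

/-- Assumptions on the parameters used in the mass bound. -/
structure Par (w : Fin N → ℝ) (B T l K C0 s ξ c h0 Λ : ℝ) : Prop where
  hw : ∀ x, 0 < w x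
  hB : ∑ x, w x ^ 2 ≤ B * ∑ x, w x
  B0 : 0 ≤ B
  T0 : 0 < T
  Tl : T ≤ l
  K1 : 1 ≤ K
  lK : l ≤ K * T
  C01 : 1 ≤ C0
  hs : 1 ≤ s
  hc : 0 ≤ c
  hh0 : s ^ (-(ξ - 1)) * exp (3 * s * T) ≤ h0
  hΛ : Λ = C0 * B * K + C0 * l * h0
  c1 : c * Λ ≤ 1
  c2 : 2 * c * B * Λ ≤ 1
  c3 : C0 * B * K * (4 * c * B * Λ) + C0 * l * h0 ≤ 1

variable {w : Fin N → ℝ} {B T l K C0 s ξ c h0 Λ : ℝ}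

/-- the relation -/
def Rel (w : Fin N → ℝ) (C0 l : ℝ) (z y : Fin N) : Prop := w y ≤ C0 * max (w z) l

lemma q_sum (hw : ∀ x, 0 < w x) (v : Fin N) : ∑ u, qw w s(v, u) = w v := by
  have := W_pos hw v
  simp_rw [qw_mk]
  rw [← Finset.sum_div, ← Finset.mul_sum]
  field_simp

namespace Par

lemma h00 (h : Par w B T l K C0 s ξ c h0 Λ) : 0 ≤ h0 := le_trans (mul_nonneg (rpow_nonneg (by linarith [h.hs]) _) (exp_pos _).le) h.hh0

lemma Λ0 (h : Par w B T l K C0 s ξ c h0 Λ) : 0 ≤ Λ := by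
  have := h.B0; have := h.T0; have := h.Tl; have := h.K1; have := h.C01; have := h.h00
  have : 0 ≤ l := by linarith
  have : 0 ≤ C0 := by linarith
  have : 0 ≤ K := by linarith
  rw [h.hΛ]; positivity

open Classical in
lemma sumR (h : Par w B T l K C0 s ξ c h0 Λ) (y : Fin N) {n : ℝ} (hn : 0 ≤ n) {g : Fin N → ℝ}
    (hg : ∀ x, g x ≤ if w x < T then h0 else n) :
    ∑ x with Rel w C0 l x y, qw w s(y, x) * g x ≤ C0 * B * K * n + C0 * l * h0 := by
  have hW := W_pos h.hw y
  have := h.B0; have hT := h.T0; have hTl := h.Tl; have hK1 := h.K1; have := h.C01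
  have hh := h.h00
  have hl : 0 ≤ l := by linarith
  have hC : 0 ≤ C0 := by linarith
  have hK : 0 ≤ K := by linarith
  have key : ∀ x ∈ Finset.univ.filter (fun x => Rel w C0 l x y), qw w s(y, x) * g x ≤
      (C0 * K * n) * (w x ^ 2 / ∑ z, w z) + (C0 * l * h0) * (w x / ∑ z, w z) := by
    intro x hx
    have hx : w y ≤ C0 * max (w x) l := (Finset.mem_filter.mp hx).2
    have hwx := h.hw x
    have hwy := h.hw y
    refine (mul_le_mul_of_nonneg_left (hg x) (qw_nonneg h.hw _)).trans ?_
    rw [qw_mk]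
    have e : (C0 * K * n) * (w x ^ 2 / ∑ z, w z) + (C0 * l * h0) * (w x / ∑ z, w z)
      = ((C0 * K * n) * w x ^ 2 + (C0 * l * h0) * w x) / ∑ z, w z := by ring
    rw [e, div_mul_eq_mul_div]
    refine div_le_div_of_nonneg_right ?_ hW.le
    by_cases hex : w x < T
    · rw [if_pos hex]
      rw [max_eq_right (by linarith)] at hx
      have h1 : w y * w x * h0 ≤ C0 * l * w x * h0 := by gcongr
      have h2 : 0 ≤ (C0 * K * n) * w x ^ 2 := by positivity
      linarith
    · rw [if_neg hex]
      push Not at hex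
      have h3 : max (w x) l ≤ K * w x := by
        refine max_le (by nlinarith) (h.lK.trans (by gcongr))
      have h4 : w y ≤ C0 * (K * w x) := hx.trans (by gcongr)
      have h1 : w y * w x * n ≤ C0 * (K * w x) * w x * n := by gcongr
      have h2 : 0 ≤ (C0 * l * h0) * w x := by positivity
      linarith
  refine (Finset.sum_le_sum key).trans ?_
  refine (Finset.sum_le_sum_of_subset_of_nonneg (Finset.filter_subset _ _) (fun x _ _ => by
    have hwx := h.hw x
    positivity)).trans ?_
  rw [Finset.sum_add_distrib, ← Finset.mul_sum, ← Finset.mul_sum, ← Finset.sum_div,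
    ← Finset.sum_div, div_self hW.ne', mul_one]
  have : (∑ x, w x ^ 2) / ∑ z, w z ≤ B := by rw [div_le_iff₀ hW]; exact h.hB
  have : C0 * K * n * ((∑ x, w x ^ 2) / ∑ z, w z) ≤ C0 * K * n * B := by gcongr
  linarith

/-- bound on the star mass -/
lemma St_le (h : Par w B T l K C0 s ξ c h0 Λ) (v : Fin N) : eval (qw w) (St (fun x => w x < T) s ξ v)
    ≤ if w v < T then h0 else 1 := by
  have hs := h.hs
  unfold St NP
  simp only [map_mul, map_prod, map_add, map_one, eval_C, eval_X, mul_zero, add_zero, map_zero]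
  by_cases hv : w v < T
  · simp only [hv, if_true]
    refine le_trans ?_ h.hh0
    refine mul_le_mul_of_nonneg_left ?_ (rpow_nonneg (by linarith) _)
    refine (prod_le_exp _ _ fun u _ => mul_nonneg (qw_nonneg h.hw _) (by linarith)).trans ?_
    rw [← Finset.sum_mul, q_sum h.hw, exp_le_exp]
    have := h.hw v
    nlinarith
  · simp [hv]

lemma St_nonneg (h : Par w B T l K C0 s ξ c h0 Λ) (v : Fin N) : 0 ≤ eval (qw w) (St (fun x => w x < T) s ξ v) :=
  eval_nonneg (qw_nonneg h.hw) (NN_St h.hs v)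

open Classical in
lemma sumSt (h : Par w B T l K C0 s ξ c h0 Λ) (y : Fin N) : ∑ x with Rel w C0 l x y,
    qw w s(y, x) * eval (qw w) (St (fun x => w x < T) s ξ x) ≤ Λ := by
  have := h.sumR y zero_le_one h.St_le
  rw [h.hΛ]; linarith

open Classical in
lemma conv (h : Par w B T l K C0 s ξ c h0 Λ) (x : Fin N) : ∑ u, qw w s(x, u) * ∑ z with Rel w C0 l z x,
    qw w s(u, z) * eval (qw w) (St (fun x => w x < T) s ξ z) ≤ B * Λ := by
  have hW := W_pos h.hw x
  simp_rw [Finset.mul_sum]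
  rw [Finset.sum_comm]
  have e : ∀ z, ∑ u, qw w s(x, u) * (qw w s(u, z) * eval (qw w) (St (fun x => w x < T) s ξ z))
      = ((∑ x, w x ^ 2) / ∑ z, w z) *
        (qw w s(x, z) * eval (qw w) (St (fun x => w x < T) s ξ z)) := by
    intro z
    rw [Finset.sum_div, Finset.sum_mul]
    refine Finset.sum_congr rfl fun u _ => ?_
    simp_rw [qw_mk]
    ring
  simp_rw [e]
  rw [← Finset.mul_sum]
  have h1 : (∑ x, w x ^ 2) / ∑ z, w z ≤ B := by rw [div_le_iff₀ hW]; exact h.hB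
  refine mul_le_mul h1 (h.sumSt x) (Finset.sum_nonneg fun z _ =>
    mul_nonneg (qw_nonneg h.hw _) (h.St_nonneg z)) h.B0

open Classical in
lemma Leaf_le (h : Par w B T l K C0 s ξ c h0 Λ) (x u : Fin N) : eval (qw w) (Leaf (Rel w C0 l) (fun x => w x < T) s ξ c x u) ≤
    2 * c * ∑ z with Rel w C0 l z x ∧ Rel w C0 l z u,
      qw w s(u, z) * eval (qw w) (St (fun x => w x < T) s ξ z) := by
  have hc := h.hc
  unfold Leaf
  simp only [map_mul, map_prod, map_add, map_one, eval_C, eval_X, map_sub]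
  have hnn : ∀ z, 0 ≤ qw w s(u, z) * eval (qw w) (St (fun x => w x < T) s ξ z) := fun z =>
    mul_nonneg (qw_nonneg h.hw _) (h.St_nonneg z)
  have h1 := prod_le_exp (Finset.univ.filter fun z => Rel w C0 l z x ∧ Rel w C0 l z u)
    (fun z => qw w s(u, z) * (c * eval (qw w) (St (fun x => w x < T) s ξ z)))
    (fun z _ => mul_nonneg (qw_nonneg h.hw _) (mul_nonneg h.hc (h.St_nonneg z)))
  have e : ∑ z with Rel w C0 l z x ∧ Rel w C0 l z u,
      qw w s(u, z) * (c * eval (qw w) (St (fun x => w x < T) s ξ z)) =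
      c * ∑ z with Rel w C0 l z x ∧ Rel w C0 l z u,
      qw w s(u, z) * eval (qw w) (St (fun x => w x < T) s ξ z) := by
    rw [Finset.mul_sum]; exact Finset.sum_congr rfl fun _ _ => by ring
  rw [e] at h1
  have h2 : ∑ z with Rel w C0 l z x ∧ Rel w C0 l z u,
      qw w s(u, z) * eval (qw w) (St (fun x => w x < T) s ξ z) ≤ Λ := by
    refine le_trans (Finset.sum_le_sum_of_subset_of_nonneg ?_ fun z _ _ => hnn z) (h.sumSt u)
    intro z; simp
  have h3 : 0 ≤ ∑ z with Rel w C0 l z x ∧ Rel w C0 l z u,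
      qw w s(u, z) * eval (qw w) (St (fun x => w x < T) s ξ z) :=
    Finset.sum_nonneg fun z _ => hnn z
  have h4 := exp_sub_le (mul_nonneg hc h3) ((mul_le_mul_of_nonneg_left h2 hc).trans h.c1)
  linarith

lemma Leaf_nonneg (h : Par w B T l K C0 s ξ c h0 Λ) (x u : Fin N) :
    0 ≤ eval (qw w) (Leaf (Rel w C0 l) (fun x => w x < T) s ξ c x u) :=
  eval_nonneg (qw_nonneg h.hw) (NN_Leaf h.hs h.hc x u)

lemma Leaf_le_two (h : Par w B T l K C0 s ξ c h0 Λ) (x u : Fin N) :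
    eval (qw w) (Leaf (Rel w C0 l) (fun x => w x < T) s ξ c x u) ≤ 2 := by
  classical
  refine (h.Leaf_le x u).trans ?_
  have hnn : ∀ z, 0 ≤ qw w s(u, z) * eval (qw w) (St (fun x => w x < T) s ξ z) := fun z =>
    mul_nonneg (qw_nonneg h.hw _) (h.St_nonneg z)
  have h2 : ∑ z with Rel w C0 l z x ∧ Rel w C0 l z u,
      qw w s(u, z) * eval (qw w) (St (fun x => w x < T) s ξ z) ≤ Λ := by
    refine le_trans (Finset.sum_le_sum_of_subset_of_nonneg ?_ fun z _ _ => hnn z) (h.sumSt u)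
    intro z; simp
  have := (mul_le_mul_of_nonneg_left h2 h.hc).trans h.c1
  linarith

lemma sumLeaf (h : Par w B T l K C0 s ξ c h0 Λ) (x : Fin N) : ∑ u, qw w s(x, u) *
    eval (qw w) (Leaf (Rel w C0 l) (fun x => w x < T) s ξ c x u) ≤ 2 * c * B * Λ := by
  classical
  have hnn : ∀ u z, 0 ≤ qw w s(u, z) * eval (qw w) (St (fun x => w x < T) s ξ z) := fun u z =>
    mul_nonneg (qw_nonneg h.hw _) (h.St_nonneg z)
  calc _ ≤ ∑ u, qw w s(x, u) * (2 * c * ∑ z with Rel w C0 l z x,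
      qw w s(u, z) * eval (qw w) (St (fun x => w x < T) s ξ z)) := by
        refine Finset.sum_le_sum fun u _ => mul_le_mul_of_nonneg_left ?_ (qw_nonneg h.hw _)
        refine (h.Leaf_le x u).trans (mul_le_mul_of_nonneg_left ?_ (by linarith [h.hc]))
        refine Finset.sum_le_sum_of_subset_of_nonneg ?_ fun z _ _ => hnn u z
        intro z; simp; tauto
    _ = 2 * c * ∑ u, qw w s(x, u) * (∑ z with Rel w C0 l z x,
      qw w s(u, z) * eval (qw w) (St (fun x => w x < T) s ξ z)) := by
        rw [Finset.mul_sum]; exact Finset.sum_congr rfl fun _ _ => by ring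
    _ ≤ 2 * c * (B * Λ) := mul_le_mul_of_nonneg_left (h.conv x) (by linarith [h.hc])
    _ = _ := by ring

lemma Nx_le (h : Par w B T l K C0 s ξ c h0 Λ) (v : Fin N) : eval (qw w) (Nx (Rel w C0 l) (fun x => w x < T) s ξ c v)
    ≤ if w v < T then h0 else 4 * c * B * Λ := by
  have hs := h.hs
  have hLn := h.Leaf_nonneg v
  unfold Nx
  by_cases hv : w v < T
  · simp only [hv, if_true]
    unfold NP
    simp only [map_mul, map_prod, map_add, map_one, eval_C, eval_X]
    refine le_trans ?_ h.hh0
    refine mul_le_mul_of_nonneg_left ?_ (rpow_nonneg (by linarith) _)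
    have hp : ∀ u, 0 ≤ s - 1 +
        s * eval (qw w) (Leaf (Rel w C0 l) (fun x => w x < T) s ξ c v u) := fun u =>
      add_nonneg (by linarith) (mul_nonneg (by linarith) (hLn u))
    refine (prod_le_exp _ _ fun u _ => mul_nonneg (qw_nonneg h.hw _) (hp u)).trans ?_
    rw [exp_le_exp]
    calc _ ≤ ∑ u, qw w s(v, u) * (3 * s) := by
          refine Finset.sum_le_sum fun u _ => mul_le_mul_of_nonneg_left ?_ (qw_nonneg h.hw _)
          have := h.Leaf_le_two v u
          nlinarith
      _ = w v * (3 * s) := by rw [← Finset.sum_mul, q_sum h.hw]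
      _ ≤ _ := by nlinarith
  · simp only [hv, if_false]
    simp only [map_mul, map_prod, map_add, map_one, eval_X, map_sub]
    have h1 := prod_le_exp Finset.univ (fun u => qw w s(v, u) *
      eval (qw w) (Leaf (Rel w C0 l) (fun x => w x < T) s ξ c v u))
      (fun u _ => mul_nonneg (qw_nonneg h.hw _) (hLn u))
    have h2 := exp_le_exp.mpr (h.sumLeaf v)
    have h3 : 0 ≤ 2 * c * B * Λ := by
      have := h.hc; have := h.B0; have := h.Λ0; positivity
    have h4 := exp_sub_le h3 h.c2
    linarith

lemma Nx_nonneg (h : Par w B T l K C0 s ξ c h0 Λ) (v : Fin N) : 0 ≤ eval (qw w) (Nx (Rel w C0 l) (fun x => w x < T) s ξ c v) :=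
  eval_nonneg (qw_nonneg h.hw) (NN_Nx h.hs h.hc v)

open Classical in
lemma Bp_le (h : Par w B T l K C0 s ξ c h0 Λ) (x y : Fin N) : eval (qw w) (Bp (Rel w C0 l) (fun x => w x < T) s ξ c x y) ≤
    3 * ∑ z with Rel w C0 l z x,
      qw w s(y, z) * eval (qw w) (St (fun x => w x < T) s ξ z) := by
  unfold Bp
  simp only [map_mul, map_prod, map_add, map_one, eval_X, map_sum]
  rw [← Finset.sum_mul, mul_comm]
  refine mul_le_mul_of_nonneg_right ?_ (Finset.sum_nonneg fun z _ =>
    mul_nonneg (qw_nonneg h.hw _) (h.St_nonneg z))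
  refine (prod_le_exp _ _ fun u _ => mul_nonneg (qw_nonneg h.hw _) (h.Nx_nonneg u)).trans ?_
  have h3 : 0 ≤ 4 * c * B * Λ := by
    have := h.hc; have := h.B0; have := h.Λ0; positivity
  have h1 := (h.sumR y h3 h.Nx_le).trans h.c3
  refine (exp_le_exp.mpr h1).trans ?_
  have := Real.exp_one_lt_d9
  linarith

lemma Root_le (h : Par w B T l K C0 s ξ c h0 Λ) (x : Fin N) : eval (qw w) (Root (Rel w C0 l) (fun x => w x < T) s ξ c x) ≤
    exp (3 * B * Λ) := by
  classical
  unfold Root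
  simp only [map_mul, map_prod, map_add, map_one, eval_X]
  refine (prod_le_exp _ _ fun u _ => mul_nonneg (qw_nonneg h.hw _)
    (eval_nonneg (qw_nonneg h.hw) (NN_Bp h.hs h.hc x u))).trans ?_
  rw [exp_le_exp]
  calc _ ≤ ∑ u, qw w s(x, u) * (3 * ∑ z with Rel w C0 l z x,
      qw w s(u, z) * eval (qw w) (St (fun x => w x < T) s ξ z)) :=
        Finset.sum_le_sum fun u _ => mul_le_mul_of_nonneg_left (h.Bp_le x u) (qw_nonneg h.hw _)
    _ = 3 * ∑ u, qw w s(x, u) * (∑ z with Rel w C0 l z x,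
      qw w s(u, z) * eval (qw w) (St (fun x => w x < T) s ξ z)) := by
        rw [Finset.mul_sum]; exact Finset.sum_congr rfl fun _ _ => by ring
    _ ≤ _ := by linarith [h.conv x]

end Par
end Mass
end TOB

set_option linter.unusedSectionVars false
namespace TOB
open MvPolynomial GRG

section Tails
variable {N : ℕ} {w : Fin N → ℝ}

lemma deg_eq (ω : EdgeIdx N → Bool) (v : Fin N) [DecidablePred fun u => s(v, u) ∈ es ω] :
    degA (Adj ω) v = (Finset.univ.filter fun u => s(v, u) ∈ es ω).card := by
  unfold GRG.degA
  rw [← Set.ncard_coe_finset]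
  congr 1
  ext; simp [mem_es]

lemma upper_tail (hw : ∀ x, 0 < w x) (z : Fin N) (a : ℝ) :
    grgMeasure w {ω | a ≤ degA (Adj ω) z} ≤ ENNReal.ofReal (exp (2 * w z - a)) := by
  classical
  have he : 0 ≤ exp 1 - 1 := by have := add_one_le_exp (1 : ℝ); linarith
  have hP : ∀ u, NN (1 + X s(z, u) * C (exp 1 - 1) : Pol N) := fun u =>
    NN_one.add ((NN_X _).mul (NN_C he))
  have hm : eval (qw w) (∏ u, (1 + X s(z, u) * C (exp 1 - 1)) : Pol N) ≤ exp (2 * w z) := by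
    simp only [map_mul, map_prod, map_add, map_one, eval_C, eval_X]
    refine (prod_le_exp _ _ fun u _ => mul_nonneg (qw_nonneg hw _) he).trans ?_
    rw [← Finset.sum_mul, q_sum hw, exp_le_exp]
    have := hw z
    have := Real.exp_one_lt_d9
    nlinarith
  have := markov hw (NN_prod _ _ fun u _ => hP u) (exp_pos a) hm
  rw [← exp_sub] at this
  refine le_trans (measure_mono ?_) this
  intro ω hω
  simp only [Set.mem_ofPred_eq] at hω ⊢
  refine le_trans ?_ (ev_prod_ge Finset.univ (fun u => (1 + X s(z, u) * C (exp 1 - 1) : Pol N))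
    (fun u => if s(z, u) ∈ es ω then {s(z, u)} else ∅) _ (fun u _ => hP u) ?_ ?_)
  · calc exp a ≤ exp (degA (Adj ω) z) := exp_le_exp.mpr hω
      _ = ∏ u, if s(z, u) ∈ es ω then exp 1 else 1 := by
        rw [Finset.prod_ite, Finset.prod_const_one, mul_one, Finset.prod_const, deg_eq,
          ← exp_nat_mul, mul_one]
      _ ≤ _ := by
        refine Finset.prod_le_prod (fun _ _ => by split_ifs <;> positivity) fun u _ => ?_
        rw [ev_add, ev_one]
        split_ifs with hu
        · have h1 := ev_X (E := Sym2 (Fin N)) (ω := {s(z, u)}) (e := s(z, u)) (by simp)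
          rw [mul_comm, ev_C_mul]
          nlinarith
        · have := ev_nonneg ∅ ((NN_X s(z, u)).mul (NN_C he))
          linarith
  · intro u _
    split_ifs with h
    · simpa using h
    · simp
  · intro u _ u' _ hne
    split_ifs
    · simp only [Finset.disjoint_singleton]
      intro h
      simp only [Sym2.eq_iff] at h
      rcases h with ⟨-, h⟩ | ⟨h, h'⟩
      · exact hne h
      · exact hne (h'.trans h)
    all_goals simp

open Classical in
lemma reindex {M : Type*} [AddCommMonoid M] (y : Fin N) (F : Sym2 (Fin N) → M) :
    ∑ e : EdgeIdx N with y ∈ sy e, F (sy e) = ∑ z with z ≠ y, F s(y, z) := by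
  rw [← Finset.sum_image (f := F) (g := sy) (s := Finset.univ.filter fun e : EdgeIdx N => y ∈ sy e)
    (fun a _ b _ h => sy_inj h)]
  rw [← Finset.sum_image (f := F) (g := fun z => s(y, z)) (s := Finset.univ.filter fun z => z ≠ y)
    (fun a _ b _ h => by
      simp only [Sym2.eq_iff] at h
      rcases h with ⟨-, h⟩ | ⟨h, h'⟩
      · exact h
      · exact h'.trans h)]
  congr 1
  ext e
  simp only [Finset.mem_image, Finset.mem_filter, Finset.mem_univ, true_and]
  constructor
  · rintro ⟨⟨⟨a, b⟩, hab⟩, h1, rfl⟩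
    simp only [sy, Sym2.mem_iff] at h1 ⊢
    rcases h1 with rfl | rfl
    · exact ⟨b, hab.ne', rfl⟩
    · exact ⟨a, hab.ne, Sym2.eq_swap⟩
  · rintro ⟨z, hz, rfl⟩
    rcases lt_or_gt_of_ne hz with h | h
    · exact ⟨⟨(z, y), h⟩, by simp [sy], by simp [sy, Sym2.eq_swap]⟩
    · exact ⟨⟨(y, z), h⟩, by simp [sy], by simp [sy]⟩

/-- symmetric version of the edge probability -/
noncomputable def pS (w : Fin N → ℝ) : Sym2 (Fin N) → ℝ :=
  Sym2.lift ⟨fun x y => pGRG w x y, fun x y => by simp only [pGRG, mul_comm (w x)]⟩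

open Classical in
lemma deg_real (ω : EdgeIdx N → Bool) (y : Fin N) :
    (degA (Adj ω) y : ℝ) = ∑ e : EdgeIdx N with y ∈ sy e, if ω e = true then (1 : ℝ) else 0 := by
  rw [deg_eq]
  have := reindex y (fun e => if e ∈ es ω then (1 : ℝ) else 0)
  simp_rw [mem_es_sy] at this
  rw [this, Finset.card_filter]
  push_cast
  refine (Finset.sum_subset (Finset.subset_univ _) fun z _ hz => ?_).symm
  have hz : z = y := by simpa using hz
  subst hz
  rw [if_neg]
  rw [mem_es]
  exact Adj_irrefl ω z

lemma lower_tail (hw : ∀ x, 0 < w x) (h1 : ∀ x y, w x * w y ≤ ∑ z, w z)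
    (h2 : ∀ x, 2 * w x ≤ ∑ z, w z) (y : Fin N) :
    grgMeasure w {ω | (degA (Adj ω) y : ℝ) ≤ w y / 16} ≤ ENNReal.ofReal (exp (-(w y / 16))) := by
  classical
  have := grg_prob hw
  have hW := W_pos hw y
  let f : EdgeIdx N → Bool → ℝ := fun e b => if y ∈ sy e then (if b = true then exp (-1) else 1) else 1
  have hexp : ∀ ω : EdgeIdx N → Bool, exp (-(degA (Adj ω) y : ℝ)) = ∏ e, f e (ω e) := by
    intro ω
    rw [deg_real, ← Finset.sum_neg_distrib, exp_sum, Finset.prod_filter]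
    refine Finset.prod_congr rfl fun e _ => ?_
    simp only [f]
    split_ifs <;> simp
  have hInt1 : ∫ ω, exp (-(degA (Adj ω) y : ℝ)) ∂(grgMeasure w) ≤ exp (-(w y / 8)) := by
    simp_rw [hexp]
    unfold grgMeasure
    rw [integral_fintype_prod_eq_prod]
    have hb : ∀ e : EdgeIdx N, ∫ b, f e b ∂(bern (pGRG w e.val.1 e.val.2)) ≤
        if y ∈ sy e then exp (-(pS w (sy e) / 2)) else 1 := by
      intro e
      have hp0 := p_nonneg hw e.val.1 e.val.2
      have hp1 := p_le_one hw e.val.1 e.val.2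
      have hpS : pS w (sy e) = pGRG w e.val.1 e.val.2 := rfl
      have hi : ∀ g : Bool → ℝ, ∫ b, g b ∂(bern (pGRG w e.val.1 e.val.2)) =
          pGRG w e.val.1 e.val.2 * g true + (1 - pGRG w e.val.1 e.val.2) * g false := by
        intro g
        unfold bern
        rw [integral_add_measure (Integrable.smul_measure Integrable.of_finite ENNReal.ofReal_ne_top)
          (Integrable.smul_measure Integrable.of_finite ENNReal.ofReal_ne_top), integral_smul_measure, integral_smul_measure,
          integral_dirac, integral_dirac, ENNReal.toReal_ofReal hp0,
          ENNReal.toReal_ofReal (by linarith)]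
        simp
      rw [hi]
      simp only [f]
      by_cases hy : y ∈ sy e
      · simp only [hy, if_true]
        rw [hpS]
        refine le_trans ?_ (add_one_le_exp _)
        have : exp (-1 : ℝ) ≤ 1 / 2 := by
          have := Real.exp_neg_one_lt_half
          linarith
        simp
        nlinarith
      · simp [hy]
    refine (Finset.prod_le_prod (fun e _ => ?_) fun e _ => hb e).trans ?_
    · refine integral_nonneg fun b => ?_
      simp only [f]
      split_ifs <;> simp [exp_nonneg]
    rw [← Finset.prod_filter, ← exp_sum, exp_le_exp]
    rw [reindex y (fun e => -(pS w e / 2))]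
    rw [Finset.sum_neg_distrib, neg_le_neg_iff]
    have hge : ∀ z, w y * w z / (4 * ∑ z, w z) ≤ pS w s(y, z) / 2 := by
      intro z
      have e : pS w s(y, z) = w y * w z / ((∑ z, w z) + w y * w z) := rfl
      have hpos := mul_pos (hw y) (hw z)
      rw [e, div_div]
      exact div_le_div_of_nonneg_left hpos.le (by positivity) (by linarith [h1 y z])
    calc w y / 8 ≤ w y * ((∑ z, w z) - w y) / (4 * ∑ z, w z) := by
          rw [div_le_div_iff₀ (by norm_num) (by positivity)]
          have := h2 y
          have := hw y
          nlinarith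
      _ = ∑ z with z ≠ y, w y * w z / (4 * ∑ z, w z) := by
          rw [← Finset.sum_div, ← Finset.mul_sum]
          congr 2
          rw [Finset.filter_ne', ← Finset.sum_erase_add _ _ (Finset.mem_univ y)]
          ring
      _ ≤ _ := Finset.sum_le_sum fun z _ => hge z
  have hm := mul_meas_ge_le_integral_of_nonneg (μ := grgMeasure w)
    (f := fun ω => exp (-(degA (Adj ω) y : ℝ))) (by filter_upwards with ω; positivity)
    (Integrable.of_finite) (exp (-(w y / 16)))
  have hs : {ω : EdgeIdx N → Bool | (degA (Adj ω) y : ℝ) ≤ w y / 16} =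
      {ω | exp (-(w y / 16)) ≤ exp (-(degA (Adj ω) y : ℝ))} := by
    ext ω
    simp
  rw [hs, ← ofReal_measureReal]
  refine ENNReal.ofReal_le_ofReal ?_
  have h3 := hm.trans hInt1
  have h4 : exp (-(w y / 8)) = exp (-(w y / 16)) * exp (-(w y / 16)) := by
    rw [← exp_add]; congr 1; ring
  rw [h4] at h3
  exact le_of_mul_le_mul_left h3 (exp_pos _)

lemma good (hw : ∀ x, 0 < w x) (h1 : ∀ x y, w x * w y ≤ ∑ z, w z)
    (h2 : ∀ x, 2 * w x ≤ ∑ z, w z) {ν l : ℝ} (hν : 0 < ν) (hl : 0 ≤ l) :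
    grgMeasure w {ω | ¬ ∀ y z, degA (Adj ω) y ≤ degA (Adj ω) z → Rel w (16 * (ν + 4)) l z y} ≤
      ENNReal.ofReal (N * (2 * exp (-((ν + 2) * l)))) := by
  classical
  have hsub : {ω | ¬ ∀ y z, degA (Adj ω) y ≤ degA (Adj ω) z → Rel w (16 * (ν + 4)) l z y} ⊆
      ⋃ y : Fin N, ({ω | (ν + 4) * max (w y) l ≤ degA (Adj ω) y} ∪
        {ω | 16 * (ν + 2) * l ≤ w y ∧ (degA (Adj ω) y : ℝ) ≤ w y / 16}) := by
    intro ω hω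
    by_contra hcon
    apply hω
    simp only [Set.mem_iUnion, Set.mem_union, Set.mem_ofPred_eq, not_exists, not_or, not_and,
      not_le] at hcon
    intro y z hyz
    have hz := (hcon z).1
    have hyz' : (degA (Adj ω) y : ℝ) ≤ degA (Adj ω) z := by exact_mod_cast hyz
    have hm : l ≤ max (w z) l := le_max_right _ _
    unfold Rel
    by_cases hy : 16 * (ν + 2) * l ≤ w y
    · have := (hcon y).2 hy
      nlinarith
    · push Not at hy
      nlinarith
  refine (measure_mono hsub).trans ((measure_iUnion_le _).trans ?_)
  rw [tsum_fintype]
  have hb : ∀ y : Fin N, grgMeasure w ({ω | (ν + 4) * max (w y) l ≤ degA (Adj ω) y} ∪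
        {ω | 16 * (ν + 2) * l ≤ w y ∧ (degA (Adj ω) y : ℝ) ≤ w y / 16}) ≤
        ENNReal.ofReal (2 * exp (-((ν + 2) * l))) := by
    intro y
    rw [two_mul, ENNReal.ofReal_add (exp_pos _).le (exp_pos _).le]
    refine (measure_union_le _ _).trans (add_le_add ?_ ?_)
    · refine (upper_tail hw y _).trans (ENNReal.ofReal_le_ofReal (exp_le_exp.mpr ?_))
      have a1 : l ≤ max (w y) l := le_max_right _ _
      have a2 : w y ≤ max (w y) l := le_max_left _ _
      nlinarith
    · by_cases hy : 16 * (ν + 2) * l ≤ w y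
      · simp only [hy, true_and]
        refine (lower_tail hw h1 h2 y).trans (ENNReal.ofReal_le_ofReal (exp_le_exp.mpr ?_))
        linarith
      · simp [hy]
  refine (Finset.sum_le_sum fun y _ => hb y).trans ?_
  rw [Finset.sum_const, Finset.card_univ, Fintype.card_fin, nsmul_eq_mul,
    ENNReal.ofReal_mul (p := (N : ℝ)) (by positivity), ENNReal.ofReal_natCast]

end Tails
end TOB

set_option linter.unusedSectionVars false
namespace TOB
open GRG Filter

lemma asym {δ ν Cb C0 c0 : ℝ} (hδ : 0 < δ) (hδ' : δ < 1 / 3) (hν : 0 < ν) (hCb : 0 < Cb)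
    (hC0 : 1 ≤ C0) (hc0 : 0 < c0) : ∀ᶠ l : ℝ in atTop,
    ∃ B T K s c h0 Λ : ℝ, B = Cb * l ^ δ ∧
      0 ≤ B ∧ 0 < T ∧ T ≤ l ∧ 1 ≤ K ∧ l ≤ K * T ∧ 1 ≤ s ∧ 0 ≤ c ∧
      s ^ (-(c0 * (l / log l) - 1)) * exp (3 * s * T) ≤ h0 ∧
      Λ = C0 * B * K + C0 * l * h0 ∧ c * Λ ≤ 1 ∧ 2 * c * B * Λ ≤ 1 ∧
      C0 * B * K * (4 * c * B * Λ) + C0 * l * h0 ≤ 1 ∧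
      3 * B * Λ + (ν + 1) * l ≤ 2 * ν * (l / log l) ^ 2 * log (1 + c) := by
  obtain ⟨τ, hτ⟩ : ∃ τ, τ = 1 - 3 * δ := ⟨_, rfl⟩
  have hτ0 : 0 < τ := by linarith
  obtain ⟨a, ha⟩ : ∃ a, a = τ / 8 := ⟨_, rfl⟩
  have ha0 : 0 < a := by linarith
  have ha1 : a < 1 / 8 := by linarith
  obtain ⟨M, hM⟩ : ∃ M, M = C0 * Cb + C0 := ⟨_, rfl⟩
  have hM0 : 0 < M := by rw [hM]; positivity
  have hη : 0 < 1 / (1 + 4 * C0 * Cb ^ 2 * M + 2 * Cb * M + M + C0) := by positivity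
  have E2 := (tendsto_rpow_neg_atTop (y := τ / 2) (by linarith)).eventually_le_const hη
  have E3 := (tendsto_rpow_neg_atTop (y := a / 2) (by linarith)).eventually_le_const
    (show 0 < a * c0 / 12 by positivity)
  have E4 := Real.isLittleO_log_id_atTop.bound (show 0 < (a * c0 / 4) / (2 + a / 2) by positivity)
  have E5 := (isLittleO_log_rpow_atTop (r := a / 4) (by linarith)).bound one_pos
  have E6 := (tendsto_rpow_atTop (y := a / 2) (by linarith)).eventually_ge_atTop
    ((3 * Cb * M + ν + 1) / ν)
  filter_upwards [E2, E3, E4, E5, E6, eventually_ge_atTop 3] with l E2 E3 E4 E5 E6 hl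
  have hl0 : 0 < l := by linarith
  have hl1 : 1 ≤ l := by linarith
  have hlog : 0 < log l := log_pos (by linarith)
  have hmono : ∀ x y : ℝ, x ≤ y → l ^ x ≤ l ^ y := fun x y h => rpow_le_rpow_of_exponent_le hl1 h
  have hrp : ∀ x : ℝ, 0 < l ^ x := fun x => rpow_pos_of_pos hl0 x
  have hadd : ∀ x y : ℝ, l ^ x * l ^ y = l ^ (x + y) := fun x y => (rpow_add hl0 x y).symm
  have hinv : l * l ^ (-2 : ℝ) = l ^ (-1 : ℝ) := by
    nth_rewrite 1 [← rpow_one l]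
    rw [hadd]; norm_num
  -- bound on Λ
  have hΛ1 : C0 * (Cb * l ^ δ) * l ^ a + C0 * l * l ^ (-2 : ℝ) ≤ M * l ^ (δ + a) := by
    have e1 : C0 * (Cb * l ^ δ) * l ^ a = C0 * Cb * l ^ (δ + a) := by rw [← hadd]; ring
    have e2 : C0 * l * l ^ (-2 : ℝ) ≤ C0 * l ^ (δ + a) := by
      rw [mul_assoc, hinv]
      exact mul_le_mul_of_nonneg_left (hmono _ _ (by linarith)) (by linarith)
    rw [e1, hM]; linarith
  have hη' : (1 + 4 * C0 * Cb ^ 2 * M + 2 * Cb * M + M + C0) * l ^ (-(τ / 2)) ≤ 1 := by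
    rw [le_div_iff₀ (by positivity)] at E2; linarith
  have hP := hrp (-(τ / 2))
  have hC00 : 0 < C0 := by linarith
  refine ⟨Cb * l ^ δ, l ^ (1 - a), l ^ a, l ^ (a / 2), l ^ (-1 + a), l ^ (-2 : ℝ), _, rfl,
    by positivity, by positivity, ?_, one_le_rpow hl1 ha0.le, ?_, one_le_rpow hl1 (by linarith),
    by positivity, ?_, rfl, ?_, ?_, ?_, ?_⟩
  · simpa using hmono (1 - a) 1 (by linarith)
  · rw [hadd]; simp
  · rw [← rpow_mul hl0.le, rpow_def_of_pos hl0, rpow_def_of_pos hl0 (-2 : ℝ), ← exp_add,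
      exp_le_exp]
    have e1 : l ^ (a / 2) * l ^ (1 - a) = l * l ^ (-(a / 2)) := by
      nth_rewrite 3 [← rpow_one l]
      rw [hadd, hadd]; congr 1; ring
    have e2 : 3 * l ^ (a / 2) * l ^ (1 - a) ≤ a * c0 / 4 * l := by
      rw [mul_assoc, e1]
      nlinarith
    have e3 : (2 + a / 2) * log l ≤ a * c0 / 4 * l := by
      rw [norm_of_nonneg hlog.le, id, norm_of_nonneg hl0.le, div_mul_eq_mul_div,
        le_div_iff₀ (by linarith)] at E4
      linarith
    have e4 : log l * (a / 2 * -(c0 * (l / log l) - 1)) = - (a / 2 * c0 * l) + a / 2 * log l := by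
      field_simp; ring
    rw [e4]
    linarith
  · calc l ^ (-1 + a) * (C0 * (Cb * l ^ δ) * l ^ a + C0 * l * l ^ (-2 : ℝ))
        ≤ l ^ (-1 + a) * (M * l ^ (δ + a)) := by gcongr
      _ = M * l ^ (-1 + a + (δ + a)) := by rw [← hadd (-1 + a) (δ + a)]; ring
      _ ≤ M * l ^ (-(τ / 2)) := by
        refine mul_le_mul_of_nonneg_left (hmono _ _ (by linarith)) hM0.le
      _ ≤ (1 + 4 * C0 * Cb ^ 2 * M + 2 * Cb * M + M + C0) * l ^ (-(τ / 2)) := by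
        refine mul_le_mul_of_nonneg_right ?_ hP.le
        have : 0 < 1 + 4 * C0 * Cb ^ 2 * M + 2 * Cb * M + C0 := by positivity
        linarith
      _ ≤ 1 := hη'
  · calc 2 * l ^ (-1 + a) * (Cb * l ^ δ) * (C0 * (Cb * l ^ δ) * l ^ a + C0 * l * l ^ (-2 : ℝ))
        ≤ 2 * l ^ (-1 + a) * (Cb * l ^ δ) * (M * l ^ (δ + a)) := by gcongr
      _ = 2 * Cb * M * l ^ (-1 + a + δ + (δ + a)) := by
          rw [← hadd (-1 + a + δ) (δ + a), ← hadd (-1 + a) δ]; ring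
      _ ≤ 2 * Cb * M * l ^ (-(τ / 2)) := by
        refine mul_le_mul_of_nonneg_left (hmono _ _ (by linarith)) (by positivity)
      _ ≤ (1 + 4 * C0 * Cb ^ 2 * M + 2 * Cb * M + M + C0) * l ^ (-(τ / 2)) := by
        refine mul_le_mul_of_nonneg_right ?_ hP.le
        have : 0 < 1 + 4 * C0 * Cb ^ 2 * M + M + C0 := by positivity
        linarith
      _ ≤ 1 := hη'
  · calc C0 * (Cb * l ^ δ) * l ^ a * (4 * l ^ (-1 + a) * (Cb * l ^ δ) *
          (C0 * (Cb * l ^ δ) * l ^ a + C0 * l * l ^ (-2 : ℝ))) + C0 * l * l ^ (-2 : ℝ)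
        ≤ C0 * (Cb * l ^ δ) * l ^ a * (4 * l ^ (-1 + a) * (Cb * l ^ δ) *
          (M * l ^ (δ + a))) + C0 * l ^ (-1 : ℝ) := by
          rw [mul_assoc C0 l, hinv]
          rw [mul_assoc C0 l, hinv] at hΛ1
          gcongr
      _ = 4 * C0 * Cb ^ 2 * M * l ^ (δ + a + (-1 + a) + δ + (δ + a)) + C0 * l ^ (-1 : ℝ) := by
          rw [← hadd (δ + a + (-1 + a) + δ) (δ + a), ← hadd (δ + a + (-1 + a)) δ,
            ← hadd (δ + a) (-1 + a), ← hadd δ a]; ring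
      _ ≤ 4 * C0 * Cb ^ 2 * M * l ^ (-(τ / 2)) + C0 * l ^ (-(τ / 2)) := by
        refine add_le_add ?_ ?_
        · refine mul_le_mul_of_nonneg_left (hmono _ _ (by linarith)) (by positivity)
        · refine mul_le_mul_of_nonneg_left (hmono _ _ (by linarith)) (by positivity)
      _ ≤ (1 + 4 * C0 * Cb ^ 2 * M + 2 * Cb * M + M + C0) * l ^ (-(τ / 2)) := by
        rw [← add_mul]
        refine mul_le_mul_of_nonneg_right ?_ hP.le
        have : 0 < 1 + 2 * Cb * M + M := by positivity
        linarith
      _ ≤ 1 := hη'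
  · have f1 : 3 * (Cb * l ^ δ) * (C0 * (Cb * l ^ δ) * l ^ a + C0 * l * l ^ (-2 : ℝ)) ≤
        3 * Cb * M * l := by
      calc _ ≤ 3 * (Cb * l ^ δ) * (M * l ^ (δ + a)) := by gcongr
        _ = 3 * Cb * M * l ^ (δ + (δ + a)) := by rw [← hadd δ (δ + a)]; ring
        _ ≤ 3 * Cb * M * l ^ (1 : ℝ) :=
          mul_le_mul_of_nonneg_left (hmono _ _ (by linarith)) (by positivity)
        _ = _ := by rw [rpow_one]
    have hc1 : l ^ (-1 + a) ≤ 1 := by simpa using hmono (-1 + a) 0 (by linarith)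
    have f2 : l ^ (-1 + a) / 2 ≤ log (1 + l ^ (-1 + a)) := by
      have hc := hrp (-1 + a)
      have h1 := one_sub_inv_le_log_of_pos (show 0 < 1 + l ^ (-1 + a) by positivity)
      refine le_trans ?_ h1
      generalize l ^ (-1 + a) = t at *
      have : 1 - (1 + t)⁻¹ = t / (1 + t) := by field_simp; ring
      rw [this]
      exact div_le_div_of_nonneg_left hc.le (by positivity) (by linarith)
    have f3 : log l ^ 2 ≤ l ^ (a / 2) := by
      rw [norm_of_nonneg hlog.le, norm_of_nonneg (hrp _).le, one_mul] at E5
      have e : l ^ (a / 2) = l ^ (a / 4) * l ^ (a / 4) := by rw [hadd]; congr 1; ring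
      rw [e, sq]
      exact mul_le_mul E5 E5 hlog.le (hrp _).le
    rw [div_le_iff₀ hν] at E6
    have f4 : ν * (l * l ^ (a / 2)) ≤ 2 * ν * (l / log l) ^ 2 * (l ^ (-1 + a) / 2) := by
      have e : 2 * ν * (l / log l) ^ 2 * (l ^ (-1 + a) / 2)
        = ν * (l * (l * l ^ (-1 + a) / log l ^ 2)) := by field_simp
      rw [e]
      have e2 : l * l ^ (-1 + a) = l ^ (a / 2) * l ^ (a / 2) := by
        nth_rewrite 1 [← rpow_one l]
        rw [hadd, hadd]; congr 1; ring
      rw [e2]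
      gcongr
      rw [le_div_iff₀ (by positivity)]
      gcongr
    calc _ ≤ 3 * Cb * M * l + (ν + 1) * l := by linarith
      _ = (3 * Cb * M + ν + 1) * l := by ring
      _ ≤ l ^ (a / 2) * ν * l := by gcongr
      _ = ν * (l * l ^ (a / 2)) := by ring
      _ ≤ _ := f4
      _ ≤ _ := by gcongr

end TOB

set_option linter.unusedSectionVars false
namespace TOB
open GRG Filter

/-- Probability bound for a fixed size `N`. -/
lemma fixed_N {N : ℕ} {w : Fin N → ℝ} {r : ℕ} {δ ν B T K s c h0 Λ : ℝ} (hr : 6 ≤ r)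
    (hN : 1 ≤ N) (hν : 0 < ν)
    (h1 : ∀ x y, w x * w y ≤ ∑ z, w z) (h2 : ∀ x, 2 * w x ≤ ∑ z, w z)
    (hp : Par w B T (log N) K (16 * (ν + 4)) s (xi ν δ N) c h0 Λ)
    (hfin : 3 * B * Λ + (ν + 1) * log N ≤
      2 * ν * (log N / log (log N)) ^ 2 * log (1 + c)) :
    1 - ENNReal.ofReal (3 * (N : ℝ) ^ (-ν)) ≤
      grgMeasure w {ω | ∀ x₁ : Fin N, x₁ ∈ VhA (Adj ω) ν δ →
        TS (Adj ω) r ν δ x₁ ≤ 2 * ν * (log N / log (log N)) ^ 2} := by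
  haveI := grg_prob hp.hw
  have hN0 : (0 : ℝ) < N := by exact_mod_cast hN
  have hl : 0 ≤ log (N : ℝ) := log_nonneg (by exact_mod_cast hN)
  obtain ⟨q, hq⟩ : ∃ q, q = 2 * ν * (log N / log (log N)) ^ 2 := ⟨_, rfl⟩
  rw [← hq] at hfin ⊢
  have hc := hp.hc
  set S := {ω : EdgeIdx N → Bool | ∀ x₁ : Fin N, x₁ ∈ VhA (Adj ω) ν δ →
        TS (Adj ω) r ν δ x₁ ≤ q} with hS
  set Bd := {ω : EdgeIdx N → Bool |
    ¬ ∀ y z, degA (Adj ω) y ≤ degA (Adj ω) z → Rel w (16 * (ν + 4)) (log N) z y} with hBd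
  let E : Fin N → Set (EdgeIdx N → Bool) := fun x => {ω | (1 + c) ^ q ≤
    ev (es ω) (Root (Rel w (16 * (ν + 4)) (log N)) (fun x => w x < T) s (xi ν δ N) c x)}
  have hsub : Sᶜ ⊆ Bd ∪ ⋃ x, E x := by
    intro ω hω
    by_cases hb : ω ∈ Bd
    · exact Or.inl hb
    right
    have hb' : ∀ y z, degA (Adj ω) y ≤ degA (Adj ω) z → Rel w (16 * (ν + 4)) (log N) z y := by
      by_contra hcon
      exact hb hcon
    have hω' : ¬ ∀ x₁ : Fin N, x₁ ∈ VhA (Adj ω) ν δ → TS (Adj ω) r ν δ x₁ ≤ q := hω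
    push Not at hω'
    obtain ⟨x, hx, hlt⟩ := hω'
    obtain ⟨Z, hZ, hle⟩ := lb_main (R := Rel w (16 * (ν + 4)) (log N)) (exc := fun x => w x < T)
      hp.hs hp.hc hr ω hb' hx
    refine Set.mem_iUnion.2 ⟨x, ?_⟩
    change (1 + c) ^ q ≤ _
    refine le_trans ?_ hle
    rw [← rpow_natCast]
    refine rpow_le_rpow_of_exponent_le (by linarith) ?_
    rw [← hZ]; exact hlt.le
  have hE : ∀ x, grgMeasure w (E x) ≤ ENNReal.ofReal ((N : ℝ) ^ (-(ν + 1))) := by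
    intro x
    refine (markov hp.hw (NN_Root hp.hs hp.hc x) (rpow_pos_of_pos (by linarith) q)
      (hp.Root_le x)).trans (ENNReal.ofReal_le_ofReal ?_)
    rw [rpow_def_of_pos (show 0 < 1 + c by linarith), rpow_def_of_pos hN0, ← exp_sub, exp_le_exp]
    linarith
  have hG := good hp.hw h1 h2 hν hl
  have hG' : grgMeasure w Bd ≤ ENNReal.ofReal (2 * (N : ℝ) ^ (-ν)) := by
    refine hG.trans (ENNReal.ofReal_le_ofReal ?_)
    have e : exp (-((ν + 2) * log N)) = (N : ℝ) ^ (-ν) * (N : ℝ) ^ (-2 : ℝ) := by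
      rw [← rpow_add hN0, rpow_def_of_pos hN0]; congr 1; ring
    rw [e]
    have e2 : (N : ℝ) * (N : ℝ) ^ (-2 : ℝ) ≤ 1 := by
      nth_rewrite 1 [← rpow_one (N : ℝ)]
      rw [← rpow_add hN0]
      exact rpow_le_one_of_one_le_of_nonpos (by exact_mod_cast hN) (by norm_num)
    have e3 := rpow_pos_of_pos hN0 (-ν)
    nlinarith
  have hU : grgMeasure w (⋃ x, E x) ≤ ENNReal.ofReal ((N : ℝ) ^ (-ν)) := by
    refine (measure_iUnion_fintype_le _ _).trans ?_
    refine (Finset.sum_le_sum fun x _ => hE x).trans ?_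
    rw [Finset.sum_const, Finset.card_univ, Fintype.card_fin, nsmul_eq_mul,
      ← ENNReal.ofReal_natCast, ← ENNReal.ofReal_mul (Nat.cast_nonneg N)]
    refine ENNReal.ofReal_le_ofReal (le_of_eq ?_)
    nth_rewrite 1 [← rpow_one (N : ℝ)]
    rw [← rpow_add hN0]; congr 1; ring
  rw [tsub_le_iff_right]
  calc (1 : ENNReal) = grgMeasure w Set.univ := measure_univ.symm
    _ = grgMeasure w (S ∪ Sᶜ) := by rw [Set.union_compl_self]
    _ ≤ grgMeasure w S + grgMeasure w Sᶜ := measure_union_le _ _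
    _ ≤ grgMeasure w S + (grgMeasure w Bd + grgMeasure w (⋃ x, E x)) := by
      gcongr
      exact (measure_mono hsub).trans (measure_union_le _ _)
    _ ≤ grgMeasure w S + (ENNReal.ofReal (2 * (N : ℝ) ^ (-ν)) + ENNReal.ofReal ((N : ℝ) ^ (-ν))) := by
      gcongr
    _ = _ := by
      rw [← ENNReal.ofReal_add (by positivity) (by positivity)]
      congr 2; ring

lemma main
    (ε δ : ℝ) (hε : 0 < ε) (hε' : ε < 1 / 2) (hδ : 0 < δ) (hδ' : δ < 1 / 3)
    (r : ℕ) (hr : 6 ≤ r)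
    (w : (N : ℕ) → Fin N → ℝ)
    (hpos : ∀ N x, 0 < w N x)
    (hA1 : ∀ N x, w N x ≤ (N : ℝ) ^ ((1 : ℝ) / 2 - ε))
    (hA2m1 : ∀ N : ℕ, 1 ≤ N → (N : ℝ) ^ (-ε) ≤ m1 (w N))
    (hA2m2 : ∃ C > 0, ∀ N : ℕ, 2 ≤ N → m2 (w N) / m1 (w N) ≤ C * Real.log N ^ δ)
    (ν : ℝ) (hν : 0 < ν) :
    ∃ C > (0 : ℝ), ∀ N : ℕ,
      1 - ENNReal.ofReal (C * (N : ℝ) ^ (-ν)) ≤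
        grgMeasure (w N) {ω | ∀ x₁ : Fin N, x₁ ∈ VhA (Adj ω) ν δ →
          TS (Adj ω) r ν δ x₁ ≤ 2 * ν * (Real.log N / Real.log (Real.log N)) ^ 2} := by
  obtain ⟨Cb, hCb, hCbN⟩ := hA2m2
  have hc0 : 0 < 3 * (ν + 1) * (2 - 3 * δ) / ((1 - δ) * (1 - 2 * δ)) := by
    have a1 : 0 < 2 - 3 * δ := by linarith
    have a2 : 0 < 1 - δ := by linarith
    have a3 : 0 < 1 - 2 * δ := by linarith
    positivity
  have hA := asym (C0 := 16 * (ν + 4)) hδ hδ' hν hCb (by linarith) hc0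
  have hlogN : Tendsto (fun n : ℕ => log (n : ℝ)) atTop atTop :=
    tendsto_log_atTop.comp tendsto_natCast_atTop_atTop
  obtain ⟨N0, hN0⟩ := eventually_atTop.1 (hlogN.eventually hA)
  refine ⟨3 + ((max N0 4 : ℕ) : ℝ) ^ ν, by positivity, fun N => ?_⟩
  rcases Nat.eq_zero_or_pos N with rfl | hN
  · haveI := grg_prob (hpos 0)
    refine tsub_le_self.trans ?_
    rw [← measure_univ (μ := grgMeasure (w 0))]
    exact measure_mono fun ω _ x => x.elim0
  have hNr : (0 : ℝ) < N := by exact_mod_cast hN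
  by_cases hlt : N < max N0 4
  · have e : (1 : ℝ) ≤ (3 + ((max N0 4 : ℕ) : ℝ) ^ ν) * (N : ℝ) ^ (-ν) := by
      rw [rpow_neg hNr.le, ← div_eq_mul_inv, le_div_iff₀ (rpow_pos_of_pos hNr _), one_mul]
      have : (N : ℝ) ^ ν ≤ ((max N0 4 : ℕ) : ℝ) ^ ν :=
        rpow_le_rpow hNr.le (by exact_mod_cast hlt.le) hν.le
      linarith
    have e' : (1 : ENNReal) ≤ ENNReal.ofReal ((3 + ((max N0 4 : ℕ) : ℝ) ^ ν) * (N : ℝ) ^ (-ν)) := by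
      rw [← ENNReal.ofReal_one]; exact ENNReal.ofReal_le_ofReal e
    rw [tsub_eq_zero_of_le e']
    exact zero_le
  have hNN0 : N0 ≤ N := by omega
  have hN4 : 4 ≤ N := by omega
  have hN4' : (4 : ℝ) ≤ N := by exact_mod_cast hN4
  have hN1' : (1 : ℝ) ≤ N := by linarith
  obtain ⟨B, T, K, s, c, h0, Λ, hB, hB0, hT0, hTl, hK1, hlK, hs, hc, hh0, hΛ, c1, c2, c3, hfin⟩ :=
    hN0 N hNN0
  have hm1 := hA2m1 N hN
  have hWm : ∑ z, w N z = N * m1 (w N) := by unfold m1; field_simp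
  have hW : (N : ℝ) ^ (1 - ε) ≤ ∑ z, w N z := by
    rw [hWm, sub_eq_add_neg, rpow_add hNr, rpow_one]
    gcongr
  have hm1pos : 0 < m1 (w N) := lt_of_lt_of_le (rpow_pos_of_pos hNr _) hm1
  have h1 : ∀ x y, w N x * w N y ≤ ∑ z, w N z := by
    intro x y
    calc w N x * w N y ≤ (N : ℝ) ^ ((1 : ℝ) / 2 - ε) * (N : ℝ) ^ ((1 : ℝ) / 2 - ε) :=
          mul_le_mul (hA1 N x) (hA1 N y) (hpos N y).le (by positivity)
      _ = (N : ℝ) ^ (1 - 2 * ε) := by rw [← rpow_add hNr]; congr 1; ring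
      _ ≤ (N : ℝ) ^ (1 - ε) := rpow_le_rpow_of_exponent_le hN1' (by linarith)
      _ ≤ _ := hW
  have h2 : ∀ x, 2 * w N x ≤ ∑ z, w N z := by
    intro x
    have e : (2 : ℝ) ≤ (N : ℝ) ^ ((1 : ℝ) / 2) := by
      rw [← sqrt_eq_rpow]
      exact le_sqrt_of_sq_le (by linarith)
    calc 2 * w N x ≤ (N : ℝ) ^ ((1 : ℝ) / 2) * (N : ℝ) ^ ((1 : ℝ) / 2 - ε) :=
          mul_le_mul e (hA1 N x) (hpos N x).le (by positivity)
      _ = (N : ℝ) ^ (1 - ε) := by rw [← rpow_add hNr]; congr 1; ring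
      _ ≤ _ := hW
  have hBB : ∑ x, w N x ^ 2 ≤ B * ∑ x, w N x := by
    have e1 : ∑ x, w N x ^ 2 = N * m2 (w N) := by unfold m2; field_simp
    have e2 := hCbN N (by omega)
    rw [div_le_iff₀ hm1pos, ← hB] at e2
    rw [e1, hWm]
    nlinarith
  have hp : Par (w N) B T (log N) K (16 * (ν + 4)) s (xi ν δ N) c h0 Λ := by
    constructor <;> first | assumption | exact hpos N | linarith
  have := fixed_N hr hN hν h1 h2 hp hfin
  refine le_trans (tsub_le_tsub_left (ENNReal.ofReal_le_ofReal ?_) 1) this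
  gcongr
  have : (0 : ℝ) ≤ ((max N0 4 : ℕ) : ℝ) ^ ν := by positivity
  linarith

end TOB

open Classical GRG in
/-- Triple-overlap bound for down-up neighbourhoods of
high-degree vertices. Under (A1) and (A2), for every `ν > 0` and every `x₁ ∈ V_ν^{(h)}`,
with `ν`-high probability
`Σ_{x₂,x₃ ∈ V_ν^{(h)}, x₂ ≺ x₁, x₂ ≺ x₃} ⟨1_{S₁^du(x₁)}, 1_{S₁^du(x₂)}⟩ ·
⟨1_{S₁^du(x₂)∖S₁^du(x₁)}, 1_{S₁^du(x₃)}⟩ ≤ 2ν (log N/log log N)²`. -/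
theorem triple_overlap_bound
    (ε δ : ℝ) (hε : 0 < ε) (hε' : ε < 1 / 2) (hδ : 0 < δ) (hδ' : δ < 1 / 3)
    (r : ℕ) (hr : 6 ≤ r)
    (w : (N : ℕ) → Fin N → ℝ)
    (hpos : ∀ N x, 0 < w N x)
    (hA1 : ∀ N x, w N x ≤ (N : ℝ) ^ ((1 : ℝ) / 2 - ε))
    (hA2m1 : ∀ N : ℕ, 1 ≤ N → (N : ℝ) ^ (-ε) ≤ m1 (w N))
    (hA2m2 : ∃ C > 0, ∀ N : ℕ, 2 ≤ N → m2 (w N) / m1 (w N) ≤ C * Real.log N ^ δ)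
    (ν : ℝ) (hν : 0 < ν) :
    ∃ C > (0 : ℝ), ∀ N : ℕ,
      1 - ENNReal.ofReal (C * (N : ℝ) ^ (-ν)) ≤
        grgMeasure (w N) {ω | ∀ x₁ : Fin N, x₁ ∈ VhA (Adj ω) ν δ →
          (∑ x₂ : Fin N, ∑ x₃ : Fin N,
            if x₂ ∈ VhA (Adj ω) ν δ ∧ x₃ ∈ VhA (Adj ω) ν δ ∧
                precA (Adj ω) x₂ x₁ ∧ precA (Adj ω) x₂ x₃ then
              dotR (indVec (S1duA (Adj ω) r x₁)) (indVec (S1duA (Adj ω) r x₂)) *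
                dotR (indVec (S1duA (Adj ω) r x₂ \ S1duA (Adj ω) r x₁))
                  (indVec (S1duA (Adj ω) r x₃))
            else 0) ≤
          2 * ν * (Real.log N / Real.log (Real.log N)) ^ 2} := by
  exact TOB.main ε δ hε hε' hδ hδ' r hr w hpos hA1 hA2m1 hA2m2 ν hν
end

section
/- Overlap bound for down-up neighbourhoods of intermediate-degree vertices. Under assumptions (A1) and (A2), for every ν > 0 and every x_1 ∈ V_ν^(i), with ν-high probability Σ_{x_2 ∈ V_ν^(i), x_2 ≠ x_1} ⟨1_{S_1^du(x_1)}, 1_{S_1^du(x_2)}⟩ ≤ 2ν · log N / log log N. -/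
open MeasureTheory Real

namespace GRG

variable {N : ℕ}

/-- Decidable adjacency of an ordered pair. -/
noncomputable def adjB (ω : EdgeIdx N → Bool) (p : Fin N × Fin N) : Bool :=
  @decide (Adj ω p.1 p.2) (Classical.dec _)

/-- The edge index of an ordered pair (junk on the diagonal). -/
def mkE [Inhabited (EdgeIdx N)] (p : Fin N × Fin N) : EdgeIdx N :=
  if h : p.1 < p.2 then ⟨p, h⟩ else if h' : p.2 < p.1 then ⟨(p.2, p.1), h'⟩ else default

lemma adjB_mkE [Inhabited (EdgeIdx N)] (ω : EdgeIdx N → Bool) (p : Fin N × Fin N)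
    (hp : p.1 ≠ p.2) : adjB ω p = ω (mkE p) := by
  obtain ⟨x, y⟩ := p
  simp only [adjB, mkE, Adj, adjMatrix] at *
  rcases lt_or_gt_of_ne hp with h | h
  · simp [h]
  · simp [h, not_lt_of_gt h]

lemma Adj_symm {ω : EdgeIdx N → Bool} {x y : Fin N} (h : Adj ω x y) : Adj ω y x := by
  unfold Adj adjMatrix at *
  rcases lt_trichotomy x y with h1 | h1 | h1
  · simpa [h1, not_lt_of_gt h1] using h
  · subst h1; exact h
  · simpa [h1, not_lt_of_gt h1] using h

lemma Adj_ne {ω : EdgeIdx N → Bool} {x y : Fin N} (h : Adj ω x y) : x ≠ y := by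
  rintro rfl
  simp [Adj, adjMatrix] at h

lemma pGRG_symm (w : Fin N → ℝ) (x y : Fin N) : pGRG w x y = pGRG w y x := by
  simp [pGRG, mul_comm]

lemma pGRG_nonneg {w : Fin N → ℝ} (hw : ∀ x, 0 < w x) (x y : Fin N) : 0 ≤ pGRG w x y := by
  have := Finset.sum_nonneg (fun z (_ : z ∈ Finset.univ) => (hw z).le)
  have := mul_pos (hw x) (hw y)
  unfold pGRG; positivity

lemma pGRG_le_one {w : Fin N → ℝ} (hw : ∀ x, 0 < w x) (x y : Fin N) : pGRG w x y ≤ 1 := by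
  have := Finset.sum_nonneg (fun z (_ : z ∈ Finset.univ) => (hw z).le)
  have := mul_pos (hw x) (hw y)
  unfold pGRG
  rw [div_le_one (by linarith)]; linarith

lemma bern_prob {p : ℝ} (h0 : 0 ≤ p) (h1 : p ≤ 1) : IsProbabilityMeasure (bern p) := by
  constructor
  simp only [bern, Measure.coe_add, Measure.coe_smul, Pi.add_apply, Pi.smul_apply,
    smul_eq_mul, measure_univ, mul_one]
  rw [← ENNReal.ofReal_add h0 (by linarith)]
  simp

lemma grg_prob {w : Fin N → ℝ} (hw : ∀ x, 0 < w x) : IsProbabilityMeasure (grgMeasure w) := by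
  have : ∀ e : EdgeIdx N, IsProbabilityMeasure (bern (pGRG w e.val.1 e.val.2)) := fun e =>
    bern_prob (pGRG_nonneg hw _ _) (pGRG_le_one hw _ _)
  unfold grgMeasure
  infer_instance

lemma integral_bern {p : ℝ} (h0 : 0 ≤ p) (h1 : p ≤ 1) (f : Bool → ℝ) :
    ∫ b, f b ∂(bern p) = p * f true + (1 - p) * f false := by
  unfold bern
  rw [integral_add_measure (Integrable.of_finite.smul_measure ENNReal.ofReal_ne_top)
    (Integrable.of_finite.smul_measure ENNReal.ofReal_ne_top)]
  simp [integral_smul_measure, h0, h1]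

open Classical in
lemma int_prod {w : Fin N → ℝ} (hw : ∀ x, 0 < w x) (P : Finset (Fin N × Fin N))
    (hP : ∀ p ∈ P, p.1 ≠ p.2 ∧ (p.2, p.1) ∉ P) (G : Fin N × Fin N → Bool → ℝ) :
    ∫ ω, ∏ p ∈ P, G p (adjB ω p) ∂(grgMeasure w) =
      ∏ p ∈ P, (pGRG w p.1 p.2 * G p true + (1 - pGRG w p.1 p.2) * G p false) := by
  have := grg_prob hw
  rcases P.eq_empty_or_nonempty with rfl | ⟨⟨x0, y0⟩, hp0⟩
  · simp
  have : Nonempty (EdgeIdx N) := by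
    rcases lt_or_gt_of_ne (hP _ hp0).1 with h | h
    · exact ⟨⟨(_, _), h⟩⟩
    · exact ⟨⟨(_, _), h⟩⟩
  inhabit EdgeIdx N
  have hinj : Set.InjOn (mkE (N := N)) P := by
    rintro ⟨a, b⟩ hp ⟨c, d⟩ hq h
    have h1 := hP _ hp
    have h2 := hP _ hq
    simp only [Finset.mem_coe] at hp hq
    simp only at h1 h2
    simp only [mkE] at h
    rcases lt_or_gt_of_ne h1.1 with h3 | h3 <;> rcases lt_or_gt_of_ne h2.1 with h4 | h4 <;>
      simp [h3, h4, not_lt_of_gt h3, not_lt_of_gt h4] at h <;> obtain ⟨rfl, rfl⟩ := h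
    · rfl
    · exact absurd hq h1.2
    · exact absurd hq h1.2
    · rfl
  let H : EdgeIdx N → Bool → ℝ := fun e b =>
    if e.1 ∈ P then G e.1 b else if (e.1.2, e.1.1) ∈ P then G (e.1.2, e.1.1) b else 1
  have hH : ∀ p ∈ P, H (mkE p) = G p := by
    rintro ⟨a, b⟩ hp
    have h1 := hP _ hp
    funext t
    simp only at h1
    rcases lt_or_gt_of_ne h1.1 with h3 | h3
    · simp [H, mkE, h3, hp]
    · simp [H, mkE, h3, not_lt_of_gt h3, hp, h1.2]
  have hH1 : ∀ e, e ∉ P.image mkE → H e = fun _ => 1 := by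
    rintro ⟨⟨a, b⟩, hab⟩ he
    simp only [Finset.mem_image, not_exists, not_and] at he
    simp only at hab
    have ha : (a, b) ∉ P := fun h => he _ h (by simp [mkE, hab])
    have hb : (b, a) ∉ P := fun h => he _ h (by simp [mkE, hab, not_lt_of_gt hab])
    simp [H, ha, hb]
  have key : ∀ ω : EdgeIdx N → Bool, ∏ p ∈ P, G p (adjB ω p) = ∏ e, H e (ω e) := by
    intro ω
    rw [← Finset.prod_subset (Finset.subset_univ (P.image mkE))
      (fun e _ he => by rw [hH1 e he]), Finset.prod_image hinj]
    refine Finset.prod_congr rfl fun p hp => ?_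
    rw [hH p hp, adjB_mkE ω p (hP p hp).1]
  simp_rw [key]
  unfold grgMeasure
  rw [integral_fintype_prod_eq_prod]
  have : ∀ e : EdgeIdx N, ∫ b, H e b ∂(bern (pGRG w e.val.1 e.val.2)) =
      pGRG w e.val.1 e.val.2 * H e true + (1 - pGRG w e.val.1 e.val.2) * H e false :=
    fun e => integral_bern (pGRG_nonneg hw _ _) (pGRG_le_one hw _ _) _
  simp_rw [this]
  rw [← Finset.prod_subset (Finset.subset_univ (P.image mkE))
      (fun e _ he => by rw [hH1 e he]; ring), Finset.prod_image hinj]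
  refine Finset.prod_congr rfl fun p hp => ?_
  rw [hH p hp]
  have : pGRG w (mkE p).val.1 (mkE p).val.2 = pGRG w p.1 p.2 := by
    rcases lt_or_gt_of_ne (hP p hp).1 with h3 | h3
    · simp [mkE, h3]
    · simp [mkE, h3, not_lt_of_gt h3, pGRG_symm w p.1 p.2]
  rw [this]

open Classical in
lemma config_prob {w : Fin N → ℝ} (hw : ∀ x, 0 < w x) (P : Finset (Fin N × Fin N))
    (Z T : Finset (Fin N)) (hZ : Z ⊆ T) (hPT : ∀ p ∈ P, p.1 ∈ T ∧ p.2 ∈ T)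
    (hP : ∀ p ∈ P, p.1 ≠ p.2 ∧ (p.2, p.1) ∉ P) (ξ : ℝ) :
    (grgMeasure w).real {ω | (∀ p ∈ P, Adj ω p.1 p.2) ∧ ∀ z ∈ Z, (deg ω z : ℝ) < ξ} ≤
      (∏ p ∈ P, pGRG w p.1 p.2) *
        ∏ z ∈ Z, (2 ^ ξ * Real.exp (-(1 / 2) * ∑ u ∈ Tᶜ, pGRG w z u)) := by
  have := grg_prob hw
  set Q : Finset (Fin N × Fin N) := Z ×ˢ Tᶜ with hQ
  have hdisj : Disjoint P Q := by
    rw [Finset.disjoint_left]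
    intro p hp hq
    simp only [hQ, Finset.mem_product, Finset.mem_compl] at hq
    exact hq.2 (hPT p hp).2
  let G : Fin N × Fin N → Bool → ℝ := fun p b =>
    if p ∈ P then (if b then 1 else 0) else (if b then 1 / 2 else 1)
  have hint := int_prod hw (P ∪ Q) (by
    intro p hp
    rcases Finset.mem_union.1 hp with h | h
    · refine ⟨(hP p h).1, fun h' => ?_⟩
      rcases Finset.mem_union.1 h' with h' | h'
      · exact (hP p h).2 h'
      · simp only [hQ, Finset.mem_product, Finset.mem_compl] at h'
        exact h'.2 (hPT p h).1
    · simp only [hQ, Finset.mem_product, Finset.mem_compl] at h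
      refine ⟨fun h' => h.2 (h' ▸ hZ h.1), fun h' => ?_⟩
      rcases Finset.mem_union.1 h' with h' | h'
      · exact h.2 (hPT _ h').1
      · simp only [hQ, Finset.mem_product, Finset.mem_compl] at h'
        exact h'.2 (hZ h.1)) G
  have hGQ : ∀ p ∈ Q, G p = fun b => if b then 1 / 2 else 1 := by
    intro p hp
    have : p ∉ P := fun h => Finset.disjoint_left.1 hdisj h hp
    simp [G, this]
  have hGP : ∀ p ∈ P, G p = fun b => if b then 1 else 0 := by
    intro p hp
    simp [G, hp]
  have hG0 : ∀ p b, 0 ≤ G p b := by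
    intro p b
    simp only [G]; split_ifs <;> norm_num
  have h1 : (grgMeasure w).real
        {ω | (∀ p ∈ P, Adj ω p.1 p.2) ∧ ∀ z ∈ Z, (deg ω z : ℝ) < ξ} ≤
      ∫ ω, (∏ z ∈ Z, (2 : ℝ) ^ ξ) * ∏ p ∈ P ∪ Q, G p (adjB ω p) ∂(grgMeasure w) := by
    rw [← integral_indicator_one (MeasurableSet.of_discrete)]
    refine integral_mono (Integrable.of_finite) (Integrable.of_finite) fun ω => ?_
    by_cases hω : ω ∈ {ω | (∀ p ∈ P, Adj ω p.1 p.2) ∧ ∀ z ∈ Z, (deg ω z : ℝ) < ξ}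
    · rw [Set.indicator_of_mem hω]
      simp only [Pi.one_apply]
      obtain ⟨ha, hd⟩ := hω
      rw [Finset.prod_union hdisj]
      have e1 : ∏ p ∈ P, G p (adjB ω p) = 1 := by
        refine Finset.prod_eq_one fun p hp => ?_
        rw [hGP p hp]
        simp [adjB, ha p hp]
      rw [e1, one_mul, hQ, Finset.prod_product, ← Finset.prod_mul_distrib]
      rw [← Finset.prod_const_one (s := Z)]
      refine Finset.prod_le_prod (fun _ _ => zero_le_one) fun z hz => ?_
      have e2 : ∏ u ∈ Tᶜ, G (z, u) (adjB ω (z, u)) =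
          (1 / 2 : ℝ) ^ (Tᶜ.filter (fun u => Adj ω z u)).card := by
        rw [← Finset.prod_const, Finset.prod_filter]
        refine Finset.prod_congr rfl fun u hu => ?_
        rw [hGQ (z, u) (by simp only [hQ, Finset.mem_product]; exact ⟨hz, hu⟩)]
        simp [adjB]
      rw [e2]
      have e3 : (Tᶜ.filter (fun u => Adj ω z u)).card ≤ deg ω z := by
        unfold deg degA
        rw [← Set.ncard_coe_finset]
        refine Set.ncard_le_ncard ?_ (Set.toFinite _)
        intro u hu
        simp at hu
        exact hu.2
      have e4 : ((Tᶜ.filter (fun u => Adj ω z u)).card : ℝ) ≤ ξ :=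
        le_trans (by exact_mod_cast e3) (hd z hz).le
      rw [one_div, inv_pow, ← Real.rpow_natCast, ← div_eq_mul_inv, le_div_iff₀ (by positivity),
        one_mul]
      exact Real.rpow_le_rpow_of_exponent_le (by norm_num) e4
    · rw [Set.indicator_of_notMem hω]
      exact mul_nonneg (Finset.prod_nonneg fun _ _ => by positivity)
        (Finset.prod_nonneg fun p _ => hG0 _ _)
  refine h1.trans ?_
  rw [integral_const_mul, hint, Finset.prod_union hdisj]
  have e1 : ∏ p ∈ P, (pGRG w p.1 p.2 * G p true + (1 - pGRG w p.1 p.2) * G p false) =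
      ∏ p ∈ P, pGRG w p.1 p.2 := by
    refine Finset.prod_congr rfl fun p hp => ?_
    rw [hGP p hp]; simp
  have hP0 : 0 ≤ ∏ p ∈ P, pGRG w p.1 p.2 := Finset.prod_nonneg fun p _ => pGRG_nonneg hw _ _
  rw [e1, mul_left_comm]
  refine mul_le_mul_of_nonneg_left ?_ hP0
  rw [hQ, Finset.prod_product, ← Finset.prod_mul_distrib]
  have hterm : ∀ z ∈ Z, ∀ u ∈ Tᶜ,
      pGRG w z u * G (z, u) true + (1 - pGRG w z u) * G (z, u) false = 1 - pGRG w z u / 2 := by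
    intro z hz u hu
    rw [hGQ (z, u) (by simp only [hQ, Finset.mem_product]; exact ⟨hz, hu⟩)]
    simp; ring
  have hn : ∀ z u : Fin N, 0 ≤ 1 - pGRG w z u / 2 := fun z u => by
    linarith [pGRG_le_one hw z u]
  refine Finset.prod_le_prod (fun z hz => mul_nonneg (by positivity)
    (Finset.prod_nonneg fun u hu => by simp only [hterm z hz u hu]; exact hn z u)) fun z hz => ?_
  refine mul_le_mul_of_nonneg_left ?_ (by positivity)
  rw [Finset.mul_sum, Real.exp_sum]
  refine Finset.prod_le_prod (fun u hu => by simp only [hterm z hz u hu]; exact hn z u)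
    fun u hu => ?_
  simp only [hterm z hz u hu]
  have := Real.add_one_le_exp (-(1 / 2) * pGRG w z u)
  linarith

lemma pGRG_le {w : Fin N → ℝ} (hw : ∀ x, 0 < w x) (x y : Fin N) :
    pGRG w x y ≤ w x * (w y / ∑ z, w z) := by
  have h1 : 0 < ∑ z, w z := Finset.sum_pos (fun z _ => hw z) ⟨x, Finset.mem_univ _⟩
  have := mul_pos (hw x) (hw y)
  unfold pGRG
  rw [← mul_div_assoc]
  gcongr
  linarith

lemma sum_pGRG_le {w : Fin N → ℝ} (hw : ∀ x, 0 < w x) (x : Fin N) :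
    ∑ y, pGRG w x y ≤ w x := by
  have h1 : 0 < ∑ z, w z := Finset.sum_pos (fun z _ => hw z) ⟨x, Finset.mem_univ _⟩
  calc ∑ y, pGRG w x y ≤ ∑ y, w x * (w y / ∑ z, w z) :=
        Finset.sum_le_sum fun y _ => pGRG_le hw x y
    _ = w x := by
        rw [← Finset.mul_sum, ← Finset.sum_div, div_self h1.ne', mul_one]

lemma mean_ge {w : Fin N → ℝ} (hw : ∀ x, 0 < w x) {B : ℝ} (hB : ∀ x, w x ≤ B)
    (hB2 : 3 * B ^ 2 ≤ ∑ z, w z) (T : Finset (Fin N)) (hT : 3 * (T.card : ℝ) * B ≤ ∑ z, w z)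
    (z : Fin N) : w z / 2 ≤ ∑ u ∈ Tᶜ, pGRG w z u := by
  set S := ∑ z, w z with hS
  have h1 : 0 < S := Finset.sum_pos (fun z _ => hw z) ⟨z, Finset.mem_univ _⟩
  have h2 : ∀ u, w z * w u * (3 / (4 * S)) ≤ pGRG w z u := by
    intro u
    have h3 := mul_pos (hw z) (hw u)
    have h4 : w z * w u ≤ B ^ 2 := by
      rw [sq]; exact mul_le_mul (hB z) (hB u) (hw u).le ((hw z).le.trans (hB z))
    unfold pGRG
    rw [← hS, mul_div_assoc', div_le_div_iff₀ (by positivity) (by positivity)]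
    nlinarith
  have h3 : ∑ u ∈ T, w u ≤ T.card * B := by
    have := Finset.sum_le_card_nsmul T w B (fun u _ => hB u)
    simpa using this
  have h4 : ∑ u ∈ Tᶜ, w u = S - ∑ u ∈ T, w u := by
    rw [hS, ← Finset.sum_add_sum_compl T w]; ring
  calc w z / 2 = w z * (3 / (4 * S)) * (2 / 3 * S) := by field_simp; ring
    _ ≤ w z * (3 / (4 * S)) * ∑ u ∈ Tᶜ, w u := by
        have := hw z
        refine mul_le_mul_of_nonneg_left ?_ (by positivity)
        rw [h4]; linarith
    _ = ∑ u ∈ Tᶜ, w z * w u * (3 / (4 * S)) := by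
        rw [Finset.mul_sum]; exact Finset.sum_congr rfl fun u _ => by ring
    _ ≤ _ := Finset.sum_le_sum fun u _ => h2 u

lemma q_le {m ξ v : ℝ} (hξ : 0 ≤ ξ) (hm : v / 2 ≤ m) :
    (2 : ℝ) ^ ξ * Real.exp (-(1 / 2) * m) ≤ Real.exp (0.7 * ξ - v / 4) := by
  rw [Real.rpow_def_of_pos (by norm_num), ← Real.exp_add]
  apply Real.exp_le_exp.2
  have := Real.log_two_lt_d9
  nlinarith

open Classical in
/-- General bound, simplified. -/
lemma config_prob' {w : Fin N → ℝ} (hw : ∀ x, 0 < w x) {B : ℝ} (hB : ∀ x, w x ≤ B)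
    (hB2 : 3 * B ^ 2 ≤ ∑ z, w z)
    (P : Finset (Fin N × Fin N))
    (Z T : Finset (Fin N)) (hZ : Z ⊆ T) (hPT : ∀ p ∈ P, p.1 ∈ T ∧ p.2 ∈ T)
    (hP : ∀ p ∈ P, p.1 ≠ p.2 ∧ (p.2, p.1) ∉ P) {ξ W : ℝ} (hξ : 0 ≤ ξ)
    (hT : 3 * (T.card : ℝ) * B ≤ ∑ z, w z) (hW : ∀ z ∈ Z, W ≤ w z) :
    (grgMeasure w).real {ω | (∀ p ∈ P, Adj ω p.1 p.2) ∧ ∀ z ∈ Z, (deg ω z : ℝ) < ξ} ≤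
      (∏ p ∈ P, pGRG w p.1 p.2) * Real.exp (0.7 * ξ - W / 4) ^ Z.card := by
  refine (config_prob hw P Z T hZ hPT hP ξ).trans ?_
  refine mul_le_mul_of_nonneg_left ?_ (Finset.prod_nonneg fun p _ => pGRG_nonneg hw _ _)
  rw [← Finset.prod_const]
  refine Finset.prod_le_prod (fun _ _ => by positivity) fun z hz => ?_
  refine (q_le hξ (mean_ge hw hB hB2 T hT z)).trans ?_
  apply Real.exp_le_exp.2
  linarith [hW z hz]

open Classical in
lemma pre_prob {w : Fin N → ℝ} (hw : ∀ x, 0 < w x) {B : ℝ} (hB : ∀ x, w x ≤ B)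
    (hB2 : 3 * B ^ 2 ≤ ∑ z, w z) {ξ W : ℝ} (hξ : 0 ≤ ξ) (hT : 3 * B ≤ ∑ z, w z) :
    (grgMeasure w).real {ω | ∃ x, W < w x ∧ (deg ω x : ℝ) < ξ} ≤
      N * Real.exp (0.7 * ξ - W / 4) := by
  have := grg_prob hw
  calc (grgMeasure w).real {ω | ∃ x, W < w x ∧ (deg ω x : ℝ) < ξ}
      ≤ (grgMeasure w).real (⋃ x ∈ Finset.univ.filter (fun x => W < w x),
          {ω | (∀ p ∈ (∅ : Finset (Fin N × Fin N)), Adj ω p.1 p.2) ∧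
            ∀ z ∈ ({x} : Finset (Fin N)), (deg ω z : ℝ) < ξ}) := by
        refine measureReal_mono ?_ (measure_ne_top _ _)
        rintro ω ⟨x, h1, h2⟩
        simp only [Set.mem_iUnion]
        exact ⟨x, by simpa using h1, by simp, by simpa using h2⟩
    _ ≤ ∑ x ∈ Finset.univ.filter (fun x => W < w x), _ := measureReal_biUnion_finset_le _ _
    _ ≤ ∑ x ∈ Finset.univ.filter (fun x => W < w x), Real.exp (0.7 * ξ - W / 4) := by
        refine Finset.sum_le_sum fun x hx => ?_
        have := config_prob' hw hB hB2 ∅ {x} {x} (le_refl _) (by simp) (by simp) hξ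
          (W := W) (by simpa using hT) (by simpa using (Finset.mem_filter.1 hx).2.le)
        simpa using this
    _ ≤ ∑ x : Fin N, Real.exp (0.7 * ξ - W / 4) :=
        Finset.sum_le_sum_of_subset_of_nonneg (Finset.subset_univ _)
          (fun _ _ _ => by positivity)
    _ = _ := by simp

open Classical in
lemma star_prob {w : Fin N → ℝ} (hw : ∀ x, 0 < w x) {B : ℝ} (hB : ∀ x, w x ≤ B)
    (hB2 : 3 * B ^ 2 ≤ ∑ z, w z) (hB0 : 0 ≤ B) {ξ W : ℝ} (hξ : 0 ≤ ξ) (hW : 0 ≤ W) (k : ℕ)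
    (hT : 3 * ((k + 1 : ℕ) : ℝ) * B ≤ ∑ z, w z) :
    (grgMeasure w).real {ω | ∃ y, w y ≤ W ∧ ∃ z : Fin k → Fin N, Function.Injective z ∧
      ∀ i, 4 * ξ < w (z i) ∧ Adj ω y (z i) ∧ (deg ω (z i) : ℝ) < ξ} ≤
      N * (W * Real.exp (-0.3 * ξ)) ^ k := by
  have := grg_prob hw
  set I : Finset (Fin N) := Finset.univ.filter (fun y => w y ≤ W) with hI
  let J : Fin N → Finset (Fin k → Fin N) := fun y =>
    Finset.univ.filter (fun z => Function.Injective z ∧ ∀ i, 4 * ξ < w (z i) ∧ z i ≠ y)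
  let P : Fin N → (Fin k → Fin N) → Finset (Fin N × Fin N) := fun y z =>
    Finset.univ.image (fun i => (y, z i))
  let Ev : Fin N → (Fin k → Fin N) → Set (EdgeIdx N → Bool) := fun y z =>
    {ω | (∀ p ∈ P y z, Adj ω p.1 p.2) ∧ ∀ u ∈ Finset.univ.image z, (deg ω u : ℝ) < ξ}
  have hEv : ∀ y, ∀ z ∈ J y, (grgMeasure w).real (Ev y z) ≤
      ∏ i, (pGRG w y (z i) * Real.exp (-0.3 * ξ)) := by
    intro y z hz
    obtain ⟨hinj, hz⟩ := (Finset.mem_filter.1 hz).2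
    have hc : (Finset.univ.image z).card = k := by
      rw [Finset.card_image_of_injective _ hinj]; simp
    have h1 := config_prob' hw hB hB2 (P y z) (Finset.univ.image z)
      (insert y (Finset.univ.image z)) (Finset.subset_insert _ _)
      (by
        intro p hp
        simp only [P, Finset.mem_image, Finset.mem_univ, true_and] at hp
        obtain ⟨i, rfl⟩ := hp
        simp)
      (by
        intro p hp
        simp only [P, Finset.mem_image, Finset.mem_univ, true_and] at hp
        obtain ⟨i, rfl⟩ := hp
        refine ⟨(hz i).2.symm, fun h => ?_⟩
        simp only [P, Finset.mem_image, Finset.mem_univ, true_and, Prod.mk.injEq] at h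
        obtain ⟨j, h, _⟩ := h
        exact (hz i).2 h.symm) hξ (W := 4 * ξ)
      (by
        refine le_trans ?_ hT
        have : (insert y (Finset.univ.image z)).card ≤ k + 1 :=
          (Finset.card_insert_le _ _).trans (by rw [hc])
        gcongr)
      (by
        intro u hu
        simp only [Finset.mem_image, Finset.mem_univ, true_and] at hu
        obtain ⟨i, rfl⟩ := hu
        exact (hz i).1.le)
    refine h1.trans (le_of_eq ?_)
    rw [hc, Finset.prod_mul_distrib, Finset.prod_const, Finset.card_univ, Fintype.card_fin]
    congr 1
    · simp only [P]
      rw [Finset.prod_image]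
      intro i _ j _ h
      exact hinj (Prod.mk.inj h).2
    · congr 2; ring
  calc (grgMeasure w).real _
      ≤ (grgMeasure w).real (⋃ y ∈ I, ⋃ z ∈ J y, Ev y z) := by
        refine measureReal_mono ?_ (measure_ne_top _ _)
        rintro ω ⟨y, h1, z, hinj, hz⟩
        simp only [Set.mem_iUnion]
        refine ⟨y, by simpa [hI] using h1, z, ?_, ?_, ?_⟩
        · simp only [J, Finset.mem_filter, Finset.mem_univ, true_and]
          exact ⟨hinj, fun i => ⟨(hz i).1, (Adj_ne (hz i).2.1).symm⟩⟩
        · intro p hp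
          simp only [P, Finset.mem_image, Finset.mem_univ, true_and] at hp
          obtain ⟨i, rfl⟩ := hp
          exact (hz i).2.1
        · intro u hu
          simp only [Finset.mem_image, Finset.mem_univ, true_and] at hu
          obtain ⟨i, rfl⟩ := hu
          exact (hz i).2.2
    _ ≤ ∑ y ∈ I, (grgMeasure w).real (⋃ z ∈ J y, Ev y z) := measureReal_biUnion_finset_le _ _
    _ ≤ ∑ y ∈ I, (W * Real.exp (-0.3 * ξ)) ^ k := by
        refine Finset.sum_le_sum fun y hy => ?_
        have hyW : w y ≤ W := (Finset.mem_filter.1 hy).2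
        calc (grgMeasure w).real (⋃ z ∈ J y, Ev y z)
            ≤ ∑ z ∈ J y, (grgMeasure w).real (Ev y z) := measureReal_biUnion_finset_le _ _
          _ ≤ ∑ z ∈ J y, ∏ i, (pGRG w y (z i) * Real.exp (-0.3 * ξ)) :=
              Finset.sum_le_sum (hEv y)
          _ ≤ ∑ z : Fin k → Fin N, ∏ i, (pGRG w y (z i) * Real.exp (-0.3 * ξ)) :=
              Finset.sum_le_sum_of_subset_of_nonneg (Finset.subset_univ _) fun z _ _ =>
                Finset.prod_nonneg fun i _ => mul_nonneg (pGRG_nonneg hw _ _) (by positivity)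
          _ = (∑ u, pGRG w y u * Real.exp (-0.3 * ξ)) ^ k := by
              have := Fintype.prod_sum (fun (_ : Fin k) (u : Fin N) =>
                pGRG w y u * Real.exp (-0.3 * ξ))
              rw [← this]; simp
          _ ≤ (W * Real.exp (-0.3 * ξ)) ^ k := by
              rw [← Finset.sum_mul]
              have h0 : 0 ≤ ∑ u, pGRG w y u := Finset.sum_nonneg fun u _ => pGRG_nonneg hw _ _
              have h1 := (sum_pGRG_le hw y).trans hyW
              gcongr
    _ ≤ ∑ y : Fin N, (W * Real.exp (-0.3 * ξ)) ^ k :=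
        Finset.sum_le_sum_of_subset_of_nonneg (Finset.subset_univ _)
          (fun _ _ _ => by positivity)
    _ = _ := by simp

open Classical in
lemma path_prob {w : Fin N → ℝ} (hw : ∀ x, 0 < w x) {B : ℝ} (hB : ∀ x, w x ≤ B)
    (hB2 : 3 * B ^ 2 ≤ ∑ z, w z) (hB0 : 0 ≤ B) {ξ W : ℝ} (hξ : 0 ≤ ξ) (hW : 0 ≤ W) (k : ℕ)
    (hT : 3 * ((2 * k + 1 : ℕ) : ℝ) * B ≤ ∑ z, w z) :
    (grgMeasure w).real {ω | ∃ x, w x ≤ W ∧ ∃ c : Fin k → Fin N × Fin N,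
      Function.Injective (fun i => (c i).1) ∧ Function.Injective (fun i => (c i).2) ∧
      (∀ i j, (c i).1 ≠ (c j).2) ∧
      ∀ i, w (c i).1 ≤ W ∧ 4 * ξ < w (c i).2 ∧ (c i).2 ≠ x ∧ Adj ω x (c i).1 ∧
        Adj ω (c i).1 (c i).2 ∧ (deg ω (c i).2 : ℝ) < ξ} ≤
      N * (W ^ 2 * Real.exp (-0.3 * ξ)) ^ k := by
  have := grg_prob hw
  set I : Finset (Fin N) := Finset.univ.filter (fun y => w y ≤ W) with hI
  let J : Fin N → Finset (Fin k → Fin N × Fin N) := fun x =>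
    (Fintype.piFinset fun _ => I ×ˢ Finset.univ).filter (fun c =>
      Function.Injective (fun i => (c i).1) ∧ Function.Injective (fun i => (c i).2) ∧
      (∀ i j, (c i).1 ≠ (c j).2) ∧
      ∀ i, 4 * ξ < w (c i).2 ∧ (c i).2 ≠ x ∧ (c i).1 ≠ x)
  let P1 : Fin N → (Fin k → Fin N × Fin N) → Finset (Fin N × Fin N) := fun x c =>
    Finset.univ.image (fun i => (x, (c i).1))
  let P2 : (Fin k → Fin N × Fin N) → Finset (Fin N × Fin N) := fun c =>
    Finset.univ.image c
  let Z : (Fin k → Fin N × Fin N) → Finset (Fin N) := fun c =>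
    Finset.univ.image (fun i => (c i).2)
  let Y : (Fin k → Fin N × Fin N) → Finset (Fin N) := fun c =>
    Finset.univ.image (fun i => (c i).1)
  let Ev : Fin N → (Fin k → Fin N × Fin N) → Set (EdgeIdx N → Bool) := fun x c =>
    {ω | (∀ p ∈ P1 x c ∪ P2 c, Adj ω p.1 p.2) ∧ ∀ u ∈ Z c, (deg ω u : ℝ) < ξ}
  have hmem : ∀ x c p, p ∈ P1 x c ∪ P2 c ↔ (∃ i, (x, (c i).1) = p) ∨ ∃ i, c i = p := by
    intro x c p
    simp [P1, P2]
  have hEv : ∀ x, ∀ c ∈ J x, (grgMeasure w).real (Ev x c) ≤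
      ∏ i, (pGRG w x (c i).1 * pGRG w (c i).1 (c i).2 * Real.exp (-0.3 * ξ)) := by
    intro x c hc
    obtain ⟨hi1, hi2, hne, hc⟩ := (Finset.mem_filter.1 hc).2
    have hcZ : (Z c).card = k := by
      rw [Finset.card_image_of_injective _ hi2]; simp
    have hcY : (Y c).card = k := by
      rw [Finset.card_image_of_injective _ hi1]; simp
    have h1 := config_prob' hw hB hB2 (P1 x c ∪ P2 c) (Z c)
      (insert x (Y c ∪ Z c))
      (Finset.subset_union_right.trans (Finset.subset_insert _ _))
      (by
        intro p hp
        rw [hmem] at hp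
        rcases hp with ⟨i, rfl⟩ | ⟨i, rfl⟩ <;> simp [Y, Z])
      (by
        intro p hp
        rw [hmem] at hp ⊢
        rcases hp with ⟨i, rfl⟩ | ⟨i, rfl⟩
        · refine ⟨(hc i).2.2.symm, ?_⟩
          rintro (⟨j, h⟩ | ⟨j, h⟩)
          · exact (hc i).2.2 (congrArg Prod.fst h).symm
          · exact (hc j).2.1 (congrArg Prod.snd h)
        · refine ⟨hne i i, ?_⟩
          rintro (⟨j, h⟩ | ⟨j, h⟩)
          · exact (hc i).2.1 (congrArg Prod.fst h).symm
          · exact hne j i (congrArg Prod.fst h)) hξ (W := 4 * ξ)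
      (by
        refine le_trans ?_ hT
        have : (insert x (Y c ∪ Z c)).card ≤ 2 * k + 1 := by
          refine (Finset.card_insert_le _ _).trans ?_
          have := Finset.card_union_le (Y c) (Z c)
          omega
        gcongr)
      (by
        intro u hu
        simp only [Z, Finset.mem_image, Finset.mem_univ, true_and] at hu
        obtain ⟨i, rfl⟩ := hu
        exact (hc i).1.le)
    refine h1.trans (le_of_eq ?_)
    rw [hcZ, Finset.prod_mul_distrib, Finset.prod_const, Finset.card_univ, Fintype.card_fin]
    congr 1
    · rw [Finset.prod_union, Finset.prod_mul_distrib]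
      · congr 1
        · simp only [P1]
          rw [Finset.prod_image]
          intro i _ j _ h
          exact hi1 (Prod.mk.inj h).2
        · simp only [P2]
          rw [Finset.prod_image]
          intro i _ j _ h
          exact hi1 (congrArg Prod.fst h)
      · rw [Finset.disjoint_left]
        intro p hp hp'
        simp only [P1, P2, Finset.mem_image, Finset.mem_univ, true_and] at hp hp'
        obtain ⟨i, rfl⟩ := hp
        obtain ⟨j, h⟩ := hp'
        exact (hc j).2.2 (congrArg Prod.fst h)
    · congr 2; ring
  calc (grgMeasure w).real _
      ≤ (grgMeasure w).real (⋃ x ∈ I, ⋃ c ∈ J x, Ev x c) := by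
        refine measureReal_mono ?_ (measure_ne_top _ _)
        rintro ω ⟨x, h1, c, hi1, hi2, hne, hc⟩
        simp only [Set.mem_iUnion]
        refine ⟨x, by simpa [hI] using h1, c, ?_, ?_, ?_⟩
        · simp only [J, Finset.mem_filter, Fintype.mem_piFinset, Finset.mem_product,
            Finset.mem_univ, and_true]
          exact ⟨fun i => by simpa [hI] using (hc i).1, hi1, hi2, hne,
            fun i => ⟨(hc i).2.1, (hc i).2.2.1, (Adj_ne (hc i).2.2.2.1).symm⟩⟩
        · intro p hp
          rw [hmem] at hp
          rcases hp with ⟨i, rfl⟩ | ⟨i, rfl⟩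
          · exact (hc i).2.2.2.1
          · exact (hc i).2.2.2.2.1
        · intro u hu
          simp only [Z, Finset.mem_image, Finset.mem_univ, true_and] at hu
          obtain ⟨i, rfl⟩ := hu
          exact (hc i).2.2.2.2.2
    _ ≤ ∑ x ∈ I, (grgMeasure w).real (⋃ c ∈ J x, Ev x c) := measureReal_biUnion_finset_le _ _
    _ ≤ ∑ x ∈ I, (W ^ 2 * Real.exp (-0.3 * ξ)) ^ k := by
        refine Finset.sum_le_sum fun x hx => ?_
        have hxW : w x ≤ W := (Finset.mem_filter.1 hx).2
        calc (grgMeasure w).real (⋃ c ∈ J x, Ev x c)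
            ≤ ∑ c ∈ J x, (grgMeasure w).real (Ev x c) := measureReal_biUnion_finset_le _ _
          _ ≤ ∑ c ∈ J x, ∏ i, (pGRG w x (c i).1 * pGRG w (c i).1 (c i).2 *
                Real.exp (-0.3 * ξ)) :=
              Finset.sum_le_sum (hEv x)
          _ ≤ ∑ c ∈ Fintype.piFinset (fun _ : Fin k => I ×ˢ (Finset.univ : Finset (Fin N))),
                ∏ i, (pGRG w x (c i).1 * pGRG w (c i).1 (c i).2 * Real.exp (-0.3 * ξ)) :=
              Finset.sum_le_sum_of_subset_of_nonneg (Finset.filter_subset _ _) fun c _ _ =>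
                Finset.prod_nonneg fun i _ => mul_nonneg (mul_nonneg (pGRG_nonneg hw _ _)
                  (pGRG_nonneg hw _ _)) (by positivity)
          _ = (∑ p ∈ I ×ˢ (Finset.univ : Finset (Fin N)),
                pGRG w x p.1 * pGRG w p.1 p.2 * Real.exp (-0.3 * ξ)) ^ k := by
              have := Finset.prod_univ_sum
                (fun _ : Fin k => I ×ˢ (Finset.univ : Finset (Fin N)))
                (fun _ p => pGRG w x p.1 * pGRG w p.1 p.2 * Real.exp (-0.3 * ξ))
              rw [← this]; simp
          _ ≤ (W ^ 2 * Real.exp (-0.3 * ξ)) ^ k := by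
              rw [← Finset.sum_mul]
              have h0 : 0 ≤ ∑ p ∈ I ×ˢ (Finset.univ : Finset (Fin N)),
                  pGRG w x p.1 * pGRG w p.1 p.2 := Finset.sum_nonneg fun u _ =>
                    mul_nonneg (pGRG_nonneg hw _ _) (pGRG_nonneg hw _ _)
              have h1 : ∑ p ∈ I ×ˢ (Finset.univ : Finset (Fin N)),
                  pGRG w x p.1 * pGRG w p.1 p.2 ≤ W ^ 2 := by
                rw [Finset.sum_product]
                calc ∑ y ∈ I, ∑ z, pGRG w x y * pGRG w y z
                    ≤ ∑ y ∈ I, pGRG w x y * W := by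
                      refine Finset.sum_le_sum fun y hy => ?_
                      rw [← Finset.mul_sum]
                      exact mul_le_mul_of_nonneg_left
                        ((sum_pGRG_le hw y).trans (Finset.mem_filter.1 hy).2)
                        (pGRG_nonneg hw _ _)
                  _ ≤ ∑ y, pGRG w x y * W :=
                      Finset.sum_le_sum_of_subset_of_nonneg (Finset.subset_univ _)
                        fun y _ _ => mul_nonneg (pGRG_nonneg hw _ _) hW
                  _ ≤ W ^ 2 := by
                      rw [← Finset.sum_mul, sq]
                      exact mul_le_mul_of_nonneg_right ((sum_pGRG_le hw x).trans hxW) hW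
              gcongr
    _ ≤ ∑ x : Fin N, (W ^ 2 * Real.exp (-0.3 * ξ)) ^ k :=
        Finset.sum_le_sum_of_subset_of_nonneg (Finset.subset_univ _)
          (fun _ _ _ => by positivity)
    _ = _ := by simp

lemma not_triangle {A : Fin N → Fin N → Prop} {r : ℕ} (hr : 6 ≤ r) (hs : ∀ a b, A a b → A b a)
    (hi : ∀ a b, A a b → a ≠ b) {x y z : Fin N} (hxy : A x y) (hyz : A y z) (hzx : A x z) :
    y ∈ S1cycA A r x := by
  have h1 := hi _ _ hxy
  have h2 := hi _ _ hyz
  have h3 := hi _ _ hzx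
  refine ⟨hxy, 3, fun i => if i = 1 then y else if i = 2 then z else x, le_refl _, by omega,
    by simp, by simp, by simp, ?_, ?_⟩
  · intro i hi'
    interval_cases i
    · simpa using hxy
    · simpa using hyz
    · simpa using hs _ _ hzx
  · intro i j hij hj hne
    interval_cases j <;> interval_cases i <;> simp_all [Ne.symm h1, Ne.symm h3]

lemma not_square {A : Fin N → Fin N → Prop} {r : ℕ} (hr : 6 ≤ r) (hs : ∀ a b, A a b → A b a)
    (hi : ∀ a b, A a b → a ≠ b) {x y z y' : Fin N} (hxy : A x y) (hyz : A y z)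
    (hxy' : A x y') (hyz' : A y' z) (hxz : z ≠ x) (hyy : y ≠ y') :
    y ∈ S1cycA A r x := by
  have h1 := hi _ _ hxy
  have h2 := hi _ _ hyz
  have h3 := hi _ _ hxy'
  have h4 := hi _ _ hyz'
  refine ⟨hxy, 4, fun i => if i = 1 then y else if i = 2 then z else if i = 3 then y' else x,
    by norm_num, by omega, by simp, by simp, by simp, ?_, ?_⟩
  · intro i hi'
    interval_cases i
    · simpa using hxy
    · simpa using hyz
    · simpa using hs _ _ hyz'
    · simpa using hs _ _ hxy'
  · intro i j hij hj hne
    interval_cases j <;> interval_cases i <;>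
      simp_all [Ne.symm h1, Ne.symm h3, Ne.symm hxz, Ne.symm h4]

open Classical in
lemma det_bound (ω : EdgeIdx N → Bool) {r : ℕ} (hr : 6 ≤ r) (w : Fin N → ℝ) {ξ W : ℝ} (k : ℕ)
    (h1 : ¬ ∃ x, W < w x ∧ (deg ω x : ℝ) < ξ)
    (h2 : ¬ ∃ y, w y ≤ W ∧ ∃ z : Fin k → Fin N, Function.Injective z ∧
      ∀ i, 4 * ξ < w (z i) ∧ Adj ω y (z i) ∧ (deg ω (z i) : ℝ) < ξ)
    (h3 : ¬ ∃ x, w x ≤ W ∧ ∃ c : Fin k → Fin N × Fin N,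
      Function.Injective (fun i => (c i).1) ∧ Function.Injective (fun i => (c i).2) ∧
      (∀ i j, (c i).1 ≠ (c j).2) ∧
      ∀ i, w (c i).1 ≤ W ∧ 4 * ξ < w (c i).2 ∧ (c i).2 ≠ x ∧ Adj ω x (c i).1 ∧
        Adj ω (c i).1 (c i).2 ∧ (deg ω (c i).2 : ℝ) < ξ)
    (x₁ : Fin N) (hx₁ : (deg ω x₁ : ℝ) < ξ) :
    (∑ x₂ : Fin N, if ((deg ω x₂ : ℝ) < ξ ∧ 4 * ξ < w x₂) ∧ x₂ ≠ x₁ then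
      dotR (indVec (S1duA (Adj ω) r x₁)) (indVec (S1duA (Adj ω) r x₂)) else 0) ≤
      (k : ℝ) * k := by
  have hlight : ∀ x, (deg ω x : ℝ) < ξ → w x ≤ W := fun x hx => by
    by_contra h
    exact h1 ⟨x, not_le.1 h, hx⟩
  have hs : ∀ a b, Adj ω a b → Adj ω b a := fun a b h => Adj_symm h
  have hirr : ∀ a b, Adj ω a b → a ≠ b := fun a b h => Adj_ne h
  set Sd := S1duA (Adj ω) r with hSd
  let C : Fin N → Finset (Fin N) := fun y => Finset.univ.filter
    (fun x₂ => (((deg ω x₂ : ℝ) < ξ ∧ 4 * ξ < w x₂) ∧ x₂ ≠ x₁) ∧ y ∈ Sd x₂)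
  let Y : Finset (Fin N) := Finset.univ.filter (fun y => y ∈ Sd x₁ ∧ (C y).Nonempty)
  have hlY : ∀ y ∈ Sd x₁, w y ≤ W := by
    rintro y ⟨_, _, hp, _⟩
    apply hlight
    have : deg ω y ≤ deg ω x₁ := by
      rcases hp with h | h
      · exact h.le
      · exact h.1.le
    exact lt_of_le_of_lt (by exact_mod_cast this) hx₁
  have hC : ∀ y ∈ Sd x₁, (C y).card ≤ k := by
    intro y hy
    by_contra hk
    have hk' : k ≤ (C y).card := by omega
    refine h2 ⟨y, hlY y hy, (C y).orderEmbOfCardLe hk', ((C y).orderEmbOfCardLe hk').injective,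
      fun i => ?_⟩
    have := Finset.orderEmbOfCardLe_mem (C y) hk' i
    simp only [C, Finset.mem_filter, Finset.mem_univ, true_and] at this
    exact ⟨this.1.1.2, hs _ _ this.2.1, this.1.1.1⟩
  have hY : Y.card ≤ k := by
    by_contra hk
    have hk' : k ≤ Y.card := by omega
    have hex : ∀ y : Fin N, ∃ z, y ∈ Y → z ∈ C y := by
      intro y
      by_cases hy : y ∈ Y
      · obtain ⟨z, hz⟩ := (Finset.mem_filter.1 hy).2.2
        exact ⟨z, fun _ => hz⟩
      · exact ⟨y, fun h => absurd h hy⟩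
    choose f hf using hex
    have hf' : ∀ y ∈ Y, (((deg ω (f y) : ℝ) < ξ ∧ 4 * ξ < w (f y)) ∧ f y ≠ x₁) ∧
        Adj ω y (f y) := by
      intro y hy
      have := hf y hy
      simp only [C, Finset.mem_filter, Finset.mem_univ, true_and] at this
      exact ⟨this.1, hs _ _ this.2.1⟩
    have hYd : ∀ y ∈ Y, y ∈ Sd x₁ := fun y hy => (Finset.mem_filter.1 hy).2.1
    set g := Y.orderEmbOfCardLe hk' with hg
    have hgm : ∀ i, g i ∈ Y := fun i => Finset.orderEmbOfCardLe_mem Y hk' i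
    refine h3 ⟨x₁, hlight _ hx₁, fun i => (g i, f (g i)), g.injective, ?_, ?_, ?_⟩
    · intro i j hij
      by_contra hne
      have hne' : g i ≠ g j := fun h => hne (g.injective h)
      simp only at hij
      refine (hYd _ (hgm i)).2.1 (not_square hr hs hirr (hYd _ (hgm i)).1 (hf' _ (hgm i)).2
        (hYd _ (hgm j)).1 ?_ (hf' _ (hgm i)).1.2 hne')
      rw [hij]; exact (hf' _ (hgm j)).2
    · intro i j hij
      simp only at hij
      refine (hYd _ (hgm j)).2.1 (not_triangle hr hs hirr (hYd _ (hgm j)).1 (hf' _ (hgm j)).2 ?_)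
      rw [← hij]; exact (hYd _ (hgm i)).1
    · intro i
      exact ⟨hlY _ (hYd _ (hgm i)), (hf' _ (hgm i)).1.1.2, (hf' _ (hgm i)).1.2,
        (hYd _ (hgm i)).1, (hf' _ (hgm i)).2, (hf' _ (hgm i)).1.1.1⟩
  calc (∑ x₂ : Fin N, if ((deg ω x₂ : ℝ) < ξ ∧ 4 * ξ < w x₂) ∧ x₂ ≠ x₁ then
        dotR (indVec (Sd x₁)) (indVec (Sd x₂)) else 0)
      = ∑ x₂ : Fin N, ∑ y : Fin N, if y ∈ Sd x₁ then (if ((((deg ω x₂ : ℝ) < ξ ∧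
          4 * ξ < w x₂) ∧ x₂ ≠ x₁) ∧ y ∈ Sd x₂) then (1 : ℝ) else 0) else 0 := by
        refine Finset.sum_congr rfl fun x₂ _ => ?_
        split_ifs with h
        · unfold dotR indVec
          refine Finset.sum_congr rfl fun y _ => ?_
          by_cases ha : y ∈ Sd x₁ <;> by_cases hb : y ∈ Sd x₂ <;> simp [ha, hb, h]
        · rw [Finset.sum_eq_zero]
          intro y _
          split_ifs with ha hb
          · exact absurd hb.1 h
          · rfl
          · rfl
    _ = ∑ y : Fin N, if y ∈ Sd x₁ then ((C y).card : ℝ) else 0 := by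
        rw [Finset.sum_comm]
        refine Finset.sum_congr rfl fun y _ => ?_
        split_ifs
        · simp [C]
        · simp
    _ = ∑ y ∈ Y, ((C y).card : ℝ) := by
        simp only [Y]
        rw [Finset.sum_filter]
        refine Finset.sum_congr rfl fun y _ => ?_
        by_cases ha : y ∈ Sd x₁ <;> by_cases hb : (C y).Nonempty
        · simp [ha, hb]
        · rw [Finset.not_nonempty_iff_eq_empty] at hb
          simp [hb]
        · simp [ha]
        · simp [ha]
    _ ≤ ∑ y ∈ Y, (k : ℝ) := Finset.sum_le_sum fun y hy => by
        exact_mod_cast hC y (Finset.mem_filter.1 hy).2.1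
    _ = Y.card * k := by simp
    _ ≤ (k : ℝ) * k := by
        have : (Y.card : ℝ) ≤ k := by exact_mod_cast hY
        gcongr

lemma asymp {c ν ε : ℝ} (hc : 0 < c) (hν : 0 < ν) (hε : 0 < ε) :
    ∀ᶠ t : ℝ in Filter.atTop, 1 ≤ t ∧ c ≤ t ∧ (t ^ 2 + 1) ^ 2 ≤ 2 * ν * (Real.exp t / t) ∧
      (4 * (ν + 2) * Real.exp t) ^ 2 ≤ Real.exp (0.2 * (c * (Real.exp t / t))) ∧
      ν + 1 ≤ 0.1 * c * t ∧ 3 ≤ Real.exp (ε * Real.exp t) ∧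
      3 * (2 * (t ^ 2 + 1) + 1) ≤ Real.exp (Real.exp t / 2) := by
  have l5 := (Real.tendsto_pow_mul_exp_neg_atTop_nhds_zero 5).eventually_le_const
    (show (0 : ℝ) < ν / 2 by positivity)
  have l2 := (Real.tendsto_pow_mul_exp_neg_atTop_nhds_zero 2).eventually_le_const
    (show (0 : ℝ) < c / 20 by positivity)
  have l2' := (Real.tendsto_pow_mul_exp_neg_atTop_nhds_zero 2).eventually_le_const
    (show (0 : ℝ) < 1 / 15 by positivity)
  filter_upwards [l5, l2, l2', Filter.eventually_ge_atTop 1, Filter.eventually_ge_atTop c,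
    Filter.eventually_ge_atTop ((ν + 1) / (0.1 * c)), Filter.eventually_ge_atTop (2 / ε),
    Filter.eventually_ge_atTop (Real.log (4 * (ν + 2)))] with t h5 h2 h2' h1 hct hd he hl
  have hE := Real.exp_pos t
  have t0 : 0 < t := by linarith
  rw [Real.exp_neg, ← div_eq_mul_inv, div_le_iff₀ hE] at h5 h2 h2'
  refine ⟨h1, hct, ?_, ?_, ?_, ?_, ?_⟩
  · rw [← mul_div_assoc, le_div_iff₀ t0]
    have : (t ^ 2 + 1) ^ 2 ≤ (2 * t ^ 2) ^ 2 := by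
      gcongr; nlinarith
    nlinarith
  · have : 4 * (ν + 2) * Real.exp t = Real.exp (Real.log (4 * (ν + 2)) + t) := by
      rw [Real.exp_add, Real.exp_log (by positivity)]
    rw [this, ← Real.exp_nat_mul]
    apply Real.exp_le_exp.2
    have : 4 * t ≤ 0.2 * (c * (Real.exp t / t)) := by
      rw [← mul_div_assoc, ← mul_div_assoc, le_div_iff₀ t0]
      nlinarith
    push_cast
    linarith
  · rw [div_le_iff₀ (by positivity)] at hd
    linarith
  · rw [div_le_iff₀ hε] at he
    have h3 := Real.add_one_le_exp (ε * Real.exp t)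
    have h4 := Real.add_one_le_exp t
    nlinarith
  · have h3 : t ≤ Real.exp t / 2 := by nlinarith
    have h4 : Real.exp t ≤ Real.exp (Real.exp t / 2) := Real.exp_le_exp.2 h3
    nlinarith

set_option maxHeartbeats 1000000 in
open Classical in
lemma main_large {ε δ : ℝ} (hδ : 0 < δ) (hδ' : δ < 1 / 3) {r : ℕ} (hr : 6 ≤ r)
    (ν : ℝ) (hν : 0 < ν) {N : ℕ} (w : Fin N → ℝ) (hpos : ∀ x, 0 < w x)
    (hA1 : ∀ x, w x ≤ (N : ℝ) ^ ((1 : ℝ) / 2 - ε))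
    (hA2 : (N : ℝ) ^ (-ε) ≤ m1 w) (hN : 3 ≤ N)
    (has : ∀ c t : ℝ, c = 3 * (ν + 1) * (2 - 3 * δ) / ((1 - δ) * (1 - 2 * δ)) →
      t = Real.log (Real.log N) →
      1 ≤ t ∧ c ≤ t ∧ (t ^ 2 + 1) ^ 2 ≤ 2 * ν * (Real.exp t / t) ∧
      (4 * (ν + 2) * Real.exp t) ^ 2 ≤ Real.exp (0.2 * (c * (Real.exp t / t))) ∧
      ν + 1 ≤ 0.1 * c * t ∧ 3 ≤ Real.exp (ε * Real.exp t) ∧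
      3 * (2 * (t ^ 2 + 1) + 1) ≤ Real.exp (Real.exp t / 2)) :
    1 - ENNReal.ofReal (3 * (N : ℝ) ^ (-ν)) ≤
        grgMeasure w {ω | ∀ x₁ : Fin N,
          ((deg ω x₁ : ℝ) < xi ν δ N ∧ 4 * xi ν δ N < w x₁) →
          (∑ x₂ : Fin N,
            if ((deg ω x₂ : ℝ) < xi ν δ N ∧ 4 * xi ν δ N < w x₂) ∧ x₂ ≠ x₁ then
              dotR (indVec (S1duA (Adj ω) r x₁)) (indVec (S1duA (Adj ω) r x₂))
            else 0) ≤
          2 * ν * (Real.log N / Real.log (Real.log N))} := by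
  have := grg_prob hpos
  obtain ⟨c, hcd⟩ : ∃ c, c = 3 * (ν + 1) * (2 - 3 * δ) / ((1 - δ) * (1 - 2 * δ)) := ⟨_, rfl⟩
  obtain ⟨t, htd⟩ : ∃ t, t = Real.log (Real.log N) := ⟨_, rfl⟩
  obtain ⟨a1, a2, a3, a4, a5, a6, a7⟩ := has c t hcd htd
  have hc : 0 < c := by
    rw [hcd]
    have : 0 < 2 - 3 * δ := by linarith
    have : 0 < 1 - δ := by linarith
    have : 0 < 1 - 2 * δ := by linarith
    positivity
  have hN3 : (3 : ℝ) ≤ N := by exact_mod_cast hN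
  have hN0 : (0 : ℝ) < N := by linarith
  have hℓ : 0 < Real.log N := Real.log_pos (by linarith)
  have het : Real.exp t = Real.log N := by rw [htd, Real.exp_log hℓ]
  rw [het] at a3 a4 a6 a7
  set ℓ := Real.log N with hℓd
  have hξ : xi ν δ N = c * (ℓ / t) := by rw [xi, hcd, htd]
  rw [hξ, ← htd]
  set ξ := c * (ℓ / t) with hξd
  have ht0 : 0 < t := by linarith
  have hξ0 : 0 < ξ := by positivity
  have hξℓ : ξ ≤ ℓ := by
    rw [hξd, ← mul_div_assoc, div_le_iff₀ ht0]
    nlinarith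
  set W := 4 * (ν + 2) * ℓ with hWd
  have hNpow : ∀ s : ℝ, (N : ℝ) ^ s = Real.exp (ℓ * s) := fun s => by
    rw [Real.rpow_def_of_pos hN0]
  have hNexp : (N : ℝ) = Real.exp ℓ := (Real.exp_log hN0).symm
  set k := ⌈t ^ 2⌉₊ with hk
  have hk1 : t ^ 2 ≤ k := Nat.le_ceil _
  have hk2 : (k : ℝ) ≤ t ^ 2 + 1 := (Nat.ceil_lt_add_one (by positivity)).le
  have hℓ1 : 1 ≤ ℓ := by
    rw [← het]; linarith [Real.add_one_le_exp t]
  have hW1 : 1 ≤ W := by nlinarith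
  -- weights
  set B := (N : ℝ) ^ ((1 : ℝ) / 2 - ε) with hBd
  have hB0 : 0 < B := by positivity
  have hS : (N : ℝ) ^ (1 - ε) ≤ ∑ z, w z := by
    have : (N : ℝ) ^ (1 - ε) = N ^ (-ε) * N := by
      rw [sub_eq_neg_add, Real.rpow_add hN0, Real.rpow_one]
    rw [this]
    rwa [m1, le_div_iff₀ hN0] at hA2
  have hB2 : 3 * B ^ 2 ≤ ∑ z, w z := by
    refine le_trans ?_ hS
    have : (N : ℝ) ^ (1 - ε) = Real.exp (ε * ℓ) * B ^ 2 := by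
      rw [hBd, hNpow, hNpow, ← Real.exp_nat_mul, ← Real.exp_add]
      congr 1; push_cast; ring
    rw [this]
    gcongr
  have hT : ∀ m : ℕ, m ≤ 2 * k + 1 → 3 * (m : ℝ) * B ≤ ∑ z, w z := by
    intro m hm
    refine le_trans ?_ hS
    have : (N : ℝ) ^ (1 - ε) = Real.exp (ℓ / 2) * B := by
      rw [hBd, hNpow, hNpow, ← Real.exp_add]
      congr 1; ring
    rw [this]
    have hm' : (m : ℝ) ≤ 2 * k + 1 := by exact_mod_cast hm
    gcongr
    linarith
  have b1 := pre_prob hpos hA1 hB2 (W := W) hξ0.le (by simpa using hT 1 (by omega))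
  have b2 := star_prob hpos hA1 hB2 hB0.le (W := W) hξ0.le (by linarith) k
    (hT (k + 1) (by omega))
  have b3 := path_prob hpos hA1 hB2 hB0.le (W := W) hξ0.le (by linarith) k
    (hT (2 * k + 1) (by omega))
  have hfin : N * (W ^ 2 * Real.exp (-0.3 * ξ)) ^ k ≤ (N : ℝ) ^ (-ν) := by
    have h1 : W ^ 2 * Real.exp (-0.3 * ξ) ≤ Real.exp (-0.1 * ξ) := by
      calc W ^ 2 * Real.exp (-0.3 * ξ) ≤ Real.exp (0.2 * ξ) * Real.exp (-0.3 * ξ) := by gcongr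
        _ = _ := by rw [← Real.exp_add]; congr 1; ring
    calc N * (W ^ 2 * Real.exp (-0.3 * ξ)) ^ k ≤ N * Real.exp (-0.1 * ξ) ^ k := by gcongr
      _ = Real.exp (ℓ + k * (-0.1 * ξ)) := by
          rw [← Real.exp_nat_mul, Real.exp_add, ← hNexp]
      _ ≤ _ := by
          rw [hNpow]
          apply Real.exp_le_exp.2
          have h2 : t ^ 2 * ξ ≤ k * ξ := by gcongr
          have h3 : t ^ 2 * ξ = c * t * ℓ := by rw [hξd]; field_simp
          have h4 : (ν + 1) * ℓ ≤ 0.1 * c * t * ℓ := mul_le_mul_of_nonneg_right a5 hℓ.le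
          linarith
  have b1' : N * Real.exp (0.7 * ξ - W / 4) ≤ (N : ℝ) ^ (-ν) := by
    rw [hNpow]
    calc N * Real.exp (0.7 * ξ - W / 4) = Real.exp (ℓ + (0.7 * ξ - W / 4)) := by
          rw [Real.exp_add, ← hNexp]
      _ ≤ _ := by
          apply Real.exp_le_exp.2
          have h4 : W / 4 = ν * ℓ + 2 * ℓ := by rw [hWd]; ring
          linarith
  have b2' : N * (W * Real.exp (-0.3 * ξ)) ^ k ≤ (N : ℝ) ^ (-ν) := by
    refine le_trans ?_ hfin
    have : W ≤ W ^ 2 := by nlinarith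
    gcongr
  set E1 := {ω : EdgeIdx N → Bool | ∃ x, W < w x ∧ (deg ω x : ℝ) < ξ} with hE1
  set E2 := {ω : EdgeIdx N → Bool | ∃ y, w y ≤ W ∧ ∃ z : Fin k → Fin N,
      Function.Injective z ∧
      ∀ i, 4 * ξ < w (z i) ∧ Adj ω y (z i) ∧ (deg ω (z i) : ℝ) < ξ} with hE2
  set E3 := {ω : EdgeIdx N → Bool | ∃ x, w x ≤ W ∧ ∃ c : Fin k → Fin N × Fin N,
      Function.Injective (fun i => (c i).1) ∧ Function.Injective (fun i => (c i).2) ∧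
      (∀ i j, (c i).1 ≠ (c j).2) ∧
      ∀ i, w (c i).1 ≤ W ∧ 4 * ξ < w (c i).2 ∧ (c i).2 ≠ x ∧ Adj ω x (c i).1 ∧
        Adj ω (c i).1 (c i).2 ∧ (deg ω (c i).2 : ℝ) < ξ} with hE3
  have hbad : (grgMeasure w).real (E1 ∪ E2 ∪ E3) ≤ 3 * (N : ℝ) ^ (-ν) := by
    have u1 := measureReal_union_le (μ := grgMeasure w) (E1 ∪ E2) E3
    have u2 := measureReal_union_le (μ := grgMeasure w) E1 E2
    linarith
  calc 1 - ENNReal.ofReal (3 * (N : ℝ) ^ (-ν)) ≤ 1 - grgMeasure w (E1 ∪ E2 ∪ E3) := by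
        refine tsub_le_tsub_left ?_ 1
        rw [← ofReal_measureReal]
        exact ENNReal.ofReal_le_ofReal hbad
    _ = grgMeasure w (E1 ∪ E2 ∪ E3)ᶜ :=
        (prob_compl_eq_one_sub (MeasurableSet.of_discrete)).symm
    _ ≤ _ := by
        refine measure_mono ?_
        intro ω hω x₁ hx₁
        simp only [Set.mem_compl_iff, Set.mem_union, not_or] at hω
        refine (det_bound ω hr w k hω.1.1 hω.1.2 hω.2 x₁ hx₁.1).trans (le_trans ?_ a3)
        rw [← sq]
        gcongr

end GRG

open Classical GRG in
/-- Overlap bound for down-up neighbourhoods of intermediate-degree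
vertices. Under (A1) and (A2), for every `ν > 0` and `x₁ ∈ V_ν^{(i)}`, with `ν`-high
probability `Σ_{x₂ ∈ V_ν^{(i)}, x₂ ≠ x₁} ⟨1_{S₁^du(x₁)}, 1_{S₁^du(x₂)}⟩ ≤
2ν log N / log log N`, where `V_ν^{(i)} = {x : D_x < ξ_ν, w_x > 4ξ_ν}`. -/
theorem intermediate_overlap_bound
    (ε δ : ℝ) (hε : 0 < ε) (hε' : ε < 1 / 2) (hδ : 0 < δ) (hδ' : δ < 1 / 3)
    (r : ℕ) (hr : 6 ≤ r)
    (w : (N : ℕ) → Fin N → ℝ)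
    (hpos : ∀ N x, 0 < w N x)
    (hA1 : ∀ N x, w N x ≤ (N : ℝ) ^ ((1 : ℝ) / 2 - ε))
    (hA2m1 : ∀ N : ℕ, 1 ≤ N → (N : ℝ) ^ (-ε) ≤ m1 (w N))
    (hA2m2 : ∃ C > 0, ∀ N : ℕ, 2 ≤ N → m2 (w N) / m1 (w N) ≤ C * Real.log N ^ δ)
    (ν : ℝ) (hν : 0 < ν) :
    ∃ C > (0 : ℝ), ∀ N : ℕ,
      1 - ENNReal.ofReal (C * (N : ℝ) ^ (-ν)) ≤
        grgMeasure (w N) {ω | ∀ x₁ : Fin N,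
          ((deg ω x₁ : ℝ) < xi ν δ N ∧ 4 * xi ν δ N < w N x₁) →
          (∑ x₂ : Fin N,
            if ((deg ω x₂ : ℝ) < xi ν δ N ∧ 4 * xi ν δ N < w N x₂) ∧ x₂ ≠ x₁ then
              dotR (indVec (S1duA (Adj ω) r x₁)) (indVec (S1duA (Adj ω) r x₂))
            else 0) ≤
          2 * ν * (Real.log N / Real.log (Real.log N))} := by
  have hc : 0 < 3 * (ν + 1) * (2 - 3 * δ) / ((1 - δ) * (1 - 2 * δ)) := by
    have : 0 < 2 - 3 * δ := by linarith
    have : 0 < 1 - δ := by linarith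
    have : 0 < 1 - 2 * δ := by linarith
    positivity
  have hlim : Filter.Tendsto (fun N : ℕ => Real.log (Real.log (N : ℝ))) Filter.atTop
      Filter.atTop :=
    Real.tendsto_log_atTop.comp (Real.tendsto_log_atTop.comp tendsto_natCast_atTop_atTop)
  obtain ⟨N₀, hN₀⟩ := Filter.eventually_atTop.1 (hlim.eventually (asymp hc hν hε))
  set M := max N₀ 3 with hM
  have hM0 : (0 : ℝ) < M := by
    have : 3 ≤ M := le_max_right _ _
    exact_mod_cast (by omega : 0 < M)
  refine ⟨3 + (M : ℝ) ^ ν, by positivity, fun N => ?_⟩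
  rcases Nat.eq_zero_or_pos N with rfl | hNpos
  · have := grg_prob (hpos 0)
    refine tsub_le_self.trans ?_
    rw [← measure_univ (μ := grgMeasure (w 0))]
    exact measure_mono fun ω _ x => x.elim0
  have hN0 : (0 : ℝ) < N := by exact_mod_cast hNpos
  by_cases hNM : M ≤ N
  · refine le_trans (tsub_le_tsub_left (ENNReal.ofReal_le_ofReal ?_) 1)
      (main_large (ε := ε) hδ hδ' hr ν hν (w N) (hpos N) (hA1 N) (hA2m1 N hNpos)
        (le_trans (le_max_right _ _) hNM) ?_)
    · have : 0 < (M : ℝ) ^ ν := by positivity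
      gcongr
      linarith
    · rintro c t rfl rfl
      exact hN₀ N (le_trans (le_max_left _ _) hNM)
  · have h1 : (1 : ℝ) ≤ (3 + (M : ℝ) ^ ν) * (N : ℝ) ^ (-ν) := by
      have h2 : (N : ℝ) ^ ν ≤ (M : ℝ) ^ ν := by
        have : (N : ℝ) ≤ M := by exact_mod_cast (not_le.1 hNM).le
        gcongr
      rw [Real.rpow_neg hN0.le, ← div_eq_mul_inv, le_div_iff₀ (by positivity)]
      linarith
    rw [tsub_eq_zero_of_le]
    · exact zero_le
    · rw [← ENNReal.ofReal_one]
      exact ENNReal.ofReal_le_ofReal h1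
end
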